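/- arXiv:2409.07979 — 2 statements merged into one kernel-verified Lean document; each statement's English description precedes it below -/
import Mathlib

section
/- Let T, S : X → X be homeomorphisms of a compact metric space X such that (X,T) and (X,S) are minimal, and suppose (X,S) is multiply k-minimal for some k ∈ ℕ. Then there is a residual subset X_0 of X such that for any x ∈ X_0 and any nonlinear integral polynomials p_1, …, p_d vanishing at 0, there is a sequence (n_i) of integers with n_i → ∞ such that S^{n_i}x → x, S^{2n_i}x → x, …, S^{kn_i}x → x, and T^{p_j(n_i)}x → x for every j = 1, …, d. -/
open Filter Topology Function Set

/-- Iterates of a homeomorphism indexed by `ℕ`. -/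
def hpowNat {X : Type*} [TopologicalSpace X] (T : X ≃ₜ X) : ℕ → X ≃ₜ X
  | 0 => Homeomorph.refl X
  | n + 1 => (hpowNat T n).trans T

/-- Iterates of a homeomorphism indexed by `ℤ`. -/
def hpowInt {X : Type*} [TopologicalSpace X] (T : X ≃ₜ X) : ℤ → X ≃ₜ X
  | Int.ofNat n => hpowNat T n
  | Int.negSucc n => (hpowNat T (n + 1)).symm

/-- The `n`-th iterate (`n : ℤ`) of the homeomorphism `T`, as a map. -/
def hpow {X : Type*} [TopologicalSpace X] (T : X ≃ₜ X) (n : ℤ) : X → X :=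
  ⇑(hpowInt T n)

/-- The (two-sided) orbit of `x` under the homeomorphism `T`. -/
def zorbit {X : Type*} [TopologicalSpace X] (T : X ≃ₜ X) (x : X) : Set X :=
  Set.range fun n : ℤ => hpow T n x

/-- `(X,T)` is a minimal t.d.s.: every orbit is dense. -/
def IsMinimalTDS {X : Type*} [TopologicalSpace X] (T : X ≃ₜ X) : Prop :=
  ∀ x : X, Dense (zorbit T x)

/-- `z` is a minimal point of `(Z,S)`: its orbit closure is a minimal subsystem, i.e.
every point of the orbit closure of `z` has the same orbit closure as `z`. -/
def IsMinimalPoint {Z : Type*} [TopologicalSpace Z] (S : Z ≃ₜ Z) (z : Z) : Prop :=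
  ∀ w ∈ closure (zorbit S z), closure (zorbit S w) = closure (zorbit S z)

/-- `p : ℤ → ℤ` is a nonlinear integral polynomial vanishing at `0`: it agrees on `ℤ`
with a polynomial (with rational coefficients) of degree at least `2`, and `p 0 = 0`. -/
def IsNonlinearIntPoly0 (p : ℤ → ℤ) : Prop :=
  p 0 = 0 ∧ ∃ q : Polynomial ℚ, (∀ n : ℤ, (p n : ℚ) = q.eval (n : ℚ)) ∧ 2 ≤ q.natDegree

/-- `(X,S)` (minimal) is multiply `k`-minimal: there is a dense `Gδ` set `Ω ⊆ X` such
that for every `x ∈ Ω` the diagonal point `(x, …, x)` is a minimal point of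
`(X^k, S × S² × ⋯ × S^k)`. -/
def MultiplyMinimal {X : Type*} [TopologicalSpace X] (S : X ≃ₜ X) (k : ℕ) : Prop :=
  ∃ Ω : Set X, IsGδ Ω ∧ Dense Ω ∧ ∀ x ∈ Ω,
    IsMinimalPoint (Homeomorph.piCongrRight fun i : Fin k => hpowNat S ((i : ℕ) + 1))
      (fun _ => x)

open Filter Topology Function Set

attribute [instance] Ultrafilter.add Ultrafilter.addSemigroup

structure Act (Γ X : Type*) [AddCommGroup Γ] [TopologicalSpace X] where
  f : Γ → X → X
  cont : ∀ a, Continuous (f a)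
  zero : ∀ x, f 0 x = x
  add : ∀ a b x, f (a + b) x = f a (f b x)

namespace Act
variable {Γ X : Type*} [AddCommGroup Γ] [TopologicalSpace X] (φ : Act Γ X)

theorem neg_f (a : Γ) (x : X) : φ.f (-a) (φ.f a x) = x := by
  rw [← φ.add, neg_add_cancel, φ.zero]
theorem f_neg (a : Γ) (x : X) : φ.f a (φ.f (-a) x) = x := by
  rw [← φ.add, add_neg_cancel, φ.zero]
theorem comm (a b : Γ) (x : X) : φ.f a (φ.f b x) = φ.f b (φ.f a x) := by
  rw [← φ.add, ← φ.add, add_comm]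
end Act

section ultra
variable {X : Type*} [TopologicalSpace X] [CompactSpace X] [T2Space X] (φ : Act ℤ X)

noncomputable def pt (p : Ultrafilter ℤ) (x : X) : X :=
  Ultrafilter.extend (fun n : ℤ => φ.f n x) p

theorem tendsto_pt (p : Ultrafilter ℤ) (x : X) :
    Tendsto (fun n => φ.f n x) p (𝓝 (pt φ p x)) :=
  (ultrafilter_extend_eq_iff (f := fun n : ℤ => φ.f n x) (b := p)).1 rfl

theorem pt_eq {p : Ultrafilter ℤ} {x y : X} (h : Tendsto (fun n => φ.f n x) p (𝓝 y)) :
    pt φ p x = y :=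
  tendsto_nhds_unique (tendsto_pt φ p x) h

theorem pt_cont (x : X) : Continuous (fun p => pt φ p x) :=
  continuous_ultrafilter_extend _

theorem pt_add (p q : Ultrafilter ℤ) (x : X) : pt φ (p + q) x = pt φ p (pt φ q x) := by
  by_contra hne
  obtain ⟨U, V, hU, hV, h1, h2, hd⟩ := t2_separation hne
  have a1 : ∀ᶠ m in (↑(p + q) : Filter ℤ), φ.f m x ∈ U := tendsto_pt φ _ x (hU.mem_nhds h1)
  have a2 : ∀ᶠ m in (p : Filter ℤ), φ.f m (pt φ q x) ∈ V := tendsto_pt φ _ _ (hV.mem_nhds h2)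
  rw [Ultrafilter.eventually_add] at a1
  obtain ⟨m, b1, b2⟩ := (a1.and a2).exists
  have a3 : ∀ᶠ n in (q : Filter ℤ), φ.f m (φ.f n x) ∈ V :=
    ((φ.cont m).continuousAt.tendsto.comp (tendsto_pt φ q x)) (hV.mem_nhds b2)
  obtain ⟨n, c1, c2⟩ := (b1.and a3).exists
  rw [φ.add] at c1
  exact Set.disjoint_left.1 hd c1 c2

theorem pt_pure (n : ℤ) (x : X) : pt φ (pure n) x = φ.f n x :=
  pt_eq φ (by rw [Ultrafilter.coe_pure]; exact tendsto_pure_nhds _ _)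

def MinIdem (u : Ultrafilter ℤ) : Prop :=
  u + u = u ∧ ∀ q : Ultrafilter ℤ, ∃ q' : Ultrafilter ℤ, q' + (q + u) = u

theorem MinIdem.add_idem {u e s : Ultrafilter ℤ} (hu : MinIdem u) (he : e + e = e)
    (hs : e = s + u) : u + e = u := by
  obtain ⟨q', h⟩ := hu.2 s
  rw [← hs] at h
  rw [← h, add_assoc, he]

theorem exists_min_left_ideal : ∃ L : Set (Ultrafilter ℤ), IsClosed L ∧ L.Nonempty ∧
    (∀ p ∈ L, ∀ q, q + p ∈ L) ∧ ∀ p ∈ L, ∀ r ∈ L, ∃ q, q + p = r := by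
  let S : Set (Set (Ultrafilter ℤ)) :=
    { N | IsClosed N ∧ N.Nonempty ∧ ∀ p ∈ N, ∀ q, q + p ∈ N }
  rsuffices ⟨L, hL⟩ : ∃ L, Minimal (· ∈ S) L
  · refine ⟨L, hL.prop.1, hL.prop.2.1, hL.prop.2.2, fun p hp r hr => ?_⟩
    have : (Set.range fun q : Ultrafilter ℤ => q + p) = L := by
      apply hL.eq_of_subset
      · refine ⟨(isCompact_range (Ultrafilter.continuous_add_left p)).isClosed, ⟨p + p, p, rfl⟩, ?_⟩
        rintro _ ⟨a, rfl⟩ q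
        exact ⟨q + a, add_assoc _ _ _⟩
      · rintro _ ⟨a, rfl⟩
        exact hL.prop.2.2 p hp a
    rw [← this] at hr
    exact hr
  refine zorn_superset _ fun c hcs hc => ?_
  refine ⟨⋂₀ c, ⟨isClosed_sInter fun t ht => (hcs ht).1, ?_, fun m hm m' => ?_⟩, fun s hs =>
      Set.sInter_subset_of_mem hs⟩
  · obtain rfl | hcnemp := c.eq_empty_or_nonempty
    · rw [Set.sInter_empty]
      exact ⟨pure 0, trivial⟩
    rw [Set.sInter_eq_iInter]
    have := hcnemp.coe_sort
    refine IsCompact.nonempty_iInter_of_directed_nonempty_isCompact_isClosed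
        ((↑) : c → Set (Ultrafilter ℤ)) ?_ ?_ ?_ ?_
    · exact DirectedOn.directed_val (IsChain.directedOn hc.symm)
    exacts [fun i => (hcs i.prop).2.1, fun i => (hcs i.prop).1.isCompact, fun i => (hcs i.prop).1]
  · rw [Set.mem_sInter]
    exact fun t ht => (hcs ht).2.2 m (Set.mem_sInter.mp hm t ht) m'

theorem exists_minIdem (hmin : ∀ x, Dense (range fun n => φ.f n x)) (x : X) :
    ∃ u, MinIdem u ∧ pt φ u x = x := by
  obtain ⟨L, hLc, ⟨p0, hp0⟩, hLi, hLm⟩ := exists_min_left_ideal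
  have hcl : IsClosed ((fun p => pt φ p x) '' L) :=
    (hLc.isCompact.image (pt_cont φ x)).isClosed
  have huniv : (fun p => pt φ p x) '' L = univ := by
    rw [← hcl.closure_eq]
    refine ((hmin (pt φ p0 x)).mono ?_).closure_eq
    rintro _ ⟨n, rfl⟩
    refine ⟨pure n + p0, hLi _ hp0 _, ?_⟩
    simp only [pt_add, pt_pure]
  obtain ⟨p1, hp1, hp1x⟩ : x ∈ (fun p => pt φ p x) '' L := huniv ▸ mem_univ x
  obtain ⟨u, ⟨huL, hux⟩, huu⟩ := exists_idempotent_in_compact_add_subsemigroup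
    (M := Ultrafilter ℤ) Ultrafilter.continuous_add_left (L ∩ {p | pt φ p x = x})
    ⟨p1, hp1, hp1x⟩ (hLc.inter (isClosed_eq (pt_cont φ x) continuous_const)).isCompact
    (by
      rintro a ⟨ha, ha'⟩ b ⟨hb, hb'⟩
      refine ⟨hLi _ hb _, ?_⟩
      simp only [Set.mem_ofPred_eq] at *
      rw [pt_add, hb', ha'])
  exact ⟨u, ⟨huu, fun q => hLm _ (hLi _ huL q) _ huL⟩, hux⟩

theorem exists_pt_eq (hmin : ∀ x, Dense (range fun n => φ.f n x)) (x y : X) :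
    ∃ q, pt φ q x = y := by
  have hcl : IsClosed (range (fun p => pt φ p x)) :=
    (isCompact_range (pt_cont φ x)).isClosed
  have huniv : range (fun p => pt φ p x) = univ := by
    rw [← hcl.closure_eq]
    refine ((hmin x).mono ?_).closure_eq
    rintro _ ⟨n, rfl⟩
    exact ⟨pure n, pt_pure φ n x⟩
  have : y ∈ range (fun p => pt φ p x) := huniv ▸ mem_univ y
  exact this
end ultra

/-- finite sums in idempotent filters -/
theorem ip_filter {Γ : Type*} [AddCommMonoid Γ] (l : Filter Γ) [NeBot l]
    (hl : ∀ A ∈ l, ∀ᶠ m in l, ∀ᶠ n in l, m + n ∈ A) {A : Set Γ} (hA : A ∈ l) (D : ℕ) :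
    ∃ n : ℕ → Γ, ∀ α ⊆ Finset.range D, (∀ᶠ m in l, ∑ j ∈ α, n j + m ∈ A) ∧
      (α.Nonempty → ∑ j ∈ α, n j ∈ A) := by
  induction D with
  | zero =>
    refine ⟨fun _ => 0, fun α hα => ?_⟩
    have : α = ∅ := by simpa using hα
    subst this
    simpa using hA
  | succ D ih =>
    obtain ⟨n, hn⟩ := ih
    have h1 : ∀ᶠ m in l, ∀ α ∈ (Finset.range D).powerset, (∑ j ∈ α, n j + m ∈ A) ∧
        ∀ᶠ m' in l, ∑ j ∈ α, n j + (m + m') ∈ A := by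
      rw [Filter.eventually_all_finset]
      intro α hα
      rw [Finset.mem_powerset] at hα
      exact ((hn α hα).1).and (hl _ (hn α hα).1)
    obtain ⟨m, hm⟩ := h1.exists
    refine ⟨Function.update n D m, fun α hα => ?_⟩
    by_cases hD : D ∈ α
    · have hsub : α.erase D ⊆ Finset.range D := by
        intro j hj
        have h1 := Finset.ne_of_mem_erase hj
        have h2 := Finset.mem_range.1 (hα (Finset.mem_of_mem_erase hj))
        exact Finset.mem_range.2 (by omega)
      have hs : ∑ j ∈ α, Function.update n D m j = ∑ j ∈ α.erase D, n j + m := by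
        rw [← Finset.sum_erase_add _ _ hD]
        simp only [Function.update_self]
        congr 1
        refine Finset.sum_congr rfl fun j hj => ?_
        rw [Function.update_of_ne (Finset.ne_of_mem_erase hj)]
      rw [hs]
      have := hm _ (Finset.mem_powerset.2 hsub)
      refine ⟨?_, fun _ => this.1⟩
      simpa only [add_assoc] using this.2
    · have hsub : α ⊆ Finset.range D := by
        intro j hj
        have h2 := Finset.mem_range.1 (hα hj)
        have : j ≠ D := fun h => hD (h ▸ hj)
        exact Finset.mem_range.2 (by omega)
      have hs : ∑ j ∈ α, Function.update n D m j = ∑ j ∈ α, n j := by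
        refine Finset.sum_congr rfl fun j hj => ?_
        have hjD : j ≠ D := fun h => hD (h ▸ hj)
        rw [Function.update_of_ne hjD]
      rw [hs]
      exact hn α hsub

theorem idem_filter {Γ : Type*} [AddCommGroup Γ] {u : Ultrafilter Γ} (hu : u + u = u) :
    ∀ A ∈ (u : Filter Γ), ∀ᶠ m in (u : Filter Γ), ∀ᶠ n in (u : Filter Γ), m + n ∈ A := by
  intro A hA
  have : ∀ᶠ m in (↑(u + u) : Filter Γ), m ∈ A := by rw [hu]; exact hA
  exact (Ultrafilter.eventually_add u u _).1 this

theorem ip_ultra {u : Ultrafilter ℤ} (hu : u + u = u) {A : Set ℤ} (hA : A ∈ u) (D : ℕ) :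
    ∃ n : ℕ → ℤ, ∀ α ⊆ Finset.range D, α.Nonempty → ∑ j ∈ α, n j ∈ A := by
  obtain ⟨n, hn⟩ := ip_filter (u : Filter ℤ) (idem_filter hu) hA D
  exact ⟨n, fun α h1 h2 => (hn α h1).2 h2⟩

theorem map_add_ultra {Γ : Type*} [AddCommGroup Γ] (χ : Γ →+ ℤ) (p q : Ultrafilter Γ) :
    (p + q).map χ = p.map χ + q.map χ := by
  refine Ultrafilter.coe_inj.mp (Filter.ext' fun P => ?_)
  simp only [Ultrafilter.eventually_add, Ultrafilter.coe_map, Filter.eventually_map, map_add]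

section SYN
variable {X : Type*} [TopologicalSpace X] [CompactSpace X] [T2Space X] (φ : Act ℤ X)

theorem UR {Γ ι : Type*} [AddCommGroup Γ] (χ : ι → Γ →+ ℤ) (uh : Ultrafilter Γ)
    (u : Ultrafilter ℤ) (hχ : ∀ i, uh.map (χ i) = u) (hu : MinIdem u) (y : X)
    (hy : pt φ u y = y) (q : Ultrafilter Γ) :
    ∃ r : Ultrafilter Γ, ∀ i, Tendsto (fun γ => φ.f (χ i γ) y) (↑(r + q) : Filter Γ) (𝓝 y) := by
  obtain ⟨v, ⟨s, rfl⟩, hv⟩ := exists_idempotent_in_compact_add_subsemigroup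
    (M := Ultrafilter Γ) Ultrafilter.continuous_add_left (range fun s => s + (q + uh))
    ⟨_, q, rfl⟩ (isCompact_range (Ultrafilter.continuous_add_left _))
    (by
      rintro _ ⟨a, rfl⟩ _ ⟨b, rfl⟩
      exact ⟨a + (q + uh) + b, add_assoc _ _ _⟩)
  refine ⟨uh + s, fun i => ?_⟩
  have h1 : pt φ ((uh + s + q).map (χ i)) y = y := by
    conv_lhs => rw [← hy]
    rw [← pt_add, map_add_ultra, map_add_ultra, hχ]
    have h2 : u + (s + (q + uh)).map (χ i) = u := by
      refine hu.add_idem (s := s.map (χ i) + q.map (χ i)) ?_ ?_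
      · rw [← map_add_ultra]
        exact congrArg _ hv
      · rw [map_add_ultra, map_add_ultra, hχ, add_assoc]
    rw [map_add_ultra, map_add_ultra, hχ] at h2
    rw [add_assoc, add_assoc, h2, hy]
  have h3 := tendsto_pt φ ((uh + s + q).map (χ i)) y
  rw [h1] at h3
  exact h3

theorem SYN {Γ ι : Type*} [Finite ι] [AddCommGroup Γ] (χ : ι → Γ →+ ℤ) (uh : Ultrafilter Γ)
    (u : Ultrafilter ℤ) (hχ : ∀ i, uh.map (χ i) = u) (hu : MinIdem u) (y : X)
    (hy : pt φ u y = y) (W : Set X) (hW : W ∈ 𝓝 y) :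
    ∃ Φ : Finset Γ, ∀ γ, ∃ a ∈ Φ, ∀ i, φ.f (χ i (a + γ)) y ∈ W := by
  classical
  by_contra hcon
  push Not at hcon
  obtain ⟨q, hq⟩ := Ultrafilter.exists_ultrafilter_of_finite_inter_nonempty
    (range fun a : Γ => {γ | ∃ i, φ.f (χ i (a + γ)) y ∉ W}) (by
      intro T hT
      choose g hg using fun t : T => hT t.2
      obtain ⟨γ, hγ⟩ := hcon (Finset.univ.image g)
      refine ⟨γ, ?_⟩
      rw [mem_sInter]
      intro t ht
      have := hγ (g ⟨t, ht⟩) (Finset.mem_image_of_mem _ (Finset.mem_univ _))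
      have h2 := hg ⟨t, ht⟩
      simp only at h2
      rw [← h2]
      exact this)
  obtain ⟨r, hr⟩ := UR φ χ uh u hχ hu y hy q
  have h1 : ∀ᶠ γ in (↑(r + q) : Filter Γ), ∀ i, φ.f (χ i γ) y ∈ W := by
    rw [Filter.eventually_all]
    exact fun i => hr i hW
  rw [Ultrafilter.eventually_add] at h1
  obtain ⟨a, ha⟩ := h1.exists
  have h2 : ∀ᶠ γ in (q : Filter Γ), ∃ i, φ.f (χ i (a + γ)) y ∉ W := hq ⟨a, rfl⟩
  obtain ⟨γ, h3, i, h4⟩ := (ha.and h2).exists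
  exact h4 (h3 i)

/-- the sum homomorphism -/
def sumHom (α : Finset ℕ) : (ℕ → ℤ) →+ ℤ where
  toFun n := ∑ j ∈ α, n j
  map_zero' := by simp
  map_add' a b := by simp [Finset.sum_add_distrib]

abbrev NF (D : ℕ) : Type := {α : Finset ℕ // α ⊆ Finset.range D ∧ α.Nonempty}

instance (D : ℕ) : Finite (NF D) :=
  Finite.of_injective (β := (Finset.range D).powerset)
    (fun α => ⟨α.1, Finset.mem_powerset.2 α.2.1⟩)
    (fun a b h => Subtype.ext (by simpa using h))

theorem exists_uh {u : Ultrafilter ℤ} (hu : u + u = u) (D : ℕ) :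
    ∃ uh : Ultrafilter (ℕ → ℤ), ∀ α : NF D, uh.map (sumHom α.1) = u := by
  let N : Set ℤ → Set (ℕ → ℤ) := fun A => {n | ∀ α : NF D, sumHom α.1 n ∈ A}
  have hN : Monotone N := fun A B h n hn α => h (hn α)
  have : NeBot ((u : Filter ℤ).lift' N) := by
    rw [lift'_neBot_iff hN]
    intro A hA
    obtain ⟨n, hn⟩ := ip_ultra hu hA D
    exact ⟨n, fun α => hn _ α.2.1 α.2.2⟩
  refine ⟨Ultrafilter.of ((u : Filter ℤ).lift' N), fun α => ?_⟩
  refine Ultrafilter.coe_le_coe.1 fun A hA => ?_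
  have h1 : N A ∈ Ultrafilter.of ((u : Filter ℤ).lift' N) :=
    Ultrafilter.of_le _ (mem_lift' hA)
  exact Filter.mem_of_superset (f := (Ultrafilter.of ((u : Filter ℤ).lift' N) : Filter (ℕ → ℤ)))
    (x := N A) h1 fun n hn => hn α

theorem SYN1 (hmin : ∀ x, Dense (range fun n => φ.f n x)) (y : X) (D : ℕ)
    (W : Set X) (hW : W ∈ 𝓝 y) :
    ∃ Φ : Finset (ℕ → ℤ), ∀ γ, ∃ a ∈ Φ, ∀ α : NF D, φ.f (sumHom α.1 (a + γ)) y ∈ W := by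
  obtain ⟨u, hu, huy⟩ := exists_minIdem φ hmin y
  obtain ⟨uh, huh⟩ := exists_uh hu.1 D
  exact SYN φ (fun α : NF D => sumHom α.1) uh u huh hu y huy W hW

theorem SYN2 (hmin : ∀ x, Dense (range fun n => φ.f n x)) (y : X) (C : Finset ℤ)
    (W : Set X) (hW : W ∈ 𝓝 y) :
    ∃ Φ : Finset (ℤ × ℤ), ∀ a b : ℤ, ∃ s ∈ Φ, φ.f (s.1 + a) y ∈ W ∧
      ∀ c ∈ C, φ.f (s.1 + a + c * (s.2 + b)) y ∈ W := by
  classical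
  obtain ⟨u, hu, huy⟩ := exists_minIdem φ hmin y
  let χ : (insert 0 C : Finset ℤ) → ℤ × ℤ →+ ℤ := fun c =>
    AddMonoidHom.fst ℤ ℤ + (AddMonoidHom.mulLeft (c : ℤ)).comp (AddMonoidHom.snd ℤ ℤ)
  obtain ⟨Φ, hΦ⟩ := SYN φ χ (u.map fun a => (a, 0)) u (by
    intro c
    rw [Ultrafilter.map_map]
    convert Ultrafilter.map_id u
    ext a
    simp [χ]) hu y huy W hW
  refine ⟨Φ, fun a b => ?_⟩
  obtain ⟨s, hs, h⟩ := hΦ (a, b)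
  refine ⟨s, hs, ?_, fun c hc => ?_⟩
  · simpa [χ] using h ⟨0, Finset.mem_insert_self _ _⟩
  · simpa [χ] using h ⟨c, Finset.mem_insert_of_mem hc⟩
end SYN

set_option linter.unusedVariables false
open Filter Topology Function Set

section rel
variable {X : Type*} [TopologicalSpace X] (φ : Act ℤ X)

def relP (x y : X) : Prop :=
  ∀ D : ℕ, ∀ W ∈ 𝓝 y, ∃ n : ℕ → ℤ, ∀ α : NF D, φ.f (sumHom α.1 n) x ∈ W

def relR (x y : X) : Prop :=
  ∀ D : ℕ, ∀ V ∈ 𝓝 x, ∀ W ∈ 𝓝 y, ∃ x' ∈ V, ∃ n : ℕ → ℤ,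
    ∀ α : NF D, φ.f (sumHom α.1 n) x' ∈ W

variable {φ}

theorem relP.relR {x y : X} (h : relP φ x y) : relR φ x y := fun D V hV W hW =>
  ⟨x, mem_of_mem_nhds hV, h D W hW⟩

theorem relR_refl (x : X) : relR φ x x := fun D V hV W hW =>
  ⟨x, mem_of_mem_nhds hV, 0, fun α => by
    rw [map_zero, φ.zero]; exact mem_of_mem_nhds hW⟩

theorem relR.act {x y : X} (h : relR φ x y) (a : ℤ) : relR φ (φ.f a x) (φ.f a y) := by
  intro D V hV W hW
  obtain ⟨x', hx', n, hn⟩ := h D _ ((φ.cont a).continuousAt hV) _ ((φ.cont a).continuousAt hW)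
  refine ⟨φ.f a x', hx', n, fun α => ?_⟩
  rw [φ.comm]
  exact hn α

theorem isClosed_relR : IsClosed {z : X × X | relR φ z.1 z.2} := by
  refine isClosed_of_closure_subset fun z hz D V hV W hW => ?_
  rw [mem_closure_iff_nhds] at hz
  obtain ⟨z', ⟨h1, h2⟩, h3⟩ := hz _ (prod_mem_nhds (interior_mem_nhds.2 hV) (interior_mem_nhds.2 hW))
  obtain ⟨x', hx', n, hn⟩ := h3 D _ (isOpen_interior.mem_nhds h1) _ (isOpen_interior.mem_nhds h2)
  exact ⟨x', interior_subset hx', n, fun α => interior_subset (hn α)⟩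

theorem nf_nhds {x y : X} {D : ℕ} {W : Set X} (hW : W ∈ 𝓝 y) {n : ℕ → ℤ}
    (hn : ∀ α : NF D, φ.f (sumHom α.1 n) x ∈ interior W) :
    ∀ᶠ x' in 𝓝 x, ∀ α : NF D, φ.f (sumHom α.1 n) x' ∈ W := by
  rw [eventually_all]
  intro α
  exact (φ.cont _).continuousAt (mem_interior_iff_mem_nhds.1 (hn α))

theorem relP.trans {x y z : X} (h1 : relP φ x y) (h2 : relP φ y z) : relP φ x z := by
  intro D W hW
  obtain ⟨n, hn⟩ := h2 D _ (interior_mem_nhds.2 hW)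
  obtain ⟨m, hm⟩ := h1 D _ (nf_nhds hW hn)
  refine ⟨n + m, fun α => ?_⟩
  rw [map_add, φ.add]
  exact hm α α

theorem relR.transP {x y z : X} (h1 : relR φ x y) (h2 : relP φ y z) : relR φ x z := by
  intro D V hV W hW
  obtain ⟨n, hn⟩ := h2 D _ (interior_mem_nhds.2 hW)
  obtain ⟨x', hx', m, hm⟩ := h1 D V hV _ (nf_nhds hW hn)
  refine ⟨x', hx', n + m, fun α => ?_⟩
  rw [map_add, φ.add]
  exact hm α α

theorem exists_generic [SecondCountableTopology X] [BaireSpace X] : ∃ G : Set X, Dense G ∧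
    ∀ g ∈ G, ∀ y, relR φ g y → relP φ g y := by
  let O : ℕ → Set X → Set X := fun D W => {x | ∃ n : ℕ → ℤ, ∀ α : NF D, φ.f (sumHom α.1 n) x ∈ W}
  have hO : ∀ D W, IsOpen W → IsOpen (O D W) := by
    intro D W hW
    have : O D W = ⋃ n : ℕ → ℤ, ⋂ α : NF D, φ.f (sumHom α.1 n) ⁻¹' W := by
      ext x; simp [O]
    rw [this]
    exact isOpen_iUnion fun n => isOpen_iInter_of_finite fun α => hW.preimage (φ.cont _)
  have hc := TopologicalSpace.countable_countableBasis X
  have hb := TopologicalSpace.isBasis_countableBasis X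
  refine ⟨⋂ D : ℕ, ⋂ W ∈ TopologicalSpace.countableBasis X, (O D W ∪ (closure (O D W))ᶜ), ?_, ?_⟩
  · refine dense_of_mem_residual ?_
    rw [countable_iInter_mem]
    intro D
    rw [countable_bInter_mem hc]
    intro W hW
    refine residual_of_dense_open ((hO D W (hb.isOpen hW)).union isClosed_closure.isOpen_compl) ?_
    intro x
    by_cases hx : x ∈ closure (O D W)
    · exact closure_mono subset_union_left hx
    · exact subset_closure (Or.inr hx)
  · intro g hg y hR D W hW
    simp only [mem_iInter] at hg
    obtain ⟨B, hB, hyB, hBW⟩ := hb.mem_nhds_iff.1 hW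
    have h1 : g ∈ closure (O D B) := by
      rw [mem_closure_iff_nhds]
      intro V hV
      obtain ⟨x', hx', n, hn⟩ := hR D V hV B ((hb.isOpen hB).mem_nhds hyB)
      exact ⟨x', hx', n, hn⟩
    rcases hg D B hB with h | h
    · obtain ⟨n, hn⟩ := h
      exact ⟨n, fun α => hBW (hn α)⟩
    · exact absurd h1 h

variable [CompactSpace X] [T2Space X]

theorem relR.lim {x y : X} (h : relR φ x y) (p : Ultrafilter ℤ) :
    relR φ (pt φ p x) (pt φ p y) :=
  isClosed_relR.mem_of_tendsto ((tendsto_pt φ p x).prodMk_nhds (tendsto_pt φ p y))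
    (Eventually.of_forall fun n => h.act n)

theorem relP_idem {u : Ultrafilter ℤ} (hu : u + u = u) (x : X) : relP φ x (pt φ u x) := by
  intro D W hW
  obtain ⟨n, hn⟩ := ip_ultra hu (tendsto_pt φ u x hW) D
  exact ⟨n, fun α => hn α.1 α.2.1 α.2.2⟩

theorem relP.symm {x y : X} (h : relP φ x y)
    (hmin : ∀ x, Dense (range fun n => φ.f n x)) : relP φ y x := by
  intro D W hW
  obtain ⟨W', hW', hcl, hsub⟩ := exists_mem_nhds_isClosed_subset hW
  obtain ⟨Φ, hΦ⟩ := SYN1 φ hmin x D W' hW'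
  by_contra hcon
  push Not at hcon
  by_cases hD : Nonempty (NF D)
  · choose! A hA using hcon
    have h4 : ∀ᶠ y' in 𝓝 y, ∀ a ∈ Φ, φ.f (sumHom (A a).1 a) y' ∉ W' := by
      rw [eventually_all_finset]
      intro a _
      exact (φ.cont _).continuousAt (hcl.isOpen_compl.mem_nhds fun h => hA a (hsub h))
    obtain ⟨n, hn⟩ := h D _ h4
    obtain ⟨a, ha, hγ⟩ := hΦ n
    refine hn (A a) a ha ?_
    have := hγ (A a)
    rwa [map_add, φ.add] at this
  · obtain ⟨α, _⟩ := hcon 0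
    exact hD ⟨α⟩

variable [SecondCountableTopology X]

theorem relR.symm {x y : X} (h : relR φ x y)
    (hmin : ∀ x, Dense (range fun n => φ.f n x)) : relR φ y x := by
  obtain ⟨G, hG, hGP⟩ := exists_generic (φ := φ)
  obtain ⟨w, hw, hwy⟩ := exists_minIdem φ hmin y
  obtain ⟨g, hg⟩ := hG.nonempty_iff.2 ⟨x⟩
  obtain ⟨q, hq⟩ := exists_pt_eq φ hmin (pt φ w x) g
  obtain ⟨q', hq'⟩ := hw.2 q
  have h1 := (h.lim w).lim q
  rw [hwy, hq] at h1
  have h2 := ((hGP g hg _ h1).symm hmin).relR.lim q'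
  rw [← hq, ← hwy, ← pt_add, ← pt_add, ← pt_add, ← pt_add, add_assoc, hq', hwy] at h2
  exact h2.transP ((relP_idem hw.1 x).symm hmin)

theorem relR.trans (hmin : ∀ x, Dense (range fun n => φ.f n x)) {x y z : X}
    (hxy : relR φ x y) (hyz : relR φ y z) : relR φ x z := by
  obtain ⟨G, hG, hGP⟩ := exists_generic (φ := φ)
  obtain ⟨w, hw, hwx⟩ := exists_minIdem φ hmin x
  obtain ⟨g, hg⟩ := hG.nonempty_iff.2 ⟨x⟩
  obtain ⟨q, hq⟩ := exists_pt_eq φ hmin (pt φ w y) g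
  obtain ⟨q', hq'⟩ := hw.2 q
  have h1 := ((hxy.lim w).lim q).symm hmin
  have h2 := ((hyz.lim w).lim q)
  rw [hq] at h1 h2
  have h3 := (((hGP g hg _ h1).symm hmin).trans (hGP g hg _ h2)).relR.lim q'
  rw [← pt_add, ← pt_add, ← pt_add, ← pt_add, add_assoc, hq', hwx] at h3
  exact h3.transP ((relP_idem hw.1 z).symm hmin)

end rel

set_option linter.unusedVariables false
open Filter Topology Function Set

section poly
variable {Γ : Type*} [AddCommGroup Γ]

def tr (m : ℤ) : (ℤ → Γ) →+ (ℤ → Γ) where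
  toFun f n := f (n + m)
  map_zero' := rfl
  map_add' _ _ := rfl

def dl (m : ℤ) : (ℤ → Γ) →+ (ℤ → Γ) where
  toFun f n := f (n + m) - f n
  map_zero' := by ext; simp
  map_add' f g := by ext; simp; abel

variable (Γ) in
def Po : ℕ → AddSubgroup (ℤ → Γ)
  | 0 => ⊥
  | d + 1 => ⨅ m : ℤ, (Po d).comap (dl m)

theorem mem_Po_zero {f : ℤ → Γ} : f ∈ Po Γ 0 ↔ f = 0 := AddSubgroup.mem_bot

theorem mem_Po_succ {d : ℕ} {f : ℤ → Γ} : f ∈ Po Γ (d + 1) ↔ ∀ m, dl m f ∈ Po Γ d := by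
  simp [Po, AddSubgroup.mem_iInf]

theorem Po_le_succ (d : ℕ) : Po Γ d ≤ Po Γ (d + 1) := by
  induction d with
  | zero => intro f hf; rw [mem_Po_zero.1 hf]; exact zero_mem _
  | succ d ih => 
    intro f hf
    rw [mem_Po_succ] at hf ⊢
    exact fun m => ih (hf m)

theorem Po_mono : Monotone (Po Γ) := monotone_nat_of_le_succ Po_le_succ

theorem tr_mem {d : ℕ} {f : ℤ → Γ} (hf : f ∈ Po Γ d) (m : ℤ) : tr m f ∈ Po Γ d := by
  induction d generalizing f with
  | zero => rw [mem_Po_zero.1 hf, map_zero]; exact zero_mem _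
  | succ d ih =>
    rw [mem_Po_succ] at hf ⊢
    intro k
    have : dl k (tr m f) = tr m (dl k f) := by
      ext n; simp [dl, tr, add_right_comm]
    rw [this]
    exact ih (hf k)

theorem tr_mem_iff {d : ℕ} {f : ℤ → Γ} {m : ℤ} : tr m f ∈ Po Γ d ↔ f ∈ Po Γ d := by
  refine ⟨fun h => ?_, fun h => tr_mem h m⟩
  have := tr_mem h (-m)
  convert this
  ext n; simp [tr]

theorem const_mem (c : Γ) : (fun _ => c : ℤ → Γ) ∈ Po Γ 1 := by
  rw [mem_Po_succ]
  intro m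
  rw [mem_Po_zero]
  ext; simp [dl]

theorem const_mem' {d : ℕ} (hd : 1 ≤ d) (c : Γ) : (fun _ => c : ℤ → Γ) ∈ Po Γ d :=
  Po_mono hd (const_mem c)

theorem Po_one {f : ℤ → Γ} (hf : f ∈ Po Γ 1) (n : ℤ) : f n = f 0 := by
  have := mem_Po_zero.1 (mem_Po_succ.1 hf n)
  have := congrFun this 0
  simpa [dl, sub_eq_zero] using this

theorem Po_one_zero {f : ℤ → Γ} (hf : f ∈ Po Γ 1) (h0 : f 0 = 0) : f = 0 := by
  ext n; rw [Po_one hf, h0]; rfl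

theorem Po_two {f : ℤ → Γ} (hf : f ∈ Po Γ 2) (h0 : f 0 = 0) (n : ℤ) : f n = n • f 1 := by
  have hadd : ∀ a b, f (a + b) = f a + f b := by
    intro a b
    have := Po_one (mem_Po_succ.1 hf b) a
    simp only [dl, AddMonoidHom.coe_mk, ZeroHom.coe_mk, zero_add, h0, sub_zero] at this
    rw [← this]; abel
  have := map_zsmul (AddMonoidHom.mk' f hadd) n 1
  simpa using this

def sh (m : ℤ) (f : ℤ → Γ) : ℤ → Γ := fun n => f (n + m) - f m

theorem sh_apply (m : ℤ) (f : ℤ → Γ) (n : ℤ) : sh m f n = f (n + m) - f m := rfl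

theorem sh_zero_apply (m : ℤ) (f : ℤ → Γ) : sh m f 0 = 0 := by simp [sh]

theorem sh_zero {f : ℤ → Γ} (h0 : f 0 = 0) : sh 0 f = f := by ext; simp [sh, h0]

theorem sh_sh (m m' : ℤ) (f : ℤ → Γ) : sh m (sh m' f) = sh (m + m') f := by
  ext n; simp only [sh]; rw [add_assoc]; abel

theorem sh_sub (m : ℤ) (f g : ℤ → Γ) : sh m (f - g) = sh m f - sh m g := by
  ext n; simp only [sh, Pi.sub_apply]; abel

theorem sh_eq (m : ℤ) (f : ℤ → Γ) : sh m f = tr m f - fun _ => f m := rfl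

theorem sh_mem_iff {d : ℕ} (hd : 1 ≤ d) {m : ℤ} {f : ℤ → Γ} : sh m f ∈ Po Γ d ↔ f ∈ Po Γ d := by
  rw [sh_eq, sub_mem_comm_iff, ← tr_mem_iff (m := m) (f := f)]
  constructor
  · intro h
    have := sub_mem (const_mem' hd (f m)) h
    simpa using this
  · intro h
    exact sub_mem (const_mem' hd (f m)) h

theorem sh_sub_self_mem {d : ℕ} (hd : 1 ≤ d) {m : ℤ} {f : ℤ → Γ} (hf : f ∈ Po Γ (d + 1)) :
    sh m f - f ∈ Po Γ d := by
  have : sh m f - f = dl m f - fun _ => f m := by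
    ext n; simp only [sh, dl, Pi.sub_apply, AddMonoidHom.coe_mk, ZeroHom.coe_mk]; abel
  rw [this]
  exact sub_mem (mem_Po_succ.1 hf m) (const_mem' hd _)

variable [IsAddTorsionFree Γ]

theorem Po_pure {d : ℕ} {k : ℤ} (hk : k ≠ 0) {f : ℤ → Γ} (hf : k • f ∈ Po Γ d) : f ∈ Po Γ d := by
  induction d generalizing f with
  | zero =>
    rw [mem_Po_zero] at hf ⊢
    exact (IsAddTorsionFree.zsmul_eq_zero_iff_right hk).1 hf
  | succ d ih =>
    rw [mem_Po_succ] at hf ⊢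
    intro m
    have := hf m
    rw [map_zsmul] at this
    exact ih this

theorem Po_L1 {e : ℕ} {k : ℤ} (hk : k ≠ 0) {f : ℤ → Γ} (hf : f ∈ Po Γ (e + 2))
    (h : dl k f ∈ Po Γ e) : f ∈ Po Γ (e + 1) := by
  have key : ∀ m : ℤ, dl m f - m • dl 1 f ∈ Po Γ e := by
    have step : ∀ m : ℤ, (dl (m + 1) f - (m + 1) • dl 1 f) - (dl m f - m • dl 1 f) ∈ Po Γ e := by
      intro m
      have h1 : (dl (m + 1) f - (m + 1) • dl 1 f) - (dl m f - m • dl 1 f) = dl m (dl 1 f) := by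
        ext n
        simp only [dl, Pi.sub_apply, AddMonoidHom.coe_mk, ZeroHom.coe_mk, add_smul, one_smul,
          Pi.add_apply, Pi.smul_apply]
        rw [← add_assoc]; abel
      rw [h1]
      exact mem_Po_succ.1 (mem_Po_succ.1 hf 1) m
    intro m
    induction m using Int.induction_on with
    | zero =>
      have : dl 0 f = 0 := by ext; simp [dl]
      simp [this, zero_mem]
    | succ i hi => 
      have := add_mem (step i) hi
      simpa using this
    | pred i hi =>
      have := sub_mem hi (step (-i - 1))
      simpa using this
  rw [mem_Po_succ]
  have h2 : k • dl 1 f ∈ Po Γ e := by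
    have := sub_mem h (key k)
    simpa using this
  have h3 := Po_pure hk h2
  intro m
  have := add_mem (key m) (AddSubgroup.zsmul_mem _ h3 m)
  simpa using this

theorem Po_descend {d e : ℕ} {k : ℤ} (hk : k ≠ 0) {f : ℤ → Γ} (hf : f ∈ Po Γ d)
    (h : dl k f ∈ Po Γ e) : f ∈ Po Γ (e + 1) := by
  induction d with
  | zero => exact Po_mono (Nat.zero_le _) hf
  | succ d ih =>
    by_cases hd : d + 1 ≤ e + 1
    · exact Po_mono hd hf
    · obtain ⟨d', rfl⟩ : ∃ d', d = d' + 1 := ⟨d - 1, by omega⟩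
      exact ih (Po_L1 hk hf (Po_mono (by omega) h))

theorem sh_inj {d : ℕ} {f : ℤ → Γ} (hf : f ∈ Po Γ d) (hf2 : f ∉ Po Γ 2) {m m' : ℤ}
    (h : sh m f = sh m' f) : m = m' := by
  by_contra hne
  refine hf2 (Po_descend (k := m' - m) (by omega) hf ?_)
  rw [← tr_mem_iff (m := m)]
  have : tr m (dl (m' - m) f) = fun _ => f m' - f m := by
    ext n
    have := congrFun h n
    simp only [sh] at this
    simp only [tr, dl, AddMonoidHom.coe_mk, ZeroHom.coe_mk]
    rw [show n + m + (m' - m) = n + m' by ring]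
    rw [sub_eq_sub_iff_add_eq_add] at this ⊢
    rw [← this, add_comm]
  rw [this]
  exact const_mem _

theorem Po_vanish {d : ℕ} {K : ℤ} (hK : K ≠ 0) {g : ℤ → Γ} (hg : g ∈ Po Γ d)
    (h : ∀ n, g (K * n) = 0) : g = 0 := by
  induction d generalizing g with
  | zero => exact mem_Po_zero.1 hg
  | succ d ih =>
    have h1 : dl K g = 0 := by
      refine ih (mem_Po_succ.1 hg K) fun n => ?_
      simp only [dl, AddMonoidHom.coe_mk, ZeroHom.coe_mk]
      rw [h, show K * n + K = K * (n + 1) by ring, h, sub_zero]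
    have h2 : g ∈ Po Γ 1 := Po_descend hK hg (mem_Po_zero.2 h1)
    exact Po_one_zero h2 (by simpa using h 0)

end poly

theorem Po_comp_hom {Γ Γ' : Type*} [AddCommGroup Γ] [AddCommGroup Γ'] (i : Γ →+ Γ')
    {d : ℕ} {f : ℤ → Γ} (hf : f ∈ Po Γ d) : (fun n => i (f n)) ∈ Po Γ' d := by
  induction d generalizing f with
  | zero => rw [mem_Po_zero] at hf ⊢; subst hf; ext; simp
  | succ d ih =>
    rw [mem_Po_succ] at hf ⊢
    intro m
    have := ih (hf m)
    convert this using 1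
    ext; simp [dl]

theorem Po_of_comp {Γ Γ' : Type*} [AddCommGroup Γ] [AddCommGroup Γ'] (i : Γ →+ Γ')
    (hi : Function.Injective i) {d : ℕ} {f : ℤ → Γ} (hf : (fun n => i (f n)) ∈ Po Γ' d) :
    f ∈ Po Γ d := by
  induction d generalizing f with
  | zero =>
    rw [mem_Po_zero] at hf ⊢
    ext n
    have := congrFun hf n
    exact hi (by simpa using this)
  | succ d ih =>
    rw [mem_Po_succ] at hf ⊢
    intro m
    refine ih ?_
    have := hf m
    convert this using 1
    ext; simp [dl]

theorem Po_scale {Γ : Type*} [AddCommGroup Γ] (K : ℤ)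
    {d : ℕ} {f : ℤ → Γ} (hf : f ∈ Po Γ d) : (fun n => f (K * n)) ∈ Po Γ d := by
  induction d generalizing f with
  | zero => rw [mem_Po_zero] at hf ⊢; subst hf; ext; simp
  | succ d ih =>
    rw [mem_Po_succ] at hf ⊢
    intro m
    have := ih (hf (K * m))
    convert this using 1
    ext; simp [dl, mul_add]

theorem Po_of_rat (q : Polynomial ℚ) (d : ℕ) (hq : q.degree < d) :
    (fun n : ℤ => q.eval (n : ℚ)) ∈ Po ℚ d := by
  induction d generalizing q with
  | zero =>
    rw [mem_Po_zero]
    have : q = 0 := by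
      rw [← Polynomial.degree_eq_bot]
      simpa [Nat.WithBot.lt_zero_iff] using hq
    ext; simp [this]
  | succ d ih =>
    rw [mem_Po_succ]
    intro m
    by_cases h0 : q = 0
    · subst h0
      convert zero_mem (Po ℚ d)
      ext; simp [dl]
    · have h1 : (Polynomial.taylor (m : ℚ) q - q).degree < d := by
        have h2 : (Polynomial.taylor (m : ℚ) q - q).degree < (Polynomial.taylor (m : ℚ) q).degree := by
          refine Polynomial.degree_sub_lt_left (by simp) ?_ (by simp)
          simpa using h0
        rw [Polynomial.degree_taylor] at h2
        rw [Polynomial.degree_eq_natDegree h0] at h2 hq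
        have h3 : q.natDegree < d + 1 := by exact_mod_cast hq
        exact h2.trans_le (by exact_mod_cast Nat.lt_succ_iff.1 h3)
      have := ih _ h1
      convert this using 1
      ext n
      simp [dl, Polynomial.taylor_eval]

theorem intPoly_mem {p : ℤ → ℤ} (hp : IsNonlinearIntPoly0 p) :
    p 0 = 0 ∧ p ∉ Po ℤ 2 ∧ ∃ d, p ∈ Po ℤ d := by
  obtain ⟨h0, q, hq, hd⟩ := hp
  refine ⟨h0, fun h => ?_, q.natDegree + 1, ?_⟩
  · have h1 := Po_two h h0
    have h2 : q = Polynomial.C (p 1 : ℚ) * Polynomial.X := by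
      refine Polynomial.eq_of_infinite_eval_eq _ _ ?_
      refine (Set.infinite_range_of_injective (Int.cast_injective (α := ℚ))).mono ?_
      rintro _ ⟨n, rfl⟩
      have := h1 n
      simp only [Set.mem_ofPred_eq]
      rw [← hq, this]
      simp [mul_comm]
    have h3 : q.natDegree ≤ 1 := by
      rw [h2]; exact (Polynomial.natDegree_C_mul_le _ _).trans Polynomial.natDegree_X_le
    omega
  · refine Po_of_comp (Int.castAddHom ℚ) Int.cast_injective ?_
    have := Po_of_rat q (q.natDegree + 1) (by
      refine lt_of_le_of_lt Polynomial.degree_le_natDegree ?_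
      exact_mod_cast Nat.lt_succ_self _)
    convert this using 1
    ext n
    simp [hq]

set_option linter.unusedVariables false
open Filter Topology Function Set

section PETs
variable {Γ : Type*} [AddCommGroup Γ]

noncomputable def ordP (f : ℤ → Γ) : ℕ := sInf {d | f ∈ Po Γ d}

theorem mem_iff_ordP {f : ℤ → Γ} {d : ℕ} (hf : f ∈ Po Γ d) (e : ℕ) :
    f ∈ Po Γ e ↔ ordP f ≤ e := by
  constructor
  · intro h; exact Nat.sInf_le h
  · intro h
    exact Po_mono h (Nat.sInf_mem (s := {d | f ∈ Po Γ d}) ⟨d, hf⟩)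

open Classical in
noncomputable def clsP (j : ℕ) (F : Finset (ℤ → Γ)) : Finset ((ℤ → Γ) ⧸ Po Γ j) :=
  (F.filter fun f => f ∈ Po Γ (j + 1) ∧ f ∉ Po Γ j).image (QuotientAddGroup.mk)

theorem mem_clsP {j : ℕ} {F : Finset (ℤ → Γ)} {c : (ℤ → Γ) ⧸ Po Γ j} :
    c ∈ clsP j F ↔ ∃ f ∈ F, f ∈ Po Γ (j + 1) ∧ f ∉ Po Γ j ∧ (f : (ℤ → Γ) ⧸ Po Γ j) = c := by
  classical
  simp [clsP, and_assoc]

theorem mk_eq_iff {j : ℕ} {f g : ℤ → Γ} :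
    ((f : (ℤ → Γ) ⧸ Po Γ j) = g) ↔ g - f ∈ Po Γ j := by
  rw [QuotientAddGroup.eq, neg_add_eq_sub]

theorem lex_lemma {n : ℕ} (x y : Fin n → ℕ) (i : Fin n) (h1 : ∀ j, i < j → x j ≤ y j)
    (h2 : x i < y i) : Pi.Lex (· > ·) (· < ·) x y := by
  classical
  obtain ⟨k, hk, hmax⟩ := Finset.exists_max_image (Finset.univ.filter fun j => i ≤ j ∧ x j < y j) id
    ⟨i, by simp [h2]⟩
  simp only [Finset.mem_filter, Finset.mem_univ, true_and, id] at hk hmax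
  refine ⟨k, fun j hj => ?_, hk.2⟩
  have hij : i < j := lt_of_le_of_lt hk.1 hj
  refine le_antisymm (h1 j hij) ?_
  by_contra hlt
  exact absurd (hmax j ⟨hij.le, not_le.1 hlt⟩) (not_le.2 hj)

theorem lex_wf (n : ℕ) : WellFounded (Pi.Lex (ι := Fin n) (β := fun _ => ℕ) (· > ·) (fun {_} => (· < ·))) :=
  Pi.Lex.wellFounded _ (fun _ => wellFounded_lt)

/-- the weight of the new family drops -/
theorem weight_lemma {dm : ℕ} {F G : Finset (ℤ → Γ)} {f1 : ℤ → Γ} {m1 : ℤ} {j0 : ℕ}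
    (hj0 : 1 ≤ j0) (hj : j0 < dm) (hf1 : f1 ∈ F) (hf1a : f1 ∈ Po Γ (j0 + 1)) (hf1b : f1 ∉ Po Γ j0)
    (hminF : ∀ f ∈ F, f ≠ 0 → f ∉ Po Γ j0)
    (hG : ∀ g ∈ G, ∃ f ∈ F, f ≠ 0 ∧ ∃ m, g = sh m f - sh m1 f1) :
    Pi.Lex (· > ·) (fun {_} => (· < ·)) (fun j : Fin dm => (clsP j G).card)
      (fun j : Fin dm => (clsP j F).card) := by
  classical
  have hb : sh m1 f1 ∈ Po Γ (j0 + 1) := (sh_mem_iff (by omega)).2 hf1a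
  refine lex_lemma _ _ ⟨j0, hj⟩ ?_ ?_
  · intro j hjj
    have hjj' : j0 < j := hjj
    refine Finset.card_le_card ?_
    intro c hc
    rw [mem_clsP] at hc ⊢
    obtain ⟨h, hh, ha, hb', rfl⟩ := hc
    obtain ⟨f, hf, hf0, m, rfl⟩ := hG h hh
    have hbj : sh m1 f1 ∈ Po Γ j := Po_mono (by omega) hb
    have h1 : f ∈ Po Γ (j + 1) := by
      rw [← sh_mem_iff (m := m) (by omega)]
      have := add_mem ha (Po_le_succ _ hbj)
      simpa using this
    have h2 : sh m f - f ∈ Po Γ j := sh_sub_self_mem (by omega) h1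
    have h3 : sh m f - sh m1 f1 - f ∈ Po Γ j := by
      have := sub_mem h2 hbj
      convert this using 1; abel
    refine ⟨f, hf, h1, ?_, mk_eq_iff.2 h3⟩
    intro h4
    apply hb'
    have := add_mem h3 h4
    simpa using this
  · have hsub : clsP j0 G ⊆ ((clsP j0 F).erase (f1 : (ℤ → Γ) ⧸ Po Γ j0)).image
        (fun c => c - (f1 : (ℤ → Γ) ⧸ Po Γ j0)) := by
      intro c hc
      rw [mem_clsP] at hc
      obtain ⟨h, hh, ha, hb', rfl⟩ := hc
      obtain ⟨f, hf, hf0, m, rfl⟩ := hG h hh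
      have h1 : f ∈ Po Γ (j0 + 1) := by
        rw [← sh_mem_iff (m := m) (by omega)]
        have := add_mem ha hb
        simpa using this
      have h2 : sh m f - f ∈ Po Γ j0 := sh_sub_self_mem (by omega) h1
      have h2' : sh m1 f1 - f1 ∈ Po Γ j0 := sh_sub_self_mem (by omega) hf1a
      have h3 : sh m f - sh m1 f1 - (f - f1) ∈ Po Γ j0 := by
        have := sub_mem h2 h2'
        convert this using 1; abel
      rw [Finset.mem_image]
      refine ⟨(f : (ℤ → Γ) ⧸ Po Γ j0), ?_, ?_⟩
      · rw [Finset.mem_erase, mem_clsP]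
        refine ⟨fun h4 => ?_, f, hf, h1, hminF f hf hf0, rfl⟩
        apply hb'
        have h5 := mk_eq_iff.1 h4.symm
        have := add_mem h3 h5
        simpa using this
      · rw [← QuotientAddGroup.mk_sub, mk_eq_iff]
        exact h3
    refine lt_of_le_of_lt (Finset.card_le_card hsub) (lt_of_le_of_lt Finset.card_image_le ?_)
    refine Finset.card_erase_lt_of_mem ?_
    rw [mem_clsP]
    exact ⟨f1, hf1, hf1a, hf1b, rfl⟩

variable {Y : Type*} [TopologicalSpace Y]

structure PET (φ : Act Γ Y) (l : Filter ℤ) (Rel : Set Y → Set Y → Prop) : Prop where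
  neBot : NeBot l
  idem : ∀ A ∈ l, ∀ᶠ m in l, ∀ᶠ n in l, m + n ∈ A
  cof : ∀ B : Set ℤ, B.Finite → Bᶜ ∈ l
  cover : ∀ O : Set Y, IsOpen O → O.Nonempty → ∃ Φ : Finset Γ, ∀ x, ∃ a ∈ Φ, φ.f a x ∈ O
  mono : ∀ O O' U, O' ⊆ O → Rel O U → Rel O' U
  inv : ∀ O U a, Rel O U → Rel (φ.f a ⁻¹' O) (φ.f a ⁻¹' U)
  base : ∀ O U, IsOpen O → IsOpen U → O.Nonempty → Rel O U → ∀ C : Finset Γ,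
    ∃ᶠ n in l, ∃ y ∈ U, ∀ c ∈ C, c ≠ 0 → φ.f (n • c) y ∈ O

def PQ (φ : Act Γ Y) (l : Filter ℤ) (Rel : Set Y → Set Y → Prop) (F : Finset (ℤ → Γ))
    (s : ℤ → Γ) : Prop :=
  ∀ O U, IsOpen O → IsOpen U → O.Nonempty → Rel O U →
    ∃ᶠ n in l, ∃ y, (∀ f ∈ F, f ≠ s → φ.f (f n) y ∈ O) ∧ φ.f (s n) y ∈ U

variable {φ : Act Γ Y} {l : Filter ℤ} {Rel : Set Y → Set Y → Prop}

theorem PQ_transl {F G : Finset (ℤ → Γ)} {s b : ℤ → Γ} (hG : ∀ f ∈ F, f - b ∈ G)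
    (h : PQ φ l Rel G (s - b)) : PQ φ l Rel F s := by
  intro O U hO hU hne hR
  refine (h O U hO hU hne hR).mono ?_
  rintro n ⟨y, h1, h2⟩
  refine ⟨φ.f (-(b n)) y, fun f hf hfs => ?_, ?_⟩
  · have := h1 (f - b) (hG f hf) (fun h => hfs (sub_left_injective h))
    rwa [Pi.sub_apply, sub_eq_add_neg, φ.add] at this
  · rwa [Pi.sub_apply, sub_eq_add_neg, φ.add] at h2

theorem PQ_base (h : PET φ l Rel) {F : Finset (ℤ → Γ)} {s : ℤ → Γ} (hs : s ∈ F)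
    (hF : ∀ f ∈ F, f 0 = 0 ∧ f ∈ Po Γ 2) : PQ φ l Rel F s := by
  classical
  intro O U hO hU hne hR
  refine (h.base O U hO hU hne hR (F.image fun f => f 1 - s 1)).mono ?_
  rintro n ⟨y, hy, hc⟩
  have hlin : ∀ f ∈ F, f n = n • f 1 := fun f hf => Po_two (hF f hf).2 (hF f hf).1 n
  refine ⟨φ.f (-(s n)) y, fun f hf hfs => ?_, ?_⟩
  · have hne : f 1 - s 1 ≠ 0 := by
      intro h0
      apply hfs
      ext n
      rw [Po_two (hF f hf).2 (hF f hf).1 n, Po_two (hF s hs).2 (hF s hs).1 n, sub_eq_zero.1 h0]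
    have := hc _ (Finset.mem_image_of_mem _ hf) hne
    rw [← φ.add, hlin f hf, hlin s hs, ← sub_eq_add_neg, ← smul_sub]
    exact this
  · rwa [φ.f_neg]

variable [IsAddTorsionFree Γ]

/-- the chain argument -/
theorem PQ_chain (h : PET φ l Rel) {dm : ℕ} {F : Finset (ℤ → Γ)} {s : ℤ → Γ} (hs : s ∈ F)
    (hF : ∀ f ∈ F, f 0 = 0 ∧ f ∈ Po Γ dm) (hs2 : s ∉ Po Γ 2)
    (IH : ∀ (M : Finset ℤ) (G : Finset (ℤ → Γ)), 0 ∈ M →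
      (∀ g, g ∈ G ↔ ∃ f ∈ F, f ≠ 0 ∧ ∃ m ∈ M, g = sh m f) → PQ φ l Rel G s) :
    PQ φ l Rel F s := by
  classical
  intro O U hO hU hne hR
  rw [Filter.frequently_iff]
  intro A0 hA0
  have hs0 : s ≠ 0 := fun h0 => hs2 (h0 ▸ zero_mem _)
  -- bad set
  let Bad : Set ℤ := ⋃ f ∈ F, {m | sh m f = s}
  have hBad : Bad.Finite := by
    refine Set.Finite.biUnion F.finite_toSet fun f hf => ?_
    refine Set.Subsingleton.finite ?_
    intro m hm m' hm'
    have hm : sh m f = s := hm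
    have hm' : sh m' f = s := hm'
    refine sh_inj (hF f hf).2 ?_ (hm.trans hm'.symm)
    intro hf2
    exact hs2 (hm ▸ (sh_mem_iff (by omega)).2 hf2)
  set A := A0 ∩ Badᶜ with hA
  have hAl : A ∈ l := inter_mem hA0 (h.cof _ hBad)
  let As : Set ℤ := {m | m ∈ A ∧ ∀ᶠ n in l, m + n ∈ A}
  have hAs : ∀ᶠ m in l, m ∈ As := by
    filter_upwards [hAl, h.idem A hAl] with m h1 h2 using ⟨h1, h2⟩
  have hAs' : ∀ m ∈ As, ∀ᶠ n in l, m + n ∈ As := by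
    rintro m ⟨h1, h2⟩
    filter_upwards [h2, h.idem _ h2] with n h3 h4
    refine ⟨h3, ?_⟩
    simpa only [add_assoc] using h4
  obtain ⟨Φ, hΦ⟩ := h.cover O hO hne
  by_contra hcon
  have hgoal : ∀ n ∈ A0, ∀ y, (∀ f ∈ F, f ≠ s → φ.f (f n) y ∈ O) → φ.f (s n) y ∈ U → False :=
    fun n hn y h1 h2 => hcon ⟨n, hn, y, h1, h2⟩
  have state : ∀ t ≤ Φ.card, ∃ Φ' ⊆ Φ, Φ'.card = t ∧ ∃ m : Γ → ℤ, ∃ O' : Set Y, IsOpen O' ∧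
      O'.Nonempty ∧ ∀ a ∈ Φ', m a ∈ As ∧ ∀ x ∈ O',
        (∀ f ∈ F, f ≠ 0 → f ≠ s → φ.f a (φ.f (f (m a)) x) ∈ O) ∧
        φ.f a (φ.f (s (m a)) x) ∈ U := by
    intro t
    induction t with
    | zero =>
      intro _
      exact ⟨∅, by simp, rfl, fun _ => 0, univ, isOpen_univ, ⟨hne.some, trivial⟩, by simp⟩
    | succ t ih =>
      intro ht
      obtain ⟨Φ', hsub, hcard, m, O', hO', ⟨x0, hx0⟩, hst⟩ := ih (by omega)
      obtain ⟨a, ha, hax⟩ := hΦ x0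
      have hout : ∀ a ∈ Φ', φ.f a x0 ∉ O := by
        intro a' ha' hin
        have h1 := hst a' ha'
        refine hgoal (m a') h1.1.1.1 (φ.f a' x0) (fun f hf hfs => ?_) ?_
        · by_cases hf0 : f = 0
          · subst hf0
            rw [Pi.zero_apply, φ.zero]; exact hin
          · rw [φ.comm]; exact (h1.2 x0 hx0).1 f hf hf0 hfs
        · rw [φ.comm]; exact (h1.2 x0 hx0).2
      have haΦ' : a ∉ Φ' := fun h1 => hout a h1 hax
      let O2 := O' ∩ φ.f a ⁻¹' O
      have hO2 : IsOpen O2 := hO'.inter (hO.preimage (φ.cont a))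
      let M : Finset ℤ := insert 0 (Φ'.image m)
      let G : Finset (ℤ → Γ) := ((F.filter (· ≠ 0)) ×ˢ M).image fun z => sh z.2 z.1
      have hG : ∀ g, g ∈ G ↔ ∃ f ∈ F, f ≠ 0 ∧ ∃ m ∈ M, g = sh m f := by
        intro g
        simp only [G, Finset.mem_image, Finset.mem_product, Finset.mem_filter, Prod.exists]
        constructor
        · rintro ⟨f, k, ⟨⟨h1, h2⟩, h3⟩, rfl⟩
          exact ⟨f, h1, h2, k, h3, rfl⟩
        · rintro ⟨f, h1, h2, k, h3, rfl⟩
          exact ⟨f, k, ⟨⟨h1, h2⟩, h3⟩, rfl⟩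
      have hQ := IH M G (Finset.mem_insert_self _ _) hG O2 (φ.f a ⁻¹' U) hO2
        (hU.preimage (φ.cont a)) ⟨x0, hx0, hax⟩
        (h.mono _ _ _ inter_subset_right (h.inv O U a hR))
      have hev : ∀ᶠ n in l, n ∈ As ∧ ∀ a' ∈ Φ', m a' + n ∈ As := by
        refine hAs.and ?_
        rw [eventually_all_finset]
        exact fun a' ha' => hAs' _ (hst a' ha').1
      obtain ⟨n, ⟨x, hx1, hx2⟩, hn1, hn2⟩ := (hQ.and_eventually hev).exists
      let O3 : Set Y := {z | (∀ g ∈ G, g ≠ s → φ.f (g n) z ∈ O2) ∧ φ.f (s n) z ∈ φ.f a ⁻¹' U}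
      have hO3 : IsOpen O3 := by
        have : O3 = (⋂ g ∈ G.filter (· ≠ s), φ.f (g n) ⁻¹' O2) ∩ φ.f (s n) ⁻¹' (φ.f a ⁻¹' U) := by
          ext z
          simp [O3, and_imp]
        rw [this]
        refine IsOpen.inter ?_ ((hU.preimage (φ.cont a)).preimage (φ.cont _))
        exact isOpen_biInter_finset fun g _ => hO2.preimage (φ.cont _)
      have hGm : ∀ f ∈ F, f ≠ 0 → ∀ k ∈ M, sh k f ∈ G := fun f hf hf0 k hk =>
        (hG _).2 ⟨f, hf, hf0, k, hk, rfl⟩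
      refine ⟨insert a Φ', Finset.insert_subset ha hsub, by
        rw [Finset.card_insert_of_notMem haΦ', hcard],
        fun c => if c = a then n else m c + n, O3, hO3, ⟨x, hx1, hx2⟩, ?_⟩
      intro c hc
      by_cases hca : c = a
      · subst hca
        simp only [if_true]
        refine ⟨hn1, fun z hz => ⟨fun f hf hf0 hfs => ?_, hz.2⟩⟩
        have h1 := hGm f hf hf0 0 (Finset.mem_insert_self _ _)
        rw [sh_zero (hF f hf).1] at h1
        exact (hz.1 f h1 hfs).2
      · have hc' : c ∈ Φ' := (Finset.mem_insert.1 hc).resolve_left hca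
        simp only [hca, if_false]
        have hkM : m c ∈ M := Finset.mem_insert_of_mem (Finset.mem_image_of_mem _ hc')
        have hshift : ∀ f : ℤ → Γ, ∀ z, φ.f (f (m c + n)) z = φ.f (f (m c)) (φ.f (sh (m c) f n) z) := by
          intro f z
          rw [← φ.add, sh_apply, add_sub_cancel, add_comm n]
        have hnb : ∀ f ∈ F, sh (m c) f ≠ s := by
          intro f hf hfs
          exact (hst c hc').1.1.2 (mem_biUnion hf hfs)
        refine ⟨hn2 c hc', fun z hz => ⟨fun f hf hf0 hfs => ?_, ?_⟩⟩
        · rw [hshift]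
          exact ((hst c hc').2 _ (hz.1 _ (hGm f hf hf0 _ hkM) (hnb f hf)).1).1 f hf hf0 hfs
        · rw [hshift]
          exact ((hst c hc').2 _ (hz.1 _ (hGm s hs hs0 _ hkM) (hnb s hs)).1).2
  obtain ⟨Φ', hsub, hcard, m, O', hO', ⟨x0, hx0⟩, hst⟩ := state Φ.card le_rfl
  have hΦeq : Φ' = Φ := Finset.eq_of_subset_of_card_le hsub hcard.ge
  subst hΦeq
  obtain ⟨a', ha', hin⟩ := hΦ x0
  have h1 := hst a' ha'
  refine hgoal (m a') h1.1.1.1 (φ.f a' x0) (fun f hf hfs => ?_) ?_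
  · by_cases hf0 : f = 0
    · subst hf0
      rw [Pi.zero_apply, φ.zero]; exact hin
    · rw [φ.comm]; exact (h1.2 x0 hx0).1 f hf hf0 hfs
  · rw [φ.comm]; exact (h1.2 x0 hx0).2

theorem PQ_core (h : PET φ l Rel) (dm : ℕ) (hdm : 2 ≤ dm) (w : Fin dm → ℕ) :
    ∀ (F : Finset (ℤ → Γ)) (s : ℤ → Γ), (fun j : Fin dm => (clsP (j : ℕ) F).card) = w →
    (∀ f ∈ F, f 0 = 0 ∧ f ∈ Po Γ dm) → s ∈ F → (∀ e, s ∈ Po Γ e → ∀ f ∈ F, f ∈ Po Γ e) →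
    PQ φ l Rel F s := by
  classical
  induction w using (lex_wf dm).induction with
  | _ w ih =>
  intro F s hw hF hs hmax
  by_cases hs2 : s ∈ Po Γ 2
  · exact PQ_base h hs fun f hf => ⟨(hF f hf).1, hmax 2 hs2 f hf⟩
  have hs0 : s ≠ 0 := fun h0 => hs2 (h0 ▸ zero_mem _)
  refine PQ_chain h hs hF hs2 fun M G hM hG => ?_
  have hGdm : ∀ g ∈ G, g 0 = 0 ∧ g ∈ Po Γ dm := by
    intro g hg
    obtain ⟨f, hf, hf0, m, hm, rfl⟩ := (hG g).1 hg
    exact ⟨sh_zero_apply _ _, (sh_mem_iff (by omega)).2 (hF f hf).2⟩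
  have hsG : s ∈ G := (hG s).2 ⟨s, hs, hs0, 0, hM, (sh_zero (hF s hs).1).symm⟩
  have hF1 : ∀ f ∈ F, f ≠ 0 → f ∉ Po Γ 1 := fun f hf hf0 h1 => hf0 (Po_one_zero h1 (hF f hf).1)
  -- minimal order
  obtain ⟨f0, hf0, hf0min⟩ := Finset.exists_min_image (F.filter (· ≠ 0)) ordP
    ⟨s, Finset.mem_filter.2 ⟨hs, hs0⟩⟩
  rw [Finset.mem_filter] at hf0
  obtain ⟨j0, hj0⟩ : ∃ j0, ordP f0 = j0 + 1 := by
    refine ⟨ordP f0 - 1, ?_⟩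
    have := hF1 f0 hf0.1 hf0.2
    rw [mem_iff_ordP (hF f0 hf0.1).2] at this
    omega
  have hj01 : 1 ≤ j0 := by
    have := hF1 f0 hf0.1 hf0.2
    rw [mem_iff_ordP (hF f0 hf0.1).2] at this
    omega
  have hminF : ∀ f ∈ F, f ≠ 0 → f ∉ Po Γ j0 := by
    intro f hf hfne hfm
    have := hf0min f (Finset.mem_filter.2 ⟨hf, hfne⟩)
    rw [mem_iff_ordP (hF f hf).2] at hfm
    omega
  have hjdm : j0 < dm := by
    have := (mem_iff_ordP (hF f0 hf0.1).2 dm).1 (hF f0 hf0.1).2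
    omega
  -- best b
  obtain ⟨⟨f1, m1⟩, h1, hbest⟩ := Finset.exists_max_image
    ((F.filter fun f => f ≠ 0 ∧ f ∈ Po Γ (j0 + 1)) ×ˢ M) (fun z => ordP (s - sh z.2 z.1))
    ⟨(f0, 0), by
      rw [Finset.mem_product, Finset.mem_filter]
      exact ⟨⟨hf0.1, hf0.2, (mem_iff_ordP (hF f0 hf0.1).2 _).2 hj0.le⟩, hM⟩⟩
  rw [Finset.mem_product, Finset.mem_filter] at h1
  obtain ⟨⟨hf1, hf1ne, hf1o⟩, hm1⟩ := h1
  have hb : sh m1 f1 ∈ Po Γ (j0 + 1) := (sh_mem_iff (by omega)).2 hf1o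
  have hbdm : sh m1 f1 ∈ Po Γ dm := Po_mono (by omega) hb
  refine PQ_transl (G := G.image (· - sh m1 f1)) (b := sh m1 f1)
    (fun f hf => Finset.mem_image_of_mem _ hf) ?_
  have hG' : ∀ g ∈ G.image (· - sh m1 f1), ∃ f ∈ F, f ≠ 0 ∧ ∃ m, g = sh m f - sh m1 f1 := by
    intro g hg
    rw [Finset.mem_image] at hg
    obtain ⟨g', hg', rfl⟩ := hg
    obtain ⟨f, hf, hfne, m, hm, rfl⟩ := (hG g').1 hg'
    exact ⟨f, hf, hfne, m, rfl⟩
  refine ih _ ?_ _ _ rfl ?_ (Finset.mem_image_of_mem _ hsG) ?_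
  · rw [← hw]
    exact weight_lemma hj01 hjdm hf1 hf1o (hminF f1 hf1 hf1ne) hminF hG'
  · intro g hg
    rw [Finset.mem_image] at hg
    obtain ⟨g', hg', rfl⟩ := hg
    refine ⟨?_, sub_mem (hGdm g' hg').2 hbdm⟩
    rw [Pi.sub_apply, (hGdm g' hg').1, sh_zero_apply, sub_zero]
  · intro e he g hg
    rw [Finset.mem_image] at hg
    obtain ⟨g', hg', rfl⟩ := hg
    obtain ⟨f, hf, hfne, m, hm, rfl⟩ := (hG g').1 hg'
    by_cases hse : s ∈ Po Γ (j0 + 1)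
    · have hfe := hmax _ hse f hf
      have h2 := hbest (f, m) (by
        rw [Finset.mem_product, Finset.mem_filter]
        exact ⟨⟨hf, hfne, hfe⟩, hm⟩)
      simp only at h2
      have h3 : s - sh m f ∈ Po Γ e := by
        rw [mem_iff_ordP (d := dm) (sub_mem (hF s hs).2 (hGdm _ hg').2)]
        rw [mem_iff_ordP (d := dm) (sub_mem (hF s hs).2 hbdm)] at he
        omega
      have := sub_mem he h3
      convert this using 1; abel
    · have he2 : j0 + 1 ≤ e := by
        by_contra hlt
        apply hse
        have := add_mem (Po_mono (by omega : e ≤ j0 + 1) he) hb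
        simpa using this
      have hse' : s ∈ Po Γ e := by
        have := add_mem he (Po_mono he2 hb)
        simpa using this
      exact sub_mem ((sh_mem_iff (by omega)).2 (hmax e hse' f hf)) (Po_mono he2 hb)

theorem PET_main (h : PET φ l Rel) {dm : ℕ} {F : Finset (ℤ → Γ)} {s : ℤ → Γ} (hs : s ∈ F)
    (hF : ∀ f ∈ F, f 0 = 0 ∧ f ∈ Po Γ dm) : PQ φ l Rel F s := by
  classical
  wlog hdm : 2 ≤ dm generalizing dm
  · exact this (dm := 2) (fun f hf => ⟨(hF f hf).1, Po_mono (by omega) (hF f hf).2⟩) le_rfl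
  obtain ⟨b, hb, hbest⟩ := Finset.exists_max_image F (fun b => ordP (s - b)) ⟨s, hs⟩
  refine PQ_transl (G := F.image (· - b)) (b := b) (fun f hf => Finset.mem_image_of_mem _ hf) ?_
  refine PQ_core h dm hdm _ _ _ rfl ?_ (Finset.mem_image_of_mem _ hs) ?_
  · intro g hg
    rw [Finset.mem_image] at hg
    obtain ⟨g', hg', rfl⟩ := hg
    refine ⟨?_, sub_mem (hF g' hg').2 (hF b hb).2⟩
    rw [Pi.sub_apply, (hF g' hg').1, (hF b hb).1, sub_zero]
  · intro e he g hg
    rw [Finset.mem_image] at hg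
    obtain ⟨g', hg', rfl⟩ := hg
    have h2 := hbest g' hg'
    have h3 : s - g' ∈ Po Γ e := by
      rw [mem_iff_ordP (d := dm) (sub_mem (hF s hs).2 (hF _ hg').2)]
      rw [mem_iff_ordP (d := dm) (sub_mem (hF s hs).2 (hF b hb).2)] at he
      omega
    have := sub_mem he h3
    convert this using 1; abel

end PETs

set_option linter.unusedVariables false
open Filter Topology Function Set

theorem ip_fintype {u : Ultrafilter ℤ} (hu : u + u = u) {A : Set ℤ} (hA : A ∈ u)
    (ι : Type*) [Fintype ι] :
    ∃ n : ι → ℤ, ∀ s : Finset ι, s.Nonempty → ∑ j ∈ s, n j ∈ A := by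
  classical
  obtain ⟨n, hn⟩ := ip_ultra hu hA (Fintype.card ι)
  let e := Fintype.equivFin ι
  refine ⟨fun i => n (e i), fun s hs => ?_⟩
  have := hn (s.image fun i => (e i : ℕ)) (by
    intro k hk
    simp only [Finset.mem_image] at hk
    obtain ⟨i, _, rfl⟩ := hk
    simp) (hs.image _)
  rwa [Finset.sum_image] at this
  intro a _ b _ h
  exact e.injective (Fin.ext h)

theorem line_sum {ι α Γ : Type*} [Fintype ι] [AddCommGroup Γ] [Nonempty α]
    (l : Combinatorics.Line α ι) (f : ι → α → Γ) :
    ∃ base : Γ, ∃ s : Finset ι, s.Nonempty ∧ (∀ i, i ∈ s ↔ l.idxFun i = none) ∧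
      ∀ c, ∑ i, f i (l c i) = base + ∑ i ∈ s, f i c := by
  classical
  obtain ⟨c0⟩ := ‹Nonempty α›
  let s : Finset ι := Finset.univ.filter fun i => l.idxFun i = none
  refine ⟨∑ i ∈ sᶜ, f i (l c0 i), s, ?_, by simp [s], fun c => ?_⟩
  · obtain ⟨i, hi⟩ := l.proper
    exact ⟨i, by simp [s, hi]⟩
  · rw [← Finset.sum_compl_add_sum s]
    congr 1
    · refine Finset.sum_congr rfl fun i hi => ?_
      have hi' : l.idxFun i ≠ none := by simpa [s] using hi
      obtain ⟨a, ha⟩ := Option.ne_none_iff_exists'.1 hi'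
      rw [l.apply_some ha, l.apply_some ha]
    · refine Finset.sum_congr rfl fun i hi => ?_
      have hi' : l.idxFun i = none := by simpa [s] using hi
      rw [l.apply_none _ _ hi']

theorem base_sub {Γ Y : Type*} [AddCommGroup Γ] [TopologicalSpace Y] (φ : Act Γ Y)
    {v : Ultrafilter ℤ} (hv : v + v = v) {O : Set Y} (hne : O.Nonempty)
    (hcov : ∃ Φ : Finset Γ, ∀ x, ∃ a ∈ Φ, φ.f a x ∈ O) (C : Finset Γ) {A : Set ℤ} (hA : A ∈ v) :
    ∃ n ∈ A, ∃ y ∈ O, ∀ c ∈ C, φ.f (n • c) y ∈ O := by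
  classical
  obtain ⟨y0, hy0⟩ := hne
  obtain ⟨Φ, hΦ⟩ := hcov
  let α := {c // c ∈ insert 0 C}
  have : Finite α := inferInstanceAs (Finite {c // c ∈ insert 0 C})
  have : Nonempty α := ⟨⟨0, by simp⟩⟩
  obtain ⟨ι, _, hι⟩ := Combinatorics.Line.exists_mono_in_high_dimension α {a // a ∈ Φ}
  obtain ⟨n, hn⟩ := ip_fintype hv hA ι
  choose g hg hg' using hΦ
  obtain ⟨l, ⟨a, ha⟩, hl⟩ := hι (fun ω => ⟨g (φ.f (∑ i, n i • (ω i : Γ)) y0), hg _⟩)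
  obtain ⟨base, s, hs, _, hb⟩ := line_sum l (fun i c => n i • (c : Γ))
  have key : ∀ c ∈ insert 0 C, φ.f ((∑ i ∈ s, n i) • c) (φ.f (a + base) y0) ∈ O := by
    intro c hc
    have h1 := hl ⟨c, hc⟩
    have h2 : g (φ.f (∑ i, n i • (l ⟨c, hc⟩ i : Γ)) y0) = a := congrArg Subtype.val h1
    have h3 := hg' (φ.f (∑ i, n i • (l ⟨c, hc⟩ i : Γ)) y0)
    rw [h2, hb, ← Finset.sum_smul, ← φ.add] at h3
    rw [← φ.add]
    convert h3 using 2
    simp only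
    abel
  refine ⟨_, hn s hs, φ.f (a + base) y0, ?_, fun c hc => key c (by simp [hc])⟩
  have := key 0 (by simp)
  rwa [smul_zero, φ.zero] at this

structure YS {X : Type*} [TopologicalSpace X] (φ : Act ℤ X) (y : X) (D : ℕ) : Type where
  g : ℕ → ℤ

section
variable {X : Type*} [TopologicalSpace X] (φ : Act ℤ X) (y : X) (D : ℕ)

def YS.ev (γ : YS φ y D) (α : NF D) : X := φ.f (sumHom α.1 γ.g) y

instance : TopologicalSpace (YS φ y D) := TopologicalSpace.induced (YS.ev φ y D) inferInstance

def YS.act : Act (ℕ → ℤ) (YS φ y D) where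
  f a γ := ⟨a + γ.g⟩
  cont a := by
    refine continuous_induced_rng.2 (continuous_pi fun α => ?_)
    have : (fun γ : YS φ y D => YS.ev φ y D ⟨a + γ.g⟩ α) =
        fun γ => φ.f (sumHom α.1 a) (YS.ev φ y D γ α) := by
      funext γ
      simp only [YS.ev]
      rw [map_add, φ.add]
    refine this ▸ (φ.cont _).comp ?_
    exact (continuous_apply α).comp (continuous_induced_dom (f := YS.ev φ y D))
  zero γ := by cases γ; simp
  add a b γ := by cases γ; simp [add_assoc]

variable [CompactSpace X] [T2Space X]

theorem YS.cover (hmin : ∀ x, Dense (range fun n => φ.f n x)) (O : Set (YS φ y D))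
    (hO : IsOpen O) (hne : O.Nonempty) :
    ∃ Φ : Finset (ℕ → ℤ), ∀ x, ∃ a ∈ Φ, (YS.act φ y D).f a x ∈ O := by
  classical
  obtain ⟨γ0, h0⟩ := hne
  obtain ⟨Q, hQ, hQO⟩ := isOpen_induced_iff.1 hO
  have h1 : Q ∈ 𝓝 (YS.ev φ y D γ0) := hQ.mem_nhds (by rw [← hQO] at h0; exact h0)
  rw [nhds_pi, Filter.mem_pi'] at h1
  obtain ⟨I, t, ht, hI⟩ := h1
  have hW : (⋂ α : NF D, φ.f (sumHom α.1 γ0.g) ⁻¹' (t α)) ∈ 𝓝 y := by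
    rw [Filter.iInter_mem]
    intro α
    exact (φ.cont _).continuousAt.preimage_mem_nhds (ht α)
  obtain ⟨Φ, hΦ⟩ := SYN1 φ hmin y D _ hW
  refine ⟨Φ.image fun a => γ0.g + a, fun γ => ?_⟩
  obtain ⟨a, ha, h⟩ := hΦ γ.g
  refine ⟨_, Finset.mem_image_of_mem _ ha, ?_⟩
  rw [← hQO]
  apply hI
  intro α _
  have := mem_iInter.1 (h α) α
  rw [mem_preimage, ← φ.add, ← map_add, ← add_assoc] at this
  exact this

variable [SecondCountableTopology X]

theorem beta (hmin : ∀ x, Dense (range fun n => φ.f n x)) {v : Ultrafilter ℤ} (hv : v + v = v)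
    {p : ℤ → ℤ} {d : ℕ} (hp0 : p 0 = 0) (hp : p ∈ Po ℤ d) {y y' : X}
    (hlim : Tendsto (fun n => φ.f (p n) y) v (𝓝 y')) : relR φ y y' := by
  classical
  by_cases hfin : ∃ B : Set ℤ, B.Finite ∧ B ∈ v
  · obtain ⟨B, hB, hBv⟩ := hfin
    obtain ⟨m, hm, rfl⟩ := Ultrafilter.eq_pure_of_finite_mem hB hBv
    have hm0 : m = 0 := by
      have h1 : ∀ᶠ k in ((pure m + pure m : Ultrafilter ℤ) : Filter ℤ), k = m := by
        rw [hv]; exact (Filter.eventually_pure (a := m)).2 rfl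
      rw [Ultrafilter.eventually_add] at h1
      simp only [Ultrafilter.coe_pure, Filter.eventually_pure] at h1
      omega
    subst hm0
    rw [Ultrafilter.coe_pure] at hlim
    have h2 : Tendsto (fun n => φ.f (p n) y) (pure 0) (𝓝 (φ.f (p 0) y)) := tendsto_pure_nhds _ _
    have := tendsto_nhds_unique hlim h2
    rw [hp0, φ.zero] at this
    rw [this]
    exact relR_refl y
  · push Not at hfin
    refine relR.symm ?_ hmin
    intro D V hV W hW
    have pet : PET (YS.act φ y D) (v : Filter ℤ) (fun O U => O ⊆ U) :=
      { neBot := v.neBot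
        idem := idem_filter hv
        cof := fun B hB => Ultrafilter.compl_mem_iff_notMem.2 (hfin B hB)
        cover := YS.cover φ y D hmin
        mono := fun O O' U h h' => h.trans h'
        inv := fun O U a h => preimage_mono h
        base := by
          intro O U hO hU hne hR C
          rw [frequently_iff]
          intro A hA
          obtain ⟨n, hn, z, hz, h⟩ := base_sub (YS.act φ y D) hv hne (YS.cover φ y D hmin O hO hne) C hA
          exact ⟨n, hn, z, hR hz, fun c hc _ => h c hc⟩ }
    let F : Finset (ℤ → (ℕ → ℤ)) := insert 0 ((Finset.range D).image fun j => fun n =>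
      AddMonoidHom.single (fun _ : ℕ => ℤ) j (p n))
    have hF : ∀ f ∈ F, f 0 = 0 ∧ f ∈ Po (ℕ → ℤ) d := by
      intro f hf
      simp only [F, Finset.mem_insert, Finset.mem_image] at hf
      rcases hf with rfl | ⟨j, _, rfl⟩
      · exact ⟨rfl, zero_mem _⟩
      · exact ⟨by simp [hp0], Po_comp_hom _ hp⟩
    let O : Set (YS φ y D) := YS.ev φ y D ⁻¹' (Set.pi univ fun _ => interior W)
    have hO : IsOpen O := (isOpen_set_pi finite_univ fun _ _ => isOpen_interior).preimage continuous_induced_dom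
    have hne : O.Nonempty := by
      refine ⟨⟨0⟩, fun α _ => ?_⟩
      change φ.f (sumHom α.1 0) y ∈ _
      rw [map_zero, φ.zero]
      exact mem_interior_iff_mem_nhds.2 hW
    have := PET_main pet (F := F) (s := 0) (Finset.mem_insert_self _ _) hF O O hO hO hne subset_rfl
    obtain ⟨n, ⟨z, hz1, hz2⟩, hn⟩ := (this.and_eventually (hlim hV)).exists
    refine ⟨φ.f (p n) y, hn, z.g, fun α => ?_⟩
    obtain ⟨j, hj⟩ := α.2.2
    have hmem : (YS.act φ y D).f (AddMonoidHom.single (fun _ : ℕ => ℤ) j (p n)) z ∈ O := by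
      by_cases h0 : (fun n => AddMonoidHom.single (fun _ : ℕ => ℤ) j (p n)) = 0
      · have h00 := congrFun h0 n
        change _ = (0 : ℕ → ℤ) at h00
        simp only [h00]
        exact hz2
      · exact hz1 _ (Finset.mem_insert_of_mem (Finset.mem_image.2 ⟨j, α.2.1 hj, rfl⟩)) h0
    have h3 := hmem α (mem_univ _)
    have h4 : YS.ev φ y D ((YS.act φ y D).f (AddMonoidHom.single (fun _ : ℕ => ℤ) j (p n)) z) α =
        φ.f (sumHom α.1 z.g) (φ.f (p n) y) := by
      change φ.f (sumHom α.1 (AddMonoidHom.single (fun _ : ℕ => ℤ) j (p n) + z.g)) y = _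
      rw [map_add, add_comm, φ.add]
      congr 2
      change ∑ i ∈ α.1, (Pi.single j (p n) : ℕ → ℤ) i = p n
      rw [Finset.sum_eq_single_of_mem j hj (fun i _ hij => Pi.single_eq_of_ne hij _), Pi.single_eq_same]
    rw [h4] at h3
    exact interior_subset h3
end

set_option linter.unusedVariables false
open Filter Topology Function Set

theorem relP.fin {X : Type*} [TopologicalSpace X] {φ : Act ℤ X} {x y : X} (h : relP φ x y)
    {W : Set X} (hW : W ∈ 𝓝 y) (ι : Type*) [Fintype ι] :
    ∃ n : ι → ℤ, ∀ s : Finset ι, s.Nonempty → φ.f (∑ j ∈ s, n j) x ∈ W := by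
  classical
  obtain ⟨n, hn⟩ := h (Fintype.card ι) W hW
  let e := Fintype.equivFin ι
  refine ⟨fun i => n (e i), fun s hs => ?_⟩
  have := hn ⟨s.image fun i => (e i : ℕ), by
    intro k hk
    simp only [Finset.mem_image] at hk
    obtain ⟨i, _, rfl⟩ := hk
    simp, hs.image _⟩
  change φ.f (∑ j ∈ s.image fun i => (e i : ℕ), n j) x ∈ W at this
  rwa [Finset.sum_image] at this
  intro a _ b _ h
  exact e.injective (Fin.ext h)

theorem relP.fin_dvd {X : Type*} [TopologicalSpace X] {φ : Act ℤ X} {x y : X} (h : relP φ x y)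
    {W : Set X} (hW : W ∈ 𝓝 y) (ι : Type*) [Fintype ι] (P : ℕ) (hP : 0 < P) :
    ∃ n : ι → ℤ, ∀ s : Finset ι, s.Nonempty → φ.f (P * ∑ j ∈ s, n j) x ∈ W := by
  classical
  obtain ⟨n, hn⟩ := h.fin hW (Σ _ : ι, Fin (2 * P))
  have := fun i : ι => Int.erdos_ginzburg_ziv (n := P) (s := (Finset.univ : Finset (Fin (2 * P))))
    (fun k => n ⟨i, k⟩) (by simp)
  choose t _ ht1 ht2 using this
  choose m hm using ht2
  refine ⟨m, fun s hs => ?_⟩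
  have := hn (s.sigma t) (by
    obtain ⟨i, hi⟩ := hs
    obtain ⟨k, hk⟩ := Finset.card_pos.1 ((ht1 i).symm ▸ hP)
    exact ⟨⟨i, k⟩, by simp [hi, hk]⟩)
  rw [Finset.sum_sigma] at this
  rwa [Finset.mul_sum, ← Finset.sum_congr rfl fun i _ => hm i]

/-- partition Hales–Jewett -/
theorem PHJ (α : Type) [Finite α] [Nonempty α] (q : ℕ) :
    ∃ (ι : Type) (_ : Fintype ι) (blk : ι → ℕ), ∀ χ : (ι → α) → ℕ, (∀ ω, χ ω < q) →
      ∃ (l : Combinatorics.Line α ι) (j : ℕ), (∀ a, χ (l a) = j) ∧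
        ∀ i, l.idxFun i = none → blk i = j := by
  classical
  induction q with
  | zero =>
    refine ⟨Empty, inferInstance, fun _ => 0, fun χ h => ?_⟩
    exact absurd (h fun x => x.elim) (by simp)
  | succ q ih =>
    obtain ⟨ι, _, blk, h⟩ := ih
    obtain ⟨ι', _, h'⟩ := Combinatorics.Line.exists_mono_in_high_dimension α ((ι → α) → Fin (q + 1))
    refine ⟨ι ⊕ ι', inferInstance, Sum.elim blk fun _ => q, fun χ hχ => ?_⟩
    obtain ⟨l', c, hc⟩ := h' fun ω' ω => ⟨χ (Sum.elim ω ω'), hχ _⟩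
    have hc' : ∀ a ω, χ (Sum.elim ω (l' a)) = c ω := fun a ω => by
      rw [← hc a]
    by_cases hq : ∃ ω, (c ω : ℕ) = q
    · obtain ⟨ω, hω⟩ := hq
      refine ⟨l'.vertical ω, q, fun a => ?_, ?_⟩
      · rw [Combinatorics.Line.vertical_apply, hc', hω]
      · rintro (i | i) hi
        · simp [Combinatorics.Line.vertical] at hi
        · rfl
    · push Not at hq
      obtain ⟨l, j, hl, hj⟩ := h (fun ω => c ω) (fun ω => by
        have := (c ω).2
        have := hq ω
        omega)
      obtain ⟨a0⟩ := ‹Nonempty α›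
      refine ⟨l.horizontal (l' a0), j, fun a => ?_, ?_⟩
      · rw [Combinatorics.Line.horizontal_apply, hc', hl]
      · rintro (i | i) hi
        · exact hj i hi
        · simp [Combinatorics.Line.horizontal] at hi

section
variable {X : Type*} [TopologicalSpace X] (φ : Act ℤ X) [CompactSpace X] [T2Space X]
  [SecondCountableTopology X]

theorem gstep1 {O U : Set X} (hU : IsOpen U) (hR : ∀ w ∈ O, ∃ z ∈ U, relR φ w z)
    {V' : Set X} (hV' : IsOpen V') (hne : V'.Nonempty) (hsub : V' ⊆ O) (P : ℕ) (hP : 0 < P)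
    (ι : Type*) [Fintype ι] :
    ∃ V ⊆ V', IsOpen V ∧ V.Nonempty ∧ ∃ n : ι → ℤ, ∀ s : Finset ι, s.Nonempty → ∀ x ∈ V,
      φ.f (P * ∑ j ∈ s, n j) x ∈ U := by
  classical
  obtain ⟨G, hG, hGR⟩ := exists_generic (φ := φ)
  obtain ⟨w, hwV, hwG⟩ := hG.inter_open_nonempty V' hV' hne
  obtain ⟨z, hzU, hz⟩ := hR w (hsub hwV)
  obtain ⟨n, hn⟩ := (hGR w hwG z hz).fin_dvd (hU.mem_nhds hzU) ι P hP
  refine ⟨V' ∩ ⋂ s : {s : Finset ι // s.Nonempty}, φ.f (P * ∑ j ∈ s.1, n j) ⁻¹' U,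
    inter_subset_left, hV'.inter (isOpen_iInter_of_finite fun s => hU.preimage (φ.cont _)),
    ⟨w, hwV, mem_iInter.2 fun s => hn _ s.2⟩, n, fun s hs x hx => mem_iInter.1 hx.2 ⟨s, hs⟩⟩

theorem gstep4 {O U : Set X} (hO : IsOpen O) (hU : IsOpen U) (hne : O.Nonempty)
    (hR : ∀ w ∈ O, ∃ z ∈ U, relR φ w z)
    (P : ℕ) (hP : 0 < P) (ι : Type*) [Fintype ι] (blk : ι → ℕ) (a : ℕ → ℤ) (q : ℕ) :
    ∃ V : Set X, IsOpen V ∧ V.Nonempty ∧ ∃ n : ι → ℤ, ∀ j < q,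
      (∀ x ∈ V, φ.f (a j) x ∉ O) ∨ ∀ s : Finset ι, s.Nonempty → (∀ i ∈ s, blk i = j) → ∀ x ∈ V,
        φ.f (P * ∑ i ∈ s, n i) (φ.f (a j) x) ∈ U := by
  classical
  induction q with
  | zero => exact ⟨univ, isOpen_univ, ⟨hne.some, trivial⟩, fun _ => 0, by simp⟩
  | succ q ih =>
    obtain ⟨V, hV, hVne, n, hn⟩ := ih
    by_cases hq : ∀ x ∈ V, φ.f (a q) x ∉ O
    · refine ⟨V, hV, hVne, n, fun j hj => ?_⟩
      rcases Nat.lt_succ_iff_lt_or_eq.1 hj with h | rfl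
      · exact hn j h
      · exact Or.inl hq
    · push Not at hq
      obtain ⟨x, hxV, hxO⟩ := hq
      obtain ⟨V2, hV2, hV2o, ⟨w, hw⟩, m, hm⟩ := gstep1 φ hU hR
        (V' := O ∩ φ.f (-a q) ⁻¹' V) (hO.inter (hV.preimage (φ.cont _)))
        ⟨φ.f (a q) x, hxO, by rw [mem_preimage, φ.neg_f]; exact hxV⟩ inter_subset_left P hP ι
      refine ⟨φ.f (a q) ⁻¹' V2, hV2o.preimage (φ.cont _), ⟨φ.f (-a q) w, by
        rw [mem_preimage, φ.f_neg]; exact hw⟩, fun i => if blk i = q then m i else n i, ?_⟩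
      have hsub : φ.f (a q) ⁻¹' V2 ⊆ V := by
        intro y hy
        have := (hV2 hy).2
        rwa [mem_preimage, φ.neg_f] at this
      intro j hj
      rcases Nat.lt_succ_iff_lt_or_eq.1 hj with h | rfl
      · rcases hn j h with h1 | h1
        · exact Or.inl fun y hy => h1 y (hsub hy)
        · refine Or.inr fun s hs hb y hy => ?_
          have := h1 s hs hb y (hsub hy)
          rwa [Finset.sum_congr rfl fun i hi => if_neg (by rw [hb i hi]; omega)]
      · refine Or.inr fun s hs hb y hy => ?_
        rw [Finset.sum_congr rfl fun i hi => if_pos (hb i hi)]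
        exact hm s hs _ hy

theorem gamma (hmin : ∀ x, Dense (range fun n => φ.f n x)) {O U : Set X} (hO : IsOpen O)
    (hU : IsOpen U) (hne : O.Nonempty) (hR : ∀ w ∈ O, ∃ z ∈ U, relR φ w z) (C : Finset ℤ)
    (hC : ∀ c ∈ C, c ≠ 0) (hCne : C.Nonempty) (N : ℤ) :
    ∃ n ≥ N, ∃ y ∈ U, ∀ c ∈ C, φ.f (n * c) y ∈ O := by
  classical
  let α := {c // c ∈ C}
  have : Finite α := inferInstanceAs (Finite {c // c ∈ C})
  have : Nonempty α := ⟨⟨_, hCne.choose_spec⟩⟩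
  let P : ℕ := ∏ c ∈ C, c.natAbs
  have hP : 0 < P := Finset.prod_pos fun c hc => Int.natAbs_pos.2 (hC c hc)
  have hdvd : ∀ c ∈ C, c ∣ (P : ℤ) := fun c hc => by
    rw [← Int.natAbs_dvd]
    exact_mod_cast Finset.dvd_prod_of_mem Int.natAbs hc
  obtain ⟨x0, hx0⟩ := hne
  obtain ⟨Φ, hΦ⟩ := SYN2 φ hmin x0 C O (hO.mem_nhds hx0)
  -- enumerate
  obtain ⟨L, hL⟩ : ∃ L : List (ℤ × ℤ), ∀ s ∈ Φ, s ∈ L := ⟨Φ.toList, by simp⟩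
  let a : ℕ → ℤ := fun j => (L.getD j (0, 0)).1
  let f : ℕ → ℤ := fun j => (L.getD j (0, 0)).2
  have hgood : ∀ a0 b : ℤ, ∃ j < L.length, φ.f (a j + a0) x0 ∈ O ∧
      ∀ c ∈ C, φ.f (a j + a0 + c * (f j + b)) x0 ∈ O := by
    intro a0 b
    obtain ⟨s, hs, h⟩ := hΦ a0 b
    obtain ⟨j, hj, rfl⟩ := List.mem_iff_getElem.1 (hL s hs)
    refine ⟨j, hj, ?_⟩
    have h1 : L.getD j (0, 0) = L[j] := by simp [hj]
    simp only [a, f, h1]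
    exact h
  obtain ⟨ι, _, blk, hι⟩ := PHJ α L.length
  obtain ⟨V, hV, hVne, n, hn⟩ := gstep4 φ hO hU ⟨x0, hx0⟩ hR P hP ι blk a L.length
  obtain ⟨_, hw, a0, rfl⟩ := (hmin x0).inter_open_nonempty V hV hVne
  simp only at hw
  let B : (ι → α) → ℤ := fun ω => ∑ i, (P / (ω i : ℤ)) * n i
  obtain ⟨b1, hb1⟩ : ∃ b1 : ℤ, ∀ ω, b1 ≤ B ω := by
    obtain ⟨b, hb⟩ := (Set.finite_range B).bddBelow
    exact ⟨b, fun ω => hb ⟨ω, rfl⟩⟩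
  obtain ⟨b2, hb2⟩ : ∃ b2 : ℤ, ∀ (c : α) (s : Finset ι), P / (c : ℤ) * ∑ i ∈ s, n i ≤ b2 := by
    obtain ⟨b, hb⟩ := (Set.finite_range fun z : α × Finset ι => P / (z.1 : ℤ) * ∑ i ∈ z.2, n i).bddAbove
    exact ⟨b, fun c s => hb ⟨(c, s), rfl⟩⟩
  obtain ⟨b3, hb3⟩ : ∃ b3 : ℤ, ∀ j < L.length, b3 ≤ f j := by
    obtain ⟨b, hb⟩ := ((Set.finite_lt_nat L.length).image f).bddBelow
    exact ⟨b, fun j hj => hb ⟨j, hj, rfl⟩⟩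
  let b0 := N - b1 + b2 - b3
  choose χ hχ1 hχ2 hχ3 using fun ω => hgood a0 (b0 + B ω)
  obtain ⟨l, j, hl, hlj⟩ := hι χ hχ1
  obtain ⟨base, s, hs, hs', hb⟩ := line_sum l (fun i (c : α) => (P / (c : ℤ)) * n i)
  obtain ⟨c0⟩ := ‹Nonempty α›
  have hj : j < L.length := hl c0 ▸ hχ1 _
  have hBl : ∀ c, B (l c) = base + P / (c : ℤ) * ∑ i ∈ s, n i := fun c => by
    rw [Finset.mul_sum]; exact hb c
  have hajO : φ.f (a j) (φ.f a0 x0) ∈ O := by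
    have := hχ2 (l c0)
    rwa [hl, φ.add] at this
  have hyU : φ.f (P * ∑ i ∈ s, n i) (φ.f (a j) (φ.f a0 x0)) ∈ U := by
    rcases hn j hj with h | h
    · exact absurd hajO (h _ hw)
    · exact h s hs (fun i hi => hlj i ((hs' i).1 hi)) _ hw
  refine ⟨f j + b0 + base, ?_, _, hyU, ?_⟩
  · have h1 := hb1 (l c0)
    rw [hBl] at h1
    have h2 := hb2 c0 s
    have h3 := hb3 j hj
    simp only [b0]
    linarith
  · intro c hc
    have := hχ3 (l ⟨c, hc⟩) c hc
    rw [hl, hBl] at this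
    rw [← φ.add, ← φ.add, ← φ.add]
    convert this using 2
    have : c * ((P : ℤ) / c) = P := Int.mul_ediv_cancel' (hdvd c hc)
    simp only
    linear_combination (-(∑ i ∈ s, n i)) * this

theorem cover_of_min {X : Type*} [TopologicalSpace X] (φ : Act ℤ X) [CompactSpace X]
    (hmin : ∀ x, Dense (range fun n => φ.f n x)) (O : Set X) (hO : IsOpen O) (hne : O.Nonempty) :
    ∃ Φ : Finset ℤ, ∀ x, ∃ a ∈ Φ, φ.f a x ∈ O := by
  obtain ⟨Φ, hΦ⟩ := isCompact_univ.elim_finite_subcover (fun a : ℤ => φ.f a ⁻¹' O)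
    (fun a => hO.preimage (φ.cont a)) (by
      intro x _
      obtain ⟨_, hw, a0, rfl⟩ := (hmin x).inter_open_nonempty O hO hne
      exact mem_iUnion.2 ⟨a0, hw⟩)
  refine ⟨Φ, fun x => ?_⟩
  have := hΦ (mem_univ x)
  simp only [mem_iUnion] at this
  obtain ⟨a, ha, h⟩ := this
  exact ⟨a, ha, h⟩

theorem petX (hmin : ∀ x, Dense (range fun n => φ.f n x)) :
    PET φ atTop (fun O U => ∀ w ∈ O, ∃ z ∈ U, relR φ w z) where
  neBot := inferInstance
  idem := by
    intro A hA
    obtain ⟨N, hN⟩ := mem_atTop_sets.1 hA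
    filter_upwards [eventually_ge_atTop N] with m hm
    filter_upwards [eventually_ge_atTop 0] with n hn
    exact hN _ (by omega)
  cof := fun B hB => atTop_le_cofinite hB.compl_mem_cofinite
  cover := cover_of_min φ hmin
  mono := fun O O' U h h' w hw => h' w (h hw)
  inv := by
    intro O U a h w hw
    obtain ⟨z, hz, hr⟩ := h _ hw
    refine ⟨φ.f (-a) z, by rw [mem_preimage, φ.f_neg]; exact hz, ?_⟩
    have := hr.act (-a)
    rwa [φ.neg_f] at this
  base := by
    classical
    intro O U hO hU hne hR C
    rw [frequently_atTop]
    intro N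
    by_cases hC : (C.filter (· ≠ 0)).Nonempty
    · obtain ⟨n, hn, y, hy, h⟩ := gamma φ hmin hO hU hne hR (C.filter (· ≠ 0)) (by simp) hC N
      exact ⟨n, hn, y, hy, fun c hc h0 => h c (by simp [hc, h0])⟩
    · obtain ⟨w, hw⟩ := hne
      obtain ⟨z, hz, _⟩ := hR w hw
      refine ⟨N, le_rfl, z, hz, fun c hc h0 => absurd ⟨c, by simp [hc, h0]⟩ hC⟩
end

set_option linter.unusedVariables false
open Filter Topology Function Set

theorem exists_K {d : ℕ} (p : Fin d → ℤ → ℤ) (dm : ℕ) (h0 : ∀ j, p j 0 = 0)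
    (hp : ∀ j, p j ∈ Po ℤ dm) (hp2 : ∀ j, p j ∉ Po ℤ 2) :
    ∃ K : ℤ, 1 ≤ K ∧ ∀ j j' l l', sh l (fun n => p j (K * n)) = sh l' (fun n => p j' (K * n)) →
      l = l' ∧ (fun n => p j (K * n)) = (fun n => p j' (K * n)) := by
  have hdm : 1 ≤ dm ∨ d = 0 := by
    rcases Nat.eq_zero_or_pos d with h | h
    · exact Or.inr h
    · left
      by_contra hc
      exact hp2 ⟨0, h⟩ (Po_mono (by omega) (hp ⟨0, h⟩))
  rcases hdm with hdm | rfl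
  swap
  · exact ⟨1, le_rfl, fun j => j.elim0⟩
  let Ms : Set ℤ := ⋃ z : Fin d × Fin d, {m | sh m (p z.1) = p z.2}
  have hfin : Ms.Finite := by
    refine Set.finite_iUnion fun z => Set.Subsingleton.finite ?_
    intro a ha b hb
    exact sh_inj (hp z.1) (hp2 z.1) (ha.trans (Eq.symm hb))
  obtain ⟨b, hb⟩ := (hfin.image fun m => |m|).bddAbove
  have hb' : ∀ m ∈ Ms, |m| ≤ b := fun m hm => hb ⟨m, hm, rfl⟩
  refine ⟨|b| + 1, by have := abs_nonneg b; omega, ?_⟩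
  intro j j' l l' h
  set K := |b| + 1 with hK
  have hKpos : 0 < K := by positivity
  have h1 : sh (K * l) (p j) - sh (K * l') (p j') = 0 := by
    refine Po_vanish (d := dm) hKpos.ne' (sub_mem ((sh_mem_iff hdm).2 (hp j)) ((sh_mem_iff hdm).2 (hp j'))) ?_
    intro n
    have := congrFun h n
    simp only [sh, Pi.sub_apply] at this ⊢
    rw [← mul_add, ← mul_add, this, sub_self]
  rw [sub_eq_zero] at h1
  have h2 : sh (K * (l - l')) (p j) = p j' := by
    have := congrArg (sh (-(K * l'))) h1
    rw [sh_sh, sh_sh, neg_add_cancel, sh_zero (h0 j')] at this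
    rw [← this]
    congr 1
    ring
  have h3 := hb' _ (mem_iUnion.2 ⟨(j, j'), h2⟩)
  rw [abs_mul, abs_of_pos hKpos] at h3
  have h4 : |l - l'| = 0 := by
    by_contra hne
    have h5 : 1 ≤ |l - l'| := Int.one_le_abs (by simpa using hne)
    have h6 := le_abs_self b
    nlinarith
  have h5 : l = l' := by rw [abs_eq_zero] at h4; omega
  refine ⟨h5, ?_⟩
  subst h5
  rw [sub_self, mul_zero, sh_zero (h0 j)] at h2
  rw [h2]

theorem scale_notMem {p : ℤ → ℤ} {dm : ℕ} {K : ℤ} (hK : 1 ≤ K) (h0 : p 0 = 0) (hp : p ∈ Po ℤ dm)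
    (hp2 : p ∉ Po ℤ 2) : (fun n => p (K * n)) ∉ Po ℤ 2 := by
  intro h
  have h1 := Po_two h (by simp [h0])
  simp only [mul_one, smul_eq_mul] at h1
  have hid : (fun n : ℤ => n * p K) ∈ Po ℤ 2 := by
    rw [mem_Po_succ]
    intro m
    have : dl m (fun n : ℤ => n * p K) = fun _ => m * p K := by
      ext n; simp [dl]; ring
    rw [this]
    exact const_mem _
  have hg : (fun n => K * p n) - (fun n : ℤ => n * p K) = 0 := by
    refine Po_vanish (d := max dm 2) (K := K) (by omega) (sub_mem (Po_mono (le_max_left _ _)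
      (Po_comp_hom (AddMonoidHom.mulLeft K) hp)) (Po_mono (le_max_right _ _) hid)) ?_
    intro n
    simp only [Pi.sub_apply]
    rw [h1]; ring
  rw [sub_eq_zero] at hg
  refine hp2 (Po_of_comp (AddMonoidHom.mulLeft K) ?_ (hg ▸ hid))
  intro a b hab
  have : K * a = K * b := hab
  exact mul_left_cancel₀ (by omega) this

section
variable {X : Type*} [TopologicalSpace X] (φ : Act ℤ X) [CompactSpace X] [T2Space X]
  [SecondCountableTopology X]

theorem exists_Bt (hmin : ∀ x, Dense (range fun n => φ.f n x)) {U : Set X} (hU : IsOpen U)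
    (hne : U.Nonempty) : ∃ Bt : Set X, IsOpen Bt ∧ (U ∩ Bt).Nonempty ∧
      (∀ x ∈ Bt, ∀ y, relR φ x y → y ∈ Bt) ∧ ∀ w ∈ Bt, ∃ z ∈ U, relR φ w z := by
  classical
  obtain ⟨x0, hx0⟩ := hne
  obtain ⟨U1, hU1, hx1, hcl⟩ : ∃ U1 : Set X, IsOpen U1 ∧ x0 ∈ U1 ∧ closure U1 ⊆ U := by
    obtain ⟨V, hV, hVc, hVU⟩ := exists_mem_nhds_isClosed_subset (hU.mem_nhds hx0)
    exact ⟨interior V, isOpen_interior, mem_interior_iff_mem_nhds.2 hV,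
      (closure_minimal interior_subset hVc).trans hVU⟩
  let Rc : Set X := {w | ∃ z ∈ closure U1, relR φ w z}
  have hRc : IsClosed Rc := by
    have : Rc = Prod.fst '' ({z : X × X | relR φ z.1 z.2} ∩ Prod.snd ⁻¹' (closure U1)) := by
      ext w
      constructor
      · rintro ⟨z, hz, h⟩
        exact ⟨(w, z), ⟨h, hz⟩, rfl⟩
      · rintro ⟨⟨a, z⟩, ⟨h, hz⟩, rfl⟩
        exact ⟨z, hz, h⟩
    rw [this]
    exact ((isClosed_relR.inter (isClosed_closure.preimage continuous_snd)).isCompact.image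
      continuous_fst).isClosed
  have hsat : ∀ x ∈ Rc, ∀ y, relR φ x y → y ∈ Rc := by
    rintro x ⟨z, hz, h⟩ y hxy
    exact ⟨z, hz, relR.trans hmin (hxy.symm hmin) h⟩
  have hcov : ∃ Φ : Finset ℤ, ∀ x, ∃ a ∈ Φ, φ.f a x ∈ Rc := by
    obtain ⟨Φ, h⟩ := cover_of_min φ hmin U1 hU1 ⟨x0, hx1⟩
    refine ⟨Φ, fun x => ?_⟩
    obtain ⟨a, ha, h⟩ := h x
    exact ⟨a, ha, _, subset_closure h, relR_refl _⟩
  obtain ⟨Φ, hΦ, hΦmin⟩ : ∃ Φ : Finset ℤ, (∀ x, ∃ a ∈ Φ, φ.f a x ∈ Rc) ∧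
      ∀ a0 ∈ Φ, ¬ ∀ x, ∃ a ∈ Φ.erase a0, φ.f a x ∈ Rc := by
    let Q : ℕ → Prop := fun n => ∃ Φ : Finset ℤ, Φ.card = n ∧ ∀ x, ∃ a ∈ Φ, φ.f a x ∈ Rc
    have hQ : ∃ n, Q n := by obtain ⟨Φ, h⟩ := hcov; exact ⟨_, Φ, rfl, h⟩
    obtain ⟨Φ, hc, h⟩ := Nat.find_spec hQ
    refine ⟨Φ, h, fun a0 ha0 hx => ?_⟩
    exact Nat.find_min hQ (m := (Φ.erase a0).card) (by
      rw [← hc]; exact Finset.card_erase_lt_of_mem ha0) ⟨_, rfl, hx⟩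
  obtain ⟨a0, ha0, _⟩ := hΦ x0
  have hx := hΦmin a0 ha0
  push Not at hx
  obtain ⟨x, hx⟩ := hx
  let Bt : Set X := φ.f (-a0) ⁻¹' (⋂ a ∈ Φ.erase a0, φ.f a ⁻¹' Rcᶜ)
  have hBt : IsOpen Bt := (isOpen_biInter_finset fun a _ =>
    hRc.isOpen_compl.preimage (φ.cont a)).preimage (φ.cont _)
  have hBsat : ∀ x ∈ Bt, ∀ y, relR φ x y → y ∈ Bt := by
    intro x hx y hxy
    simp only [Bt, mem_preimage, mem_iInter, mem_compl_iff] at hx ⊢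
    intro a ha hy
    exact hx a ha (hsat _ hy _ (((hxy.symm hmin).act (-a0)).act a))
  have hBR : ∀ w ∈ Bt, w ∈ Rc := by
    intro w hw
    obtain ⟨a, ha, h⟩ := hΦ (φ.f (-a0) w)
    by_cases haa : a = a0
    · rw [haa, φ.f_neg] at h; exact h
    · simp only [Bt, mem_preimage, mem_iInter, mem_compl_iff] at hw
      exact absurd h (hw a (Finset.mem_erase.2 ⟨haa, ha⟩))
  refine ⟨Bt, hBt, ?_, hBsat, fun w hw => ?_⟩
  · have hxB : φ.f a0 x ∈ Bt := by
      simp only [Bt, mem_preimage, mem_iInter, mem_compl_iff]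
      rw [φ.neg_f]
      exact hx
    obtain ⟨z, hz, h⟩ := hBR _ hxB
    exact ⟨z, hcl hz, hBsat _ hxB _ h⟩
  · obtain ⟨z, hz, h⟩ := hBR w hw
    exact ⟨z, hcl hz, h⟩

theorem synd {Z : Type*} [TopologicalSpace Z] [CompactSpace Z] [T2Space Z] (Ψ : Act ℤ Z) {z : Z}
    (hz : ∀ w ∈ closure (range fun n => Ψ.f n z), z ∈ closure (range fun n => Ψ.f n w))
    (hmin : ∀ x, Dense (range fun n => φ.f n x)) {d dm : ℕ} (p : Fin d → ℤ → ℤ)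
    (h0 : ∀ j, p j 0 = 0) (hp : ∀ j, p j ∈ Po ℤ dm) {Bt : Set X} (hBt : IsOpen Bt)
    (hsat : ∀ x ∈ Bt, ∀ y, relR φ x y → y ∈ Bt) {y : X} (hy : y ∈ Bt) {Q : Set Z} (hQ : Q ∈ 𝓝 z)
    (K : ℤ) (hK : 1 ≤ K) :
    ∃ L : ℕ, ∀ N : ℤ, ∃ l : ℕ, l ≤ L ∧ N + l ∈ {n : ℤ | K ∣ n ∧ Ψ.f n z ∈ Q ∧ ∀ j, φ.f (p j n) y ∈ Bt} := by
  classical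
  set A : Set ℤ := {n : ℤ | K ∣ n ∧ Ψ.f n z ∈ Q ∧ ∀ j, φ.f (p j n) y ∈ Bt} with hA
  by_contra hcon
  push Not at hcon
  let I : Set (Ultrafilter ℤ) := {q | ∀ m : ℤ, {n | m + n ∉ A} ∈ q}
  have hIc : IsClosed I := by
    have : I = ⋂ m : ℤ, {q : Ultrafilter ℤ | {n | m + n ∉ A} ∈ q} := by
      ext q; simp only [I, mem_iInter]; rfl
    rw [this]
    exact isClosed_iInter fun m => ultrafilter_isClosed_basic _
  have hIl : ∀ q ∈ I, ∀ r, r + q ∈ I := by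
    intro q hq r m
    change ∀ᶠ n in ((r + q : Ultrafilter ℤ) : Filter ℤ), m + n ∉ A
    rw [Ultrafilter.eventually_add]
    refine Filter.Eventually.of_forall fun a => ?_
    have := hq (m + a)
    filter_upwards [this] with b hb
    rwa [← add_assoc]
  obtain ⟨p0, hp0⟩ : I.Nonempty := by
    choose N hN using hcon
    refine ⟨(hyperfilter ℕ).map fun L => N (2 * L) + L, fun m => ?_⟩
    rw [Ultrafilter.mem_map]
    have : ∀ᶠ L : ℕ in atTop, m.natAbs ≤ L := eventually_ge_atTop _
    have h2 : ∀ᶠ L : ℕ in (hyperfilter ℕ : Filter ℕ), m.natAbs ≤ L := Nat.hyperfilter_le_atTop this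
    filter_upwards [h2] with L hL
    have := hN (2 * L) (m + L).toNat (by omega)
    have e : N (2 * L) + ((m + L).toNat : ℤ) = m + (N (2 * L) + L) := by
      rw [Int.toNat_of_nonneg (by omega)]; ring
    rw [e] at this
    exact this
  have hcl : IsClosed ((fun q => pt Ψ q z) '' I) :=
    (hIc.isCompact.image (pt_cont Ψ z)).isClosed
  have hw : pt Ψ p0 z ∈ closure (range fun n => Ψ.f n z) :=
    mem_closure_of_tendsto (tendsto_pt Ψ p0 z) (Eventually.of_forall fun n => ⟨n, rfl⟩)
  obtain ⟨p1, hp1, hp1x⟩ : z ∈ (fun q => pt Ψ q z) '' I := by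
    rw [← hcl.closure_eq]
    refine closure_mono ?_ (hz _ hw)
    rintro _ ⟨n, rfl⟩
    refine ⟨pure n + p0, hIl _ hp0 _, ?_⟩
    simp only [pt_add, pt_pure]
  obtain ⟨v, ⟨hvI, hvz⟩, hvv⟩ := exists_idempotent_in_compact_add_subsemigroup
    (M := Ultrafilter ℤ) Ultrafilter.continuous_add_left (I ∩ {q | pt Ψ q z = z})
    ⟨p1, hp1, hp1x⟩ (hIc.inter (isClosed_eq (pt_cont Ψ z) continuous_const)).isCompact
    (by
      rintro a ⟨ha, ha'⟩ b ⟨hb, hb'⟩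
      refine ⟨hIl _ hb _, ?_⟩
      simp only [Set.mem_ofPred_eq] at *
      rw [pt_add, hb', ha'])
  have h1 : ∀ᶠ n in (v : Filter ℤ), K ∣ n := by
    have hKn : NeZero K.toNat := ⟨by omega⟩
    obtain ⟨r, hr⟩ := (v.map fun n : ℤ => (n : ZMod K.toNat)).eq_pure_of_finite
    have hr' : ∀ᶠ n : ℤ in (v : Filter ℤ), (n : ZMod K.toNat) = r := by
      have : ({r} : Set (ZMod K.toNat)) ∈ v.map fun n : ℤ => (n : ZMod K.toNat) := by
        rw [hr]; exact Filter.mem_pure.2 rfl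
      exact this
    have hr2 := hr'
    rw [← hvv, Ultrafilter.eventually_add] at hr2
    obtain ⟨a, ha, ha'⟩ := (hr'.and hr2).exists
    obtain ⟨b, hb, hb'⟩ := (hr'.and ha').exists
    push_cast at hb'
    rw [ha, hb] at hb'
    have hr0 : r = 0 := by simpa using hb'
    filter_upwards [hr'] with n hn
    rw [hr0, ZMod.intCast_zmod_eq_zero_iff_dvd] at hn
    rwa [Int.toNat_of_nonneg (by omega)] at hn
  have h2 : ∀ᶠ n in (v : Filter ℤ), Ψ.f n z ∈ Q := by
    have := tendsto_pt Ψ v z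
    rw [show pt Ψ v z = z from hvz] at this
    exact this hQ
  have h3 : ∀ᶠ n in (v : Filter ℤ), ∀ j, φ.f (p j n) y ∈ Bt := by
    rw [Filter.eventually_all]
    intro j
    obtain ⟨y', -, hy'⟩ := isCompact_univ.ultrafilter_le_nhds (v.map fun n => φ.f (p j n) y) (by simp)
    have hlim : Tendsto (fun n => φ.f (p j n) y) v (𝓝 y') := hy'
    have := beta φ hmin hvv (h0 j) (hp j) hlim
    exact hlim (hBt.mem_nhds (hsat y hy _ this))
  have h4 := hvI 0
  obtain ⟨n, hn, a, b, c⟩ := (Filter.Eventually.and (p := fun n => (0 : ℤ) + n ∉ A) h4 (h1.and (h2.and h3))).exists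
  rw [zero_add] at hn
  exact hn ⟨a, b, c⟩

theorem shrink {V : Set X} (hV : IsOpen V) (hne : V.Nonempty) {I : Type*} [Fintype I] (Q : I → Set X)
    (hQ : ∀ c, IsOpen (Q c)) : ∃ W ⊆ V, IsOpen W ∧ W.Nonempty ∧ ∀ c, W ⊆ Q c ∨ ∀ w ∈ W, w ∉ Q c := by
  classical
  suffices h : ∀ s : Finset I, ∃ W ⊆ V, IsOpen W ∧ W.Nonempty ∧ ∀ c ∈ s, W ⊆ Q c ∨ ∀ w ∈ W, w ∉ Q c by
    obtain ⟨W, a, b, c, h⟩ := h Finset.univ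
    exact ⟨W, a, b, c, fun i => h i (Finset.mem_univ _)⟩
  intro s
  induction s using Finset.induction_on with
  | empty => exact ⟨V, subset_rfl, hV, hne, by simp⟩
  | insert c s hc ih =>
    obtain ⟨W, hWV, hW, hWn, h⟩ := ih
    by_cases hd : ∀ w ∈ W, w ∉ Q c
    · refine ⟨W, hWV, hW, hWn, fun i hi => ?_⟩
      rcases Finset.mem_insert.1 hi with rfl | hi
      · exact Or.inr hd
      · exact h i hi
    · push Not at hd
      obtain ⟨w, hw, hwQ⟩ := hd
      refine ⟨W ∩ Q c, inter_subset_left.trans hWV, hW.inter (hQ c), ⟨w, hw, hwQ⟩, fun i hi => ?_⟩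
      rcases Finset.mem_insert.1 hi with rfl | hi
      · exact Or.inl inter_subset_right
      · rcases h i hi with h | h
        · exact Or.inl (inter_subset_left.trans h)
        · exact Or.inr fun w hw => h w hw.1

theorem exchangeAll (hmin : ∀ x, Dense (range fun n => φ.f n x)) {U Bt : Set X} (hU : IsOpen U)
    (hBt : IsOpen Bt) (hBU : ∀ w ∈ Bt, ∃ z ∈ U, relR φ w z) {V : Set X} (hV : IsOpen V)
    (hVne : V.Nonempty) {I : Type*} [Fintype I] (P : I → ℤ → ℤ) (dm : ℕ) (hP : ∀ c, P c ∈ Po ℤ dm)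
    (hP2 : ∀ c, P c ∉ Po ℤ 2) (hinj : ∀ M c c', sh M (P c) = sh M (P c') → P c M = P c' M) (N : ℤ) :
    ∃ W ⊆ V, IsOpen W ∧ W.Nonempty ∧ ∃ M ≥ N, ∀ c, (∀ w ∈ W, φ.f (P c M) w ∈ U) ∨
      ∀ w ∈ W, φ.f (P c M) w ∉ Bt := by
  classical
  suffices h : ∀ s : Finset I, ∃ W ⊆ V, IsOpen W ∧ W.Nonempty ∧ ∃ M ≥ N, ∀ c,
      (∀ w ∈ W, φ.f (P c M) w ∈ U) ∨ (∀ w ∈ W, φ.f (P c M) w ∉ Bt) ∨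
        (c ∉ s ∧ ∀ w ∈ W, φ.f (P c M) w ∈ Bt) by
    obtain ⟨W, hW, hWo, hWn, M, hM, h⟩ := h Finset.univ
    refine ⟨W, hW, hWo, hWn, M, hM, fun c => ?_⟩
    rcases h c with h | h | h
    · exact Or.inl h
    · exact Or.inr h
    · exact absurd (Finset.mem_univ c) h.1
  intro s
  induction s using Finset.induction_on with
  | empty =>
    obtain ⟨W, hWV, hW, hWn, h⟩ := shrink hV hVne (fun c => φ.f (P c N) ⁻¹' Bt)
      (fun c => hBt.preimage (φ.cont _))
    refine ⟨W, hWV, hW, hWn, N, le_rfl, fun c => ?_⟩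
    rcases h c with h | h
    · exact Or.inr (Or.inr ⟨by simp, h⟩)
    · exact Or.inr (Or.inl h)
  | insert c0 s hc0 ih =>
    obtain ⟨W, hWV, hW, hWn, M, hM, h⟩ := ih
    by_cases hthird : (∀ w ∈ W, φ.f (P c0 M) w ∈ U) ∨ (∀ w ∈ W, φ.f (P c0 M) w ∉ Bt)
    · refine ⟨W, hWV, hW, hWn, M, hM, fun c => ?_⟩
      by_cases hc : c = c0
      · subst hc
        rcases hthird with h | h
        · exact Or.inl h
        · exact Or.inr (Or.inl h)
      · rcases h c with h | h | h
        · exact Or.inl h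
        · exact Or.inr (Or.inl h)
        · exact Or.inr (Or.inr ⟨by simp [hc, h.1], h.2⟩)
    have hB : ∀ w ∈ W, φ.f (P c0 M) w ∈ Bt := by
      rcases h c0 with h | h | h
      · exact absurd (Or.inl h) hthird
      · exact absurd (Or.inr h) hthird
      · exact h.2
    have hdm : 1 ≤ dm := by
      by_contra hc
      exact hP2 c0 (Po_mono (by omega) (hP c0))
    let F : Finset (ℤ → ℤ) := insert 0 (Finset.univ.image fun c => sh M (P c))
    have hF : ∀ f ∈ F, f 0 = 0 ∧ f ∈ Po ℤ dm := by
      intro f hf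
      simp only [F, Finset.mem_insert, Finset.mem_image] at hf
      rcases hf with rfl | ⟨c, _, rfl⟩
      · exact ⟨rfl, zero_mem _⟩
      · exact ⟨sh_zero_apply _ _, (sh_mem_iff hdm).2 (hP c)⟩
    have hmemF : ∀ c, sh M (P c) ∈ F := fun c =>
      Finset.mem_insert_of_mem (Finset.mem_image_of_mem _ (Finset.mem_univ c))
    have hpq := PET_main (petX φ hmin) (hmemF c0) hF W (φ.f (P c0 M) ⁻¹' U) hW
      (hU.preimage (φ.cont _)) hWn (by
        intro w hw
        obtain ⟨z, hz, hr⟩ := hBU _ (hB w hw)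
        refine ⟨φ.f (-P c0 M) z, by rw [mem_preimage, φ.f_neg]; exact hz, ?_⟩
        have := hr.act (-P c0 M)
        rwa [φ.neg_f] at this)
    rw [frequently_atTop] at hpq
    obtain ⟨n, hn, y, hy1, hy2⟩ := hpq 0
    have hs0 : (0 : ℤ → ℤ) ≠ sh M (P c0) := by
      intro h0
      refine hP2 c0 ((sh_mem_iff (m := M) (by norm_num)).1 ?_)
      rw [← h0]; exact zero_mem _
    have hyW : y ∈ W := by
      have := hy1 0 (Finset.mem_insert_self _ _) hs0
      rwa [Pi.zero_apply, φ.zero] at this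
    have hsplit : ∀ c w, φ.f (P c (M + n)) w = φ.f (P c M) (φ.f (sh M (P c) n) w) := by
      intro c w
      rw [← φ.add]
      congr 1
      simp only [sh]
      rw [add_comm n M]; ring
    let Q : I → Set X := fun c => if sh M (P c) = sh M (P c0) then
      φ.f (sh M (P c) n) ⁻¹' (φ.f (P c0 M) ⁻¹' U) else φ.f (sh M (P c) n) ⁻¹' W
    have hQo : ∀ c, IsOpen (Q c) := by
      intro c
      by_cases hc : sh M (P c) = sh M (P c0)
      · simp only [Q, if_pos hc]
        exact (hU.preimage (φ.cont _)).preimage (φ.cont _)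
      · simp only [Q, if_neg hc]
        exact hW.preimage (φ.cont _)
    refine ⟨W ∩ ⋂ c, Q c, inter_subset_left.trans hWV, hW.inter (isOpen_iInter_of_finite hQo),
      ⟨y, hyW, mem_iInter.2 fun c => ?_⟩, M + n, by omega, fun c => ?_⟩
    · by_cases hc : sh M (P c) = sh M (P c0)
      · simp only [Q, if_pos hc]
        rw [hc]; exact hy2
      · simp only [Q, if_neg hc]
        exact hy1 _ (hmemF c) hc
    · by_cases hc : sh M (P c) = sh M (P c0)
      · left
        intro w hw
        have := mem_iInter.1 hw.2 c
        simp only [Q, if_pos hc] at this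
        rw [hsplit, hinj M c c0 hc]
        exact this
      · have hcc : c ≠ c0 := fun h => hc (by rw [h])
        have hw' : ∀ w ∈ W ∩ ⋂ c, Q c, φ.f (sh M (P c) n) w ∈ W := by
          intro w hw
          have := mem_iInter.1 hw.2 c
          simp only [Q, if_neg hc] at this
          exact this
        rcases h c with h | h | h
        · exact Or.inl fun w hw => by rw [hsplit]; exact h _ (hw' w hw)
        · exact Or.inr (Or.inl fun w hw => by rw [hsplit]; exact h _ (hw' w hw))
        · exact Or.inr (Or.inr ⟨by simp [hcc, h.1], fun w hw => by rw [hsplit]; exact h.2 _ (hw' w hw)⟩)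

theorem main_lemma {k : ℕ} (Ψ : Act ℤ (Fin k → X)) {Ω : Set X} (hΩ : IsGδ Ω) (hΩd : Dense Ω)
    (hz : ∀ y ∈ Ω, ∀ w ∈ closure (range fun n => Ψ.f n (fun _ => y)),
      (fun _ => y) ∈ closure (range fun n => Ψ.f n w))
    (hmin : ∀ x, Dense (range fun n => φ.f n x)) {d dm : ℕ} (p : Fin d → ℤ → ℤ)
    (h0 : ∀ j, p j 0 = 0) (hp : ∀ j, p j ∈ Po ℤ dm) (hp2 : ∀ j, p j ∉ Po ℤ 2)
    {U : Set X} (hU : IsOpen U) (hUn : U.Nonempty) (N : ℤ) :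
    ∃ y ∈ U, ∃ n ≥ N, (∀ i, Ψ.f n (fun _ => y) i ∈ U) ∧ ∀ j, φ.f (p j n) y ∈ U := by
  classical
  obtain ⟨Bt, hBt, hne, hsat, hBU⟩ := exists_Bt φ hmin hU hUn
  obtain ⟨K, hK, hKinj⟩ := exists_K p dm h0 hp hp2
  let Q : Set (Fin k → X) := Set.pi univ fun _ => U
  have hQ : IsOpen Q := isOpen_set_pi finite_univ fun _ _ => hU
  let E : ℕ → Set X := fun L => {y | y ∈ U ∩ Bt ∧ ∀ N : ℤ, ∃ l : ℕ, l ≤ L ∧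
    N + l ∈ {n : ℤ | K ∣ n ∧ Ψ.f n (fun _ => y) ∈ Q ∧ ∀ j, φ.f (p j n) y ∈ Bt}}
  have hdense := hΩ.dense_iUnion_interior_of_closed hΩd
    (f := fun o : Option ℕ => o.elim (U ∩ Bt)ᶜ fun L => closure (E L))
    (by rintro (_ | L); exacts [(hU.inter hBt).isClosed_compl, isClosed_closure]) (by
      intro y hy
      by_cases hyU : y ∈ U ∩ Bt
      · obtain ⟨L, hL⟩ := synd φ Ψ (hz y hy) hmin p h0 hp hBt hsat hyU.2
          (hQ.mem_nhds (fun i _ => hyU.1)) K hK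
        exact mem_iUnion.2 ⟨some L, subset_closure ⟨hyU, hL⟩⟩
      · exact mem_iUnion.2 ⟨none, hyU⟩)
  obtain ⟨x, hx1, hx2⟩ := hdense.inter_open_nonempty _ (hU.inter hBt) hne
  obtain ⟨o, ho⟩ := mem_iUnion.1 hx2
  rcases o with _ | L
  · exact absurd hx1 (interior_subset ho)
  change x ∈ interior (closure (E L)) at ho
  let P : Fin d × Fin (L + 1) → ℤ → ℤ := fun c n => p c.1 (K * (n + (c.2 : ℕ)))
  have hPtr : ∀ c, P c = tr (c.2 : ℕ) (fun n => p c.1 (K * n)) := fun c => rfl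
  obtain ⟨W, hWV, hW, hWn, M, hM, hWc⟩ := exchangeAll φ hmin hU hBt hBU
    (V := interior (closure (E L))) isOpen_interior ⟨x, ho⟩ P dm
    (fun c => by rw [hPtr]; exact tr_mem (Po_scale K (hp _)) _)
    (fun c => by
      rw [hPtr, tr_mem_iff]
      exact scale_notMem hK (h0 _) (hp _) (hp2 _))
    (by
      intro M c c' h
      have h1 := hKinj c.1 c'.1 (M + (c.2 : ℕ)) (M + (c'.2 : ℕ)) (by
        ext n
        have := congrFun h n
        simpa only [sh, P, add_assoc] using this)
      have h2 := congrFun h1.2 (M + (c.2 : ℕ))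
      simp only [P]
      rw [← h1.1]
      exact h2) (max N 0)
  obtain ⟨w, hw⟩ := hWn
  obtain ⟨y, hyW, hyE⟩ := mem_closure_iff.1 (interior_subset (hWV hw)) W hW hw
  obtain ⟨l', hl', hdvd, hyQ, hyB⟩ := hyE.2 (K * M)
  have hd' : K ∣ (l' : ℤ) := (Int.dvd_add_right (dvd_mul_right K M)).1 hdvd
  obtain ⟨l, hl⟩ := hd'
  have hl0 : 0 ≤ l := by
    by_contra hc
    have : K * l < 0 := mul_neg_of_pos_of_neg (by omega) (by omega)
    omega
  have hlL : l ≤ L := by nlinarith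
  refine ⟨y, hyE.1.1, K * M + l', ?_, fun i => hyQ i (mem_univ _), fun j => ?_⟩
  · have h1 := le_max_left N 0
    have h2 := le_max_right N 0
    nlinarith
  · have e : K * M + l' = K * (M + (l.toNat : ℤ)) := by
      rw [Int.toNat_of_nonneg hl0, hl]; ring
    have hb := hyB j
    rw [e] at hb ⊢
    rcases hWc (j, ⟨l.toNat, by omega⟩) with h | h
    · exact h y hyW
    · exact absurd hb (h y hyW)
end

set_option linter.unusedVariables false
open Filter Topology Function Set

section
variable {X : Type*} [TopologicalSpace X]

theorem hpowNat_eq (T : X ≃ₜ X) (n : ℕ) : hpowNat T n = T ^ n := by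
  induction n with
  | zero => rfl
  | succ n ih => rw [hpowNat, ih, pow_succ']; rfl

theorem hpowInt_eq (T : X ≃ₜ X) (n : ℤ) : hpowInt T n = T ^ n := by
  cases n with
  | ofNat n => simp only [hpowInt, hpowNat_eq, Int.ofNat_eq_natCast, zpow_natCast]
  | negSucc n => rw [hpowInt, hpowNat_eq, zpow_negSucc]; rfl

theorem hpow_add (T : X ≃ₜ X) (a b : ℤ) (x : X) : hpow T (a + b) x = hpow T a (hpow T b x) := by
  simp only [hpow, hpowInt_eq, zpow_add]; rfl

theorem hpow_zero (T : X ≃ₜ X) (x : X) : hpow T 0 x = x := rfl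

def hAct (T : X ≃ₜ X) : Act ℤ X where
  f := hpow T
  cont n := (hpowInt T n).continuous
  zero := hpow_zero T
  add := hpow_add T

theorem hpow_hpowNat (S : X ≃ₜ X) (m : ℕ) (n : ℤ) : hpow (hpowNat S m) n = hpow S (m * n) := by
  simp only [hpow, hpowInt_eq, hpowNat_eq, zpow_mul, zpow_natCast]

theorem hpowNat_pi {k : ℕ} (e : Fin k → X ≃ₜ X) (n : ℕ) (z : Fin k → X) (i : Fin k) :
    hpowNat (Homeomorph.piCongrRight e) n z i = hpowNat (e i) n (z i) := by
  induction n with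
  | zero => rfl
  | succ n ih =>
    change e i (hpowNat (Homeomorph.piCongrRight e) n z i) = e i (hpowNat (e i) n (z i))
    rw [ih]

theorem hpow_pi {k : ℕ} (e : Fin k → X ≃ₜ X) (n : ℤ) (z : Fin k → X) (i : Fin k) :
    hpow (Homeomorph.piCongrRight e) n z i = hpow (e i) n (z i) := by
  cases n with
  | ofNat n => exact hpowNat_pi e n z i
  | negSucc n =>
    change (hpowNat (Homeomorph.piCongrRight e) (n + 1)).symm z i = (hpowNat (e i) (n + 1)).symm (z i)
    rw [Homeomorph.eq_symm_apply, ← hpowNat_pi, Homeomorph.apply_symm_apply]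

end

theorem countable_polyQ : Countable (Polynomial ℚ) := by
  rw [← Cardinal.mk_le_aleph0_iff]
  exact (Polynomial.cardinalMk_le_max).trans (by simp)

instance countable_intPoly : Countable {p : ℤ → ℤ // IsNonlinearIntPoly0 p} := by
  have := countable_polyQ
  choose f hf using fun p : {p : ℤ → ℤ // IsNonlinearIntPoly0 p} => p.2.2
  refine Function.Injective.countable (f := f) ?_
  intro a b h
  apply Subtype.ext
  funext n
  have h1 := (hf a).1 n
  have h2 := (hf b).1 n
  rw [h, ← h2] at h1
  exact_mod_cast h1

/-- **Corollary.** Let `(X,T)`, `(X,S)` be minimal and `(X,S)` multiply `k`-minimal. Then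
there is a residual subset `X₀` of `X` such that for all `x ∈ X₀` and all nonlinear
integral polynomials `p 0, …, p (d-1)` vanishing at `0` there is a sequence `nᵢ → ∞` with
`S^{m nᵢ} x → x` for `1 ≤ m ≤ k` and `T^{p j (nᵢ)} x → x` for all `j`. -/
theorem multiple_recurrence_multiply_k_minimal
    {X : Type*} [MetricSpace X] [CompactSpace X] (T S : X ≃ₜ X)
    (hT : IsMinimalTDS T) (hS : IsMinimalTDS S)
    (k : ℕ) (hk : MultiplyMinimal S k) :
    ∃ X₀ ∈ residual X, ∀ x ∈ X₀,
      ∀ (d : ℕ) (p : Fin d → ℤ → ℤ), (∀ j, IsNonlinearIntPoly0 (p j)) →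
        ∃ ns : ℕ → ℤ, Tendsto ns atTop atTop ∧
          (∀ m : ℕ, 1 ≤ m → m ≤ k →
            Tendsto (fun i => hpow S ((m : ℤ) * ns i) x) atTop (𝓝 x)) ∧
          ∀ j : Fin d, Tendsto (fun i => hpow T (p j (ns i)) x) atTop (𝓝 x) := by
  classical
  obtain ⟨Ω, hΩ, hΩd, hmp⟩ := hk
  let Ψ : Act ℤ (Fin k → X) :=
    hAct (Homeomorph.piCongrRight fun i : Fin k => hpowNat S ((i : ℕ) + 1))
  have hΨ : ∀ n z i, Ψ.f n z i = hpow S (((i : ℕ) + 1 : ℕ) * n) (z i) := by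
    intro n z i
    change hpow (Homeomorph.piCongrRight fun i : Fin k => hpowNat S ((i : ℕ) + 1)) n z i = _
    rw [hpow_pi, hpow_hpowNat]
  let J : Type := Σ d : ℕ, (Fin d → {p : ℤ → ℤ // IsNonlinearIntPoly0 p}) × ℕ
  let G : J → Set X := fun c => {x | ∃ n : ℤ, (c.2.2 : ℤ) ≤ n ∧
    (∀ i : Fin k, dist (hpow S (((i : ℕ) + 1 : ℕ) * n) x) x < 1 / ((c.2.2 : ℝ) + 1)) ∧
    ∀ j, dist (hpow T ((c.2.1 j).1 n) x) x < 1 / ((c.2.2 : ℝ) + 1)}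
  have hGo : ∀ c, IsOpen (G c) := by
    intro c
    have hpc : ∀ (R : X ≃ₜ X) (n : ℤ), Continuous (hpow R n) := fun R n => (hpowInt R n).continuous
    have : G c = ⋃ n : ℤ, ⋃ _ : (c.2.2 : ℤ) ≤ n,
        ((⋂ i : Fin k, {x | dist (hpow S (((i : ℕ) + 1 : ℕ) * n) x) x < 1 / ((c.2.2 : ℝ) + 1)}) ∩
        ⋂ j, {x | dist (hpow T ((c.2.1 j).1 n) x) x < 1 / ((c.2.2 : ℝ) + 1)}) := by
      ext x
      simp only [G, mem_iUnion, mem_inter_iff, mem_iInter, Set.mem_ofPred_eq, exists_prop]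
    rw [this]
    refine isOpen_iUnion fun n => isOpen_iUnion fun _ => IsOpen.inter ?_ ?_
    · exact isOpen_iInter_of_finite fun i => isOpen_lt ((hpc _ _).dist continuous_id) continuous_const
    · exact isOpen_iInter_of_finite fun i => isOpen_lt ((hpc _ _).dist continuous_id) continuous_const
  have hGd : ∀ c, Dense (G c) := by
    intro c
    rw [dense_iff_inter_open]
    rintro V hV ⟨x, hx⟩
    set ε : ℝ := 1 / ((c.2.2 : ℝ) + 1) with hε
    have hεpos : 0 < ε := by positivity
    choose dm hdm using fun j => (intPoly_mem (c.2.1 j).2).2.2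
    obtain ⟨y, hy, n, hn, h1, h2⟩ := main_lemma (hAct T) Ψ hΩ hΩd (by
        intro y hy w hw
        have h1 := hmp y hy w hw
        change (fun _ => y) ∈ closure (zorbit _ w)
        rw [h1]
        exact subset_closure ⟨0, rfl⟩) hT
      (dm := Finset.univ.sup dm) (fun j => (c.2.1 j).1) (fun j => (intPoly_mem (c.2.1 j).2).1)
      (fun j => Po_mono (Finset.le_sup (Finset.mem_univ j)) (hdm j))
      (fun j => (intPoly_mem (c.2.1 j).2).2.1)
      (U := V ∩ Metric.ball x (ε / 2)) (hV.inter Metric.isOpen_ball)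
      ⟨x, hx, Metric.mem_ball_self (by positivity)⟩ (c.2.2 : ℤ)
    have hd : ∀ z, z ∈ V ∩ Metric.ball x (ε / 2) → dist z y < ε := by
      intro z hz
      have a := Metric.mem_ball.1 hz.2
      have b := Metric.mem_ball'.1 hy.2
      calc dist z y ≤ dist z x + dist x y := dist_triangle _ _ _
        _ < ε / 2 + ε / 2 := add_lt_add a b
        _ = ε := by ring
    refine ⟨y, hy.1, n, hn, fun i => hd _ ?_, fun j => hd _ (h2 j)⟩
    have := h1 i
    rwa [hΨ] at this
  refine ⟨⋂ c, G c, countable_iInter_mem.2 fun c => residual_of_dense_open (hGo c) (hGd c), ?_⟩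
  intro x hx d p hp
  have hx' := fun i : ℕ => mem_iInter.1 hx ⟨d, fun j => ⟨p j, hp j⟩, i⟩
  choose ns h1 h2 h3 using hx'
  have hlim : Tendsto (fun i : ℕ => 1 / ((i : ℝ) + 1)) atTop (𝓝 0) :=
    tendsto_one_div_add_atTop_nhds_zero_nat
  refine ⟨ns, ?_, ?_, ?_⟩
  · exact tendsto_atTop_mono h1 tendsto_natCast_atTop_atTop
  · intro m hm1 hmk
    rw [tendsto_iff_dist_tendsto_zero]
    refine squeeze_zero (fun _ => dist_nonneg) (fun i => ?_) hlim
    have := h2 i ⟨m - 1, by omega⟩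
    simp only [Nat.sub_add_cancel hm1] at this
    exact this.le
  · intro j
    rw [tendsto_iff_dist_tendsto_zero]
    exact squeeze_zero (fun _ => dist_nonneg) (fun i => (h3 i j).le) hlim
end

section
/- Let (X,T) be a minimal topological dynamical system, d ∈ ℕ, and let p_1, …, p_d be integral polynomials with p_i(0) = 0 and deg(p_i) ≥ 2 for every 1 ≤ i ≤ d. Then there is a dense Gδ subset X_0 of X such that for each x ∈ X_0 and each neighbourhood U of x, the set N_{{p_1,…,p_d}}(x,U) = {n ∈ ℤ : T^{p_1(n)}x ∈ U, …, T^{p_d(n)}x ∈ U} is piecewise syndetic. -/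
open Filter Topology Function Set

/-- A subset of `ℤ` is syndetic if it has bounded gaps. -/
def Syndetic (A : Set ℤ) : Prop :=
  ∃ N : ℕ, ∀ i : ℤ, ∃ j : ℤ, i ≤ j ∧ j ≤ i + N ∧ j ∈ A

/-- A subset of `ℤ` is thick if it contains arbitrarily long runs of consecutive integers. -/
def Thick (A : Set ℤ) : Prop :=
  ∀ N : ℕ, ∃ i : ℤ, ∀ j : ℤ, i ≤ j → j ≤ i + N → j ∈ A

/-- A subset of `ℤ` is piecewise syndetic if it is the intersection of a syndetic set
with a thick set. -/
def PiecewiseSyndetic (A : Set ℤ) : Prop :=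
  ∃ S T : Set ℤ, Syndetic S ∧ Thick T ∧ A = S ∩ T


namespace PRT

/-- `P i p`: `p` is polynomial of degree at most `i` (all differences of order `i+1` vanish). -/
def P {V : Type*} [AddCommGroup V] : ℕ → (ℤ → V) → Prop
  | 0, p => ∀ n, p n = p 0
  | i + 1, p => ∀ h, P i (fun n => p (n + h) - p n)

section polys
variable {V : Type*} [AddCommGroup V]

lemma P_const (i : ℕ) (c : V) : P i (fun _ : ℤ => c) := by
  induction i generalizing c with
  | zero => intro n; rfl
  | succ i ih => intro h; simpa using ih 0

lemma P_succ {i : ℕ} {p : ℤ → V} (hp : P i p) : P (i + 1) p := by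
  induction i generalizing p with
  | zero =>
    intro h n
    simp only
    rw [hp (n + h), hp n, hp (0 + h)]
  | succ i ih => intro h; exact ih (hp h)

lemma P_mono {i j : ℕ} (hij : i ≤ j) {p : ℤ → V} (hp : P i p) : P j p := by
  induction hij with
  | refl => exact hp
  | step _ ih => exact P_succ ih

lemma P_add {i : ℕ} {p q : ℤ → V} (hp : P i p) (hq : P i q) : P i (fun n => p n + q n) := by
  induction i generalizing p q with
  | zero => intro n; simp only; rw [hp n, hq n]
  | succ i ih =>
    intro h
    have := ih (hp h) (hq h)
    convert this using 2
    (try beta_reduce)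
    abel

lemma P_map {W : Type*} [AddCommGroup W] (f : V →+ W) {i : ℕ} {p : ℤ → V} (hp : P i p) :
    P i (fun n => f (p n)) := by
  induction i generalizing p with
  | zero => intro n; simp only; rw [hp n]
  | succ i ih =>
    intro h
    have := ih (hp h)
    simpa using this

lemma P_of_map {W : Type*} [AddCommGroup W] (f : V →+ W) (hf : Injective f) {i : ℕ} {p : ℤ → V}
    (hp : P i (fun n => f (p n))) : P i p := by
  induction i generalizing p with
  | zero => intro n; exact hf (hp n)
  | succ i ih =>
    intro h
    apply ih
    have := hp h
    simpa using this

lemma P_neg {i : ℕ} {p : ℤ → V} (hp : P i p) : P i (fun n => - p n) :=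
  P_map (negAddMonoidHom (α := V)) hp

lemma P_sub {i : ℕ} {p q : ℤ → V} (hp : P i p) (hq : P i q) : P i (fun n => p n - q n) := by
  have := P_add hp (P_neg hq)
  simpa [sub_eq_add_neg] using this

lemma P_shift {i : ℕ} {p : ℤ → V} (hp : P i p) (k : ℤ) : P i (fun n => p (n + k)) := by
  induction i generalizing p with
  | zero => intro n; simp only; rw [hp (n + k), hp (0 + k)]
  | succ i ih =>
    intro h
    have := ih (hp h)
    convert this using 4
    ring

lemma P_scale {i : ℕ} {p : ℤ → V} (hp : P i p) (k : ℤ) : P i (fun n => p (k * n)) := by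
  induction i generalizing p with
  | zero => intro n; simp only; rw [hp (k * n), hp (k * 0)]
  | succ i ih =>
    intro h
    have := ih (hp (k * h))
    convert this using 4
    ring

lemma P_diff {i : ℕ} {p : ℤ → V} (hp : P (i + 1) p) (h : ℤ) : P i (fun n => p (n + h) - p n) :=
  hp h

lemma P_pi {ι : Type*} {i : ℕ} {p : ℤ → ι → V} (hp : ∀ m, P i (fun n => p n m)) : P i p := by
  induction i generalizing p with
  | zero => intro n; funext m; exact hp m n
  | succ i ih => intro h; apply ih; intro m; exact hp m h

lemma P_eval (k : ℕ) (q : Polynomial ℚ) (hq : q.natDegree ≤ k) :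
    P k (fun n : ℤ => q.eval (n : ℚ)) := by
  induction k generalizing q with
  | zero =>
    rw [Polynomial.eq_C_of_natDegree_le_zero hq]
    intro n; simp
  | succ k ih =>
    intro h
    have key : (q.comp (Polynomial.X + Polynomial.C (h : ℚ)) - q).natDegree ≤ k := by
      by_cases h0 : q.natDegree = 0
      · rw [Polynomial.eq_C_of_natDegree_eq_zero h0]; simp
      · have hne : q ≠ 0 := by rintro rfl; simp at h0
        have h1 : (q.comp (Polynomial.X + Polynomial.C (h : ℚ))).natDegree = q.natDegree := by
          rw [Polynomial.natDegree_comp, Polynomial.natDegree_X_add_C, mul_one]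
        have hne' : q.comp (Polynomial.X + Polynomial.C (h : ℚ)) ≠ 0 := by
          intro h2; rw [h2] at h1; simp at h1; exact h0 h1.symm
        have h2 := Polynomial.degree_sub_lt_left (p := q.comp (Polynomial.X + Polynomial.C (h : ℚ)))
          (q := q) (by rw [Polynomial.degree_eq_natDegree hne, Polynomial.degree_eq_natDegree hne',
            h1]) hne' (by
              rw [Polynomial.leadingCoeff_comp (by rw [Polynomial.natDegree_X_add_C]; simp),
                Polynomial.leadingCoeff_X_add_C]; simp)
        have h3 := Polynomial.natDegree_lt_natDegree (p := q.comp (Polynomial.X + Polynomial.C (h : ℚ)) - q)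
          (q := q.comp (Polynomial.X + Polynomial.C (h : ℚ)))
        by_cases h4 : q.comp (Polynomial.X + Polynomial.C (h : ℚ)) - q = 0
        · rw [h4]; simp
        · have := h3 h4 h2
          omega
    have := ih _ key
    simpa using this

lemma P_of_poly (p : ℤ → ℤ) (q : Polynomial ℚ) (h : ∀ n : ℤ, (p n : ℚ) = q.eval (n : ℚ)) :
    P q.natDegree p := by
  apply P_of_map (Int.castAddHom ℚ) (fun a b hab => by simpa using hab)
  have := P_eval q.natDegree q le_rfl
  simpa [h] using this

end polys

section vdw
variable {V : Type} [AddCommGroup V]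

/-- Finite (compact) form of the polynomial recurrence for colourings. -/
def Good (A : Finset (ℤ → V)) : Prop :=
  ∀ (κ : Type) [Finite κ], ∃ E : Set V, E.Finite ∧ ∃ B : Set ℤ, B.Finite ∧ (∀ n ∈ B, 0 < n) ∧
    ∀ c : V → κ, ∃ a ∈ E, ∃ n ∈ B, ∀ p ∈ A, c (a + p n) = c a

lemma focus (A : Finset (ℤ → V)) (hA0 : ∀ p ∈ A, p 0 = 0) (l : ℤ → V)
    (hgood : ∀ A' : Finset (ℤ → V), (∀ q ∈ A', q ≠ 0 ∧ ∃ p ∈ A, ∃ h, q = fun n => p (n + h) - p h - l n) →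
      Good A') : Good A := by
  classical
  intro κ _
  have CF : ∀ k : ℕ, ∃ E : Set V, E.Finite ∧ ∃ B : Set ℤ, B.Finite ∧ (∀ n ∈ B, 0 < n) ∧
      ∀ c : V → κ, (∃ a ∈ E, ∃ n ∈ B, ∀ p ∈ A, c (a + p n) = c a) ∨
        (∃ a ∈ E, ∃ S : Finset κ, S.card = k ∧ ∀ col ∈ S, ∃ n ∈ B, ∀ p ∈ A, c (a + p n) = col) := by
    intro k
    induction k with
    | zero =>
      exact ⟨{0}, Set.finite_singleton _, ∅, Set.finite_empty, by simp,
        fun c => Or.inr ⟨0, rfl, ∅, rfl, by simp⟩⟩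
    | succ k ih =>
      obtain ⟨E, hE, B, hB, hBpos, hc⟩ := ih
      -- the new family
      let B0 : Finset ℤ := insert 0 hB.toFinset
      let A' : Finset (ℤ → V) :=
        ((A ×ˢ B0).image (fun x => fun n => x.1 (n + x.2) - x.1 x.2 - l n)).filter (· ≠ 0)
      have hA' : Good A' := by
        apply hgood
        intro q hq
        simp only [A', Finset.mem_filter, Finset.mem_image, Finset.mem_product] at hq
        obtain ⟨⟨x, ⟨hx1, hx2⟩, rfl⟩, hne⟩ := hq
        exact ⟨hne, x.1, hx1, x.2, rfl⟩
      let Ehat : Set V := E ∪ ⋃ p ∈ A, (fun x : V × ℤ => x.1 + p x.2) '' (E ×ˢ B)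
      have hEhat : Ehat.Finite := by
        refine hE.union ?_
        exact Set.Finite.biUnion A.finite_toSet (fun p _ => (hE.prod hB).image _)
      have : Finite Ehat := hEhat
      obtain ⟨F, hF, G, hG, hGpos, hFG⟩ := hA' (Ehat → κ)
      refine ⟨(fun x : V × V => x.1 + x.2) '' (F ×ˢ E) ∪
        (fun x : (V × V) × ℤ => x.1.1 + x.1.2 - l x.2) '' ((F ×ˢ E) ×ˢ G), ?_,
        B ∪ G ∪ (fun x : ℤ × ℤ => x.1 + x.2) '' (G ×ˢ B), ?_, ?_, ?_⟩
      · exact ((hF.prod hE).image _).union (((hF.prod hE).prod hG).image _)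
      · exact (hB.union hG).union ((hG.prod hB).image _)
      · rintro n ((hn | hn) | ⟨x, ⟨hx1, hx2⟩, rfl⟩)
        · exact hBpos n hn
        · exact hGpos n hn
        · have := hGpos _ hx1
          have := hBpos _ hx2
          simp only; omega
      · intro c
        obtain ⟨b, hb, n, hn, hbn⟩ := hFG (fun b x => c (b + x))
        -- key equality
        have key : ∀ x ∈ Ehat, ∀ p ∈ A, ∀ h ∈ B0, c (b + x + (p (n + h) - p h - l n)) = c (b + x) := by
          intro x hx p hp h hh
          by_cases hz : (fun n => p (n + h) - p h - l n) = 0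
          · have := congrFun hz n
            simp only [Pi.zero_apply] at this
            rw [this, add_zero]
          · have := hbn (fun n => p (n + h) - p h - l n) (by
              simp only [A', Finset.mem_filter, Finset.mem_image, Finset.mem_product]
              exact ⟨⟨(p, h), ⟨hp, hh⟩, rfl⟩, hz⟩)
            have := congrFun this ⟨x, hx⟩
            simp only at this
            rw [← this]
            congr 1
            (try beta_reduce)
            abel
        rcases hc (fun v => c (b + v)) with ⟨a, ha, h, hh, hmono⟩ | ⟨a, ha, S, hS, hcol⟩
        · left
          refine ⟨b + a, Or.inl ⟨(b, a), ⟨hb, ha⟩, rfl⟩, h, Or.inl (Or.inl hh), ?_⟩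
          intro p hp
          rw [add_assoc]; exact hmono p hp
        · by_cases hmem : c (b + a) ∈ S
          · left
            obtain ⟨h, hh, hmono⟩ := hcol _ hmem
            refine ⟨b + a, Or.inl ⟨(b, a), ⟨hb, ha⟩, rfl⟩, h, Or.inl (Or.inl hh), ?_⟩
            intro p hp
            rw [add_assoc]; exact hmono p hp
          · right
            refine ⟨b + a - l n, Or.inr ⟨((b, a), n), ⟨⟨hb, ha⟩, hn⟩, rfl⟩,
              insert (c (b + a)) S, by rw [Finset.card_insert_of_notMem hmem, hS], ?_⟩
            intro col hc'
            rcases Finset.mem_insert.1 hc' with rfl | hc'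
            · refine ⟨n, Or.inl (Or.inr hn), ?_⟩
              intro p hp
              have := key a (Or.inl ha) p hp 0 (by simp [B0])
              rw [hA0 p hp] at this
              rw [← this]
              congr 1
              rw [add_zero]; abel
            · obtain ⟨h, hh, hmono⟩ := hcol _ hc'
              refine ⟨n + h, Or.inr ⟨(n, h), ⟨hn, hh⟩, rfl⟩, ?_⟩
              intro p hp
              have := key (a + p h) (Or.inr (by
                simp only [Set.mem_iUnion]
                exact ⟨p, hp, (a, h), ⟨ha, hh⟩, rfl⟩)) p hp h (by simp [B0, hh])
              rw [← hmono p hp, ← this]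
              congr 1
              (try beta_reduce)
              abel
  have := Fintype.ofFinite κ
  obtain ⟨E, hE, B, hB, hBpos, hc⟩ := CF (Fintype.card κ + 1)
  refine ⟨E, hE, B, hB, hBpos, fun c => ?_⟩
  rcases hc c with h | ⟨a, _, S, hS, _⟩
  · exact h
  · have := Finset.card_le_univ S
    omega

lemma pet (D : ℕ) (L : Fin D → Finset (ℤ → V)) :
    (∀ i, ∀ l ∈ L i, P (i + 1) l ∧ l 0 = 0) → ∀ A : Finset (ℤ → V),
    (∀ p ∈ A, p 0 = 0 ∧ ∃ i : Fin D, ∃ l ∈ L i, P i (fun n => p n - l n)) → Good A := by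
  classical
  have wf : WellFounded (Pi.Lex (fun i j : Fin D => i > j)
      (fun {_} (a b : ℕ) => a < b)) :=
    Pi.Lex.wellFounded _ (fun _ => wellFounded_lt)
  have wf' := InvImage.wf (fun L : Fin D → Finset (ℤ → V) => fun i => (L i).card) wf
  induction L using wf'.induction with
  | _ L IH =>
  intro hL A hA
  by_cases hne : ∃ j, (L j).Nonempty
  swap
  · -- no polynomials
    push Not at hne
    intro κ _
    refine ⟨{0}, Set.finite_singleton _, {1}, Set.finite_singleton _, by simp, fun c => ?_⟩
    refine ⟨0, rfl, 1, rfl, ?_⟩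
    intro p hp
    obtain ⟨-, i, l, hl, -⟩ := hA p hp
    rw [hne i] at hl
    simp at hl
  · obtain ⟨j, hj, hmin⟩ : ∃ j, (L j).Nonempty ∧ ∀ i, (L i).Nonempty → j ≤ i := by
      have h1 : (Finset.univ.filter (fun j => (L j).Nonempty)).Nonempty := by
        obtain ⟨j, hj⟩ := hne
        exact ⟨j, by simpa using hj⟩
      refine ⟨Finset.min' _ h1, ?_, ?_⟩
      · have := Finset.min'_mem _ h1
        simpa using this
      · intro i hi
        exact Finset.min'_le _ _ (by simpa using hi)
    obtain ⟨l, hl⟩ := hj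
    apply focus A (fun p hp => (hA p hp).1) l
    intro A' hA'
    let L' : Fin D → Finset (ℤ → V) := fun i =>
      if j < i then L i else if i = j then ((L j).erase l).image (fun m => fun n => m n - l n)
      else A'.filter (fun q => P (i + 1) q)
    have hl' := hL j l hl
    have hq0 : ∀ q ∈ A', q 0 = 0 := by
      intro q hq
      obtain ⟨_, p, hp, h, rfl⟩ := hA' q hq
      simp [hl'.2]
    apply IH L' _ _ A' _
    · refine ⟨j, ?_, ?_⟩
      · intro i hi
        simp only [L']
        rw [if_pos hi]
      · simp only [L']
        rw [if_neg (lt_irrefl _)]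
        simp only [if_true]
        refine lt_of_le_of_lt Finset.card_image_le ?_
        exact Finset.card_erase_lt_of_mem hl
    · intro i m hm
      simp only [L'] at hm
      split_ifs at hm with h1 h2
      · exact hL i m hm
      · subst h2
        simp only [Finset.mem_image, Finset.mem_erase] at hm
        obtain ⟨m', ⟨_, hm'⟩, rfl⟩ := hm
        refine ⟨P_sub (hL i m' hm').1 hl'.1, ?_⟩
        simp [(hL i m' hm').2, hl'.2]
      · rw [Finset.mem_filter] at hm
        exact ⟨hm.2, hq0 m hm.1⟩
    · intro q hq
      refine ⟨hq0 q hq, ?_⟩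
      obtain ⟨hqne, p, hp, h, hqe⟩ := hA' q hq
      obtain ⟨hp0, i, m, hm, hpm⟩ := hA p hp
      have hji : j ≤ i := hmin i ⟨m, hm⟩
      have hpi : P (i + 1) p := by
        have := P_add (P_succ hpm) (hL i m hm).1
        simpa using this
      have hbase : P i (fun n => (p (n + h) - p n) + (p n - m n) - p h) :=
        P_sub (P_add (hpi h) hpm) (P_const _ _)
      rcases hji.lt_or_eq with hlt | rfl
      · refine ⟨i, m, ?_, ?_⟩
        · simp only [L']; rw [if_pos hlt]; exact hm
        · have := P_sub hbase (P_mono (show (j : ℕ) + 1 ≤ i from hlt) hl'.1)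
          rw [hqe]
          convert this using 2
          (try beta_reduce)
          abel
      · by_cases hml : m = l
        · subst hml
          have hqP : P j q := by
            rw [hqe]
            convert hbase using 2
            (try beta_reduce)
            abel
          obtain ⟨j, hjD⟩ := j
          cases j with
          | zero =>
            exfalso
            apply hqne
            funext n
            have := hqP n
            rw [this, hq0 q hq]; rfl
          | succ j =>
            refine ⟨⟨j, by omega⟩, q, ?_, ?_⟩
            · simp only [L']
              rw [if_neg (by simp), if_neg (by simp)]
              rw [Finset.mem_filter]
              exact ⟨hq, hqP⟩
            · simpa using P_const j (0 : V)
        · refine ⟨j, fun n => m n - l n, ?_, ?_⟩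
          · simp only [L']
            rw [if_neg (lt_irrefl _)]
            simp only [if_true]
            exact Finset.mem_image.2 ⟨m, Finset.mem_erase.2 ⟨hml, hm⟩, rfl⟩
          · rw [hqe]
            convert hbase using 2
            (try beta_reduce)
            abel

/-- Polynomial van der Waerden theorem in an abelian group. -/
lemma poly_vdw (D : ℕ) (A : Finset (ℤ → V)) (hA : ∀ p ∈ A, p 0 = 0 ∧ P D p)
    {κ : Type} [Finite κ] (c : V → κ) : ∃ a : V, ∃ n : ℤ, 0 < n ∧ ∀ p ∈ A, c (a + p n) = c a := by
  classical
  have := pet (V := V) (D + 1) (fun i => A.filter (fun p => P (i + 1) p))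
    (by intro i l hl; rw [Finset.mem_filter] at hl; exact ⟨hl.2, (hA l hl.1).1⟩) A
    (by
      intro p hp
      refine ⟨(hA p hp).1, ⟨D, by omega⟩, p, ?_, ?_⟩
      · rw [Finset.mem_filter]; exact ⟨hp, P_succ (hA p hp).2⟩
      · simpa using P_const D (0 : V)) κ
  obtain ⟨E, _, B, _, hB, h⟩ := this
  obtain ⟨a, _, n, hn, hm⟩ := h c
  exact ⟨a, n, hB n hn, hm⟩

end vdw

end PRT

namespace PRT

section hp
variable {X : Type*} [TopologicalSpace X] (T : X ≃ₜ X)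

lemma hpowNat_eq (n : ℕ) : hpowNat T n = T ^ n := by
  induction n with
  | zero => rfl
  | succ n ih => rw [hpowNat, ih, pow_succ']; rfl

lemma hpowInt_eq (n : ℤ) : hpowInt T n = T ^ n := by
  cases n with
  | ofNat n => simp [hpowInt, hpowNat_eq]
  | negSucc n => rw [hpowInt, hpowNat_eq, zpow_negSucc]; rfl

lemma hpow_add (a b : ℤ) (x : X) : hpow T (a + b) x = hpow T a (hpow T b x) := by
  unfold hpow
  rw [hpowInt_eq, hpowInt_eq, hpowInt_eq, zpow_add]; rfl

lemma hpow_zero (x : X) : hpow T 0 x = x := rfl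

lemma hpow_neg (a : ℤ) (x : X) : hpow T (-a) (hpow T a x) = x := by
  rw [← hpow_add]; simp [hpow_zero]

lemma hpow_neg' (a : ℤ) (x : X) : hpow T a (hpow T (-a) x) = x := by
  rw [← hpow_add]; simp [hpow_zero]

lemma hpow_cont (a : ℤ) : Continuous (hpow T a) := (hpowInt T a).continuous

lemma cover [CompactSpace X] (hT : IsMinimalTDS T) {U : Set X} (hU : IsOpen U) (hne : U.Nonempty) :
    ∃ J : Finset ℤ, ∀ x, ∃ j ∈ J, hpow T j x ∈ U := by
  obtain ⟨J, hJ⟩ := isCompact_univ.elim_finite_subcover (fun j : ℤ => hpow T j ⁻¹' U)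
    (fun j => hU.preimage (hpow_cont T j)) (by
      intro x _
      obtain ⟨y, hy, n, rfl⟩ := (hT x).inter_open_nonempty U hU hne
      exact Set.mem_iUnion.2 ⟨n, hy⟩)
  refine ⟨J, fun x => ?_⟩
  have := hJ (Set.mem_univ x)
  simpa using this

end hp

section minimal
variable {Y : Type*} [TopologicalSpace Y]

/-- `M` is invariant under all the maps in `F`. -/
def Inv (F : Set (Y → Y)) (M : Set Y) : Prop := ∀ φ ∈ F, ∀ x ∈ M, φ x ∈ M

/-- minimal nonempty closed invariant sets -/
structure MinSet (F : Set (Y → Y)) (M : Set Y) : Prop where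
  closed : IsClosed M
  ne : M.Nonempty
  inv : Inv F M
  eq : ∀ N ⊆ M, IsClosed N → N.Nonempty → Inv F N → N = M

lemma exists_min [CompactSpace Y] (F : Set (Y → Y)) {K : Set Y} (hK : IsClosed K) (hne : K.Nonempty)
    (hinv : Inv F K) : ∃ M ⊆ K, MinSet F M := by
  obtain ⟨M, hMK, hM⟩ := zorn_superset_nonempty {N : Set Y | IsClosed N ∧ N.Nonempty ∧ Inv F N} (by
    intro c hc hchain hcne
    refine ⟨⋂₀ c, ⟨isClosed_sInter fun s hs => (hc hs).1, ?_, ?_⟩, fun s hs => Set.sInter_subset_of_mem hs⟩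
    · have : Nonempty c := hcne.to_subtype
      refine IsCompact.nonempty_sInter_of_directed_nonempty_isCompact_isClosed ?_
        (fun s hs => (hc hs).2.1) (fun s hs => (hc hs).1.isCompact) (fun s hs => (hc hs).1)
      intro s hs t ht
      rcases hchain.total hs ht with h | h
      · exact ⟨s, hs, subset_rfl, h⟩
      · exact ⟨t, ht, h, subset_rfl⟩
    · intro φ hφ x hx s hs
      exact (hc hs).2.2 φ hφ x (hx s hs)) K ⟨hK, hne, hinv⟩
  refine ⟨M, hMK, hM.prop.1, hM.prop.2.1, hM.prop.2.2, ?_⟩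
  intro N hN h1 h2 h3
  exact hM.eq_of_subset ⟨h1, h2, h3⟩ hN

lemma inv_closure {F : Set (Y → Y)} (hF : ∀ φ ∈ F, Continuous φ) {N : Set Y} (h : Inv F N) :
    Inv F (closure N) := by
  intro φ hφ x hx
  exact map_mem_closure (hF φ hφ) hx (fun y hy => h φ hφ y hy)

end minimal

set_option linter.unusedSectionVars false

section omega
variable {X : Type*} [TopologicalSpace X]

/-- translation of the index -/
def Sg (g : ℤ → ℤ) (f : (ℤ → ℤ) → X) : (ℤ → ℤ) → X := fun h => f (h + g)

/-- shift of the variable -/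
def sh (k : ℤ) (f : (ℤ → ℤ) → X) : (ℤ → ℤ) → X := fun h => f (fun n => h (n + k))

lemma Sg_cont (g : ℤ → ℤ) : Continuous (Sg (X := X) g) :=
  continuous_pi fun _ => continuous_apply _

lemma sh_cont (k : ℤ) : Continuous (sh (X := X) k) :=
  continuous_pi fun _ => continuous_apply _

lemma Sg_Sg (g g' : ℤ → ℤ) (f : (ℤ → ℤ) → X) : Sg g (Sg g' f) = Sg (g + g') f := by
  funext h; simp [Sg, add_assoc]

lemma Sg_zero (f : (ℤ → ℤ) → X) : Sg 0 f = f := by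
  funext h; simp [Sg]

lemma sh_Sg (k : ℤ) (g : ℤ → ℤ) (f : (ℤ → ℤ) → X) :
    sh k (Sg g f) = Sg (fun n => g (n - k)) (sh k f) := by
  funext h
  simp only [sh, Sg]
  congr 1
  funext n
  simp

lemma sh_sh (k l : ℤ) (f : (ℤ → ℤ) → X) : sh k (sh l f) = sh (l + k) f := by
  funext h
  simp [sh, add_assoc]

/-- the acting maps of level `i` -/
def Fam (X : Type*) (i : ℕ) : Set (((ℤ → ℤ) → X) → ((ℤ → ℤ) → X)) :=
  {φ | (∃ g, P i g ∧ φ = Sg g) ∨ ∃ k, φ = sh k}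

lemma Fam_cont (i : ℕ) : ∀ φ ∈ Fam X i, Continuous φ := by
  rintro φ (⟨g, _, rfl⟩ | ⟨k, rfl⟩)
  · exact Sg_cont g
  · exact sh_cont k

lemma Inv_Fam {i : ℕ} {M : Set ((ℤ → ℤ) → X)} :
    Inv (Fam X i) M ↔ (∀ g, P i g → ∀ f ∈ M, Sg g f ∈ M) ∧ ∀ k, ∀ f ∈ M, sh k f ∈ M := by
  constructor
  · intro h
    exact ⟨fun g hg f hf => h _ (Or.inl ⟨g, hg, rfl⟩) f hf, fun k f hf => h _ (Or.inr ⟨k, rfl⟩) f hf⟩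
  · rintro ⟨h1, h2⟩ φ (⟨g, hg, rfl⟩ | ⟨k, rfl⟩)
    · exact h1 g hg
    · exact h2 k

lemma P_shift_sub {i : ℕ} {g : ℤ → ℤ} (hg : P (i + 1) g) (k : ℤ) :
    P i ((fun n => g (n - k)) - g) := hg (-k)

lemma descent [CompactSpace X] [T2Space X] {i : ℕ} {M O : Set ((ℤ → ℤ) → X)}
    (hM : MinSet (Fam X (i + 1)) M) (hO : IsOpen O) (hMO : (M ∩ O).Nonempty) :
    ∃ M' ⊆ M, MinSet (Fam X i) M' ∧ (M' ∩ O).Nonempty := by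
  have hMi := Inv_Fam.1 hM.inv
  obtain ⟨M0, hM0M, hM0⟩ := exists_min (Fam X i) hM.closed hM.ne
    (Inv_Fam.2 ⟨fun g hg f hf => hMi.1 g (P_succ hg) f hf, hMi.2⟩)
  have hM0i := Inv_Fam.1 hM0.inv
  let N : Set ((ℤ → ℤ) → X) := {f | ∃ g, P (i + 1) g ∧ ∃ m ∈ M0, f = Sg g m}
  have hNM : N ⊆ M := by
    rintro _ ⟨g, hg, m, hm, rfl⟩
    exact hMi.1 g hg m (hM0M hm)
  have hNne : N.Nonempty := by
    obtain ⟨m, hm⟩ := hM0.ne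
    exact ⟨_, 0, P_const (i + 1) (0 : ℤ), m, hm, rfl⟩
  have hNinv : Inv (Fam X (i + 1)) N := by
    rw [Inv_Fam]
    constructor
    · rintro g hg _ ⟨g', hg', m, hm, rfl⟩
      exact ⟨g + g', P_add hg hg', m, hm, Sg_Sg _ _ _⟩
    · rintro k _ ⟨g', hg', m, hm, rfl⟩
      exact ⟨_, P_shift hg' (-k), sh k m, hM0i.2 k m hm, sh_Sg _ _ _⟩
  have hcl : closure N = M := hM.eq _ (closure_minimal hNM hM.closed) isClosed_closure hNne.closure
    (inv_closure (Fam_cont _) hNinv)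
  obtain ⟨f0, hf0M, hf0O⟩ := hMO
  rw [← hcl] at hf0M
  obtain ⟨_, hfO, g, hg, m, hm, rfl⟩ := mem_closure_iff.1 hf0M O hO hf0O
  refine ⟨Sg g '' M0, ?_, ⟨?_, hM0.ne.image _, ?_, ?_⟩, ⟨_, ⟨m, hm, rfl⟩, hfO⟩⟩
  · rintro _ ⟨m, hm, rfl⟩
    exact hMi.1 g hg m (hM0M hm)
  · exact (hM0.closed.isCompact.image (Sg_cont g)).isClosed
  · rw [Inv_Fam]
    constructor
    · rintro g' hg' _ ⟨m, hm, rfl⟩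
      exact ⟨Sg g' m, hM0i.1 g' hg' m hm, by rw [Sg_Sg, Sg_Sg, add_comm]⟩
    · rintro k _ ⟨m, hm, rfl⟩
      refine ⟨Sg ((fun n => g (n - k)) - g) (sh k m), hM0i.1 _ (P_shift_sub hg k) _ (hM0i.2 k m hm), ?_⟩
      rw [sh_Sg, Sg_Sg]; congr 1; abel
  · intro K hK hKc hKne hKinv
    have hKi := Inv_Fam.1 hKinv
    apply Set.Subset.antisymm hK
    have : M0 ∩ Sg g ⁻¹' K = M0 := by
      apply hM0.eq _ Set.inter_subset_left (hM0.closed.inter (hKc.preimage (Sg_cont g)))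
      · obtain ⟨x, hx⟩ := hKne
        obtain ⟨m, hm, rfl⟩ := hK hx
        exact ⟨m, hm, hx⟩
      · rw [Inv_Fam]
        constructor
        · rintro g' hg' m ⟨hm, hmK⟩
          refine ⟨hM0i.1 g' hg' m hm, ?_⟩
          have := hKi.1 g' hg' _ hmK
          rw [Sg_Sg, add_comm, ← Sg_Sg] at this
          exact this
        · rintro k m ⟨hm, hmK⟩
          refine ⟨hM0i.2 k m hm, ?_⟩
          have h1 := hKi.1 _ (P_neg (P_shift_sub hg k)) _ (hKi.2 k _ hmK)
          rw [sh_Sg, Sg_Sg] at h1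
          have h2 : ((fun n => -((fun n => g (n - k)) - g) n) + fun n => g (n - k)) = g := by
            funext n; simp
          rw [h2] at h1
          exact h1
    rintro _ ⟨m, hm, rfl⟩
    rw [← this] at hm
    exact hm.2

lemma descent_all [CompactSpace X] [T2Space X] (i : ℕ) {M O : Set ((ℤ → ℤ) → X)}
    (hM : MinSet (Fam X i) M) (hO : IsOpen O) (hMO : (M ∩ O).Nonempty) :
    ∃ M' ⊆ M, MinSet (Fam X 0) M' ∧ (M' ∩ O).Nonempty := by
  induction i generalizing M with
  | zero => exact ⟨M, subset_rfl, hM, hMO⟩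
  | succ i ih =>
    obtain ⟨M1, h1, h2, h3⟩ := descent hM hO hMO
    obtain ⟨M2, h4, h5, h6⟩ := ih h2 h3
    exact ⟨M2, h4.trans h1, h5, h6⟩

/-- the basic points -/
def pt (T : X ≃ₜ X) (x : X) (n : ℤ) : (ℤ → ℤ) → X := fun g => hpow T (g n) x

/-- the orbit-type space -/
def Om (T : X ≃ₜ X) : Set ((ℤ → ℤ) → X) := closure {f | ∃ x n, f = pt T x n}

lemma Om_inv (T : X ≃ₜ X) (i : ℕ) : Inv (Fam X i) (Om T) := by
  apply inv_closure (Fam_cont i)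
  rw [Inv_Fam]
  constructor
  · rintro g _ _ ⟨x, n, rfl⟩
    refine ⟨hpow T (g n) x, n, ?_⟩
    funext h
    simp only [Sg, pt, Pi.add_apply]
    rw [hpow_add]
  · rintro k _ ⟨x, n, rfl⟩
    exact ⟨x, n + k, rfl⟩

lemma Om_const [T2Space X] (T : X ≃ₜ X) {f : (ℤ → ℤ) → X} (hf : f ∈ Om T) (g : ℤ → ℤ) (c : ℤ) :
    f (fun n => g n + c) = hpow T c (f g) := by
  have hc : IsClosed {f : (ℤ → ℤ) → X | f (fun n => g n + c) = hpow T c (f g)} :=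
    isClosed_eq (continuous_apply _) ((hpow_cont T c).comp (continuous_apply g))
  refine closure_minimal ?_ hc hf
  rintro _ ⟨x, n, rfl⟩
  simp only [pt, Set.mem_ofPred_eq]
  rw [add_comm, hpow_add]

/-- the polynomial subgroup -/
def PolyGrp (D : ℕ) : AddSubgroup (ℤ → ℤ) where
  carrier := {g | P D g}
  add_mem' := fun ha hb => P_add ha hb
  zero_mem' := P_const D (0 : ℤ)
  neg_mem' := fun ha => P_neg ha

lemma base [CompactSpace X] [T2Space X] [Nonempty X] (T : X ≃ₜ X) (hT : IsMinimalTDS T) {U : Set X}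
    (hU : IsOpen U) (hne : U.Nonempty) (D d : ℕ) (p : Fin d → ℤ → ℤ) (hp0 : ∀ i, p i 0 = 0)
    (hp : ∀ i, P D (p i)) :
    ∃ e : ℤ, 0 < e ∧ ∃ M ⊆ Om T, MinSet (Fam X 0) M ∧
      ∃ f ∈ M, f 0 ∈ U ∧ ∀ i, f (fun n => p i (e * n)) ∈ U := by
  classical
  have hOne : (Om T).Nonempty := by
    obtain ⟨x⟩ := ‹Nonempty X›
    exact ⟨pt T x 0, subset_closure ⟨x, 0, rfl⟩⟩
  obtain ⟨M, hMO, hM⟩ := exists_min (Fam X D) (isClosed_closure : IsClosed (Om T)) hOne (Om_inv T D)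
  obtain ⟨f, hf⟩ := hM.ne
  obtain ⟨J, hJ⟩ := cover T hT hU hne
  choose col hcolJ hcol using hJ
  let c : PolyGrp D → J := fun g => ⟨col (f g.1), hcolJ _⟩
  let q : Fin d → ℤ → PolyGrp D := fun i e => ⟨fun n => p i (e * n), P_scale (hp i) e⟩
  obtain ⟨g, e, he, hge⟩ := poly_vdw D (Finset.univ.image q) (by
    intro r hr
    obtain ⟨i, -, rfl⟩ := Finset.mem_image.1 hr
    constructor
    · apply Subtype.ext; funext n; simp [q, hp0]
    · apply P_of_map (PolyGrp D).subtype Subtype.val_injective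
      apply P_pi
      intro m
      have := P_scale (hp i) m
      simpa [q, mul_comm] using this) c
  let j := col (f g.1)
  have hMi := Inv_Fam.1 hM.inv
  let f' := Sg (fun n => g.1 n + j) f
  have hf' : f' ∈ M := hMi.1 _ (P_add g.2 (P_const D j)) f hf
  have hf'v : ∀ h, f' h = hpow T j (f (h + g.1)) := by
    intro h
    rw [← Om_const T (hMO hf)]
    simp only [f', Sg]
    congr 1
    funext n
    simp [add_assoc]
  have h0 : f' 0 ∈ U := by
    rw [hf'v, zero_add]; exact hcol _
  have h1 : ∀ i, f' (fun n => p i (e * n)) ∈ U := by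
    intro i
    have := hge (q i) (Finset.mem_image_of_mem _ (Finset.mem_univ i))
    have h2 : col (f (g.1 + (q i e).1)) = j := congrArg Subtype.val this
    rw [hf'v, add_comm, ← h2]
    exact hcol _
  have hOpen : IsOpen {f : (ℤ → ℤ) → X | f 0 ∈ U ∧ ∀ i, f (fun n => p i (e * n)) ∈ U} := by
    refine (hU.preimage (continuous_apply _)).inter ?_
    have : {f : (ℤ → ℤ) → X | ∀ i, f (fun n => p i (e * n)) ∈ U} =
      ⋂ i, {f : (ℤ → ℤ) → X | f (fun n => p i (e * n)) ∈ U} := by ext; simp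
    change IsOpen {f : (ℤ → ℤ) → X | ∀ i, f (fun n => p i (e * n)) ∈ U}
    rw [this]
    exact isOpen_iInter_of_finite fun i => hU.preimage (continuous_apply _)
  obtain ⟨M', hM'M, hM', f'', hf'', h0, h1⟩ := descent_all D hM hOpen ⟨f', hf', h0, h1⟩
  exact ⟨e, he, M', hM'M.trans hMO, hM', f'', hf'', h0, h1⟩

end omega
end PRT

namespace PRT

section loc
variable {X : Type*} [TopologicalSpace X]

/-- points with a long block of syndetic return times -/
def Blk (T : X ≃ₜ X) {d : ℕ} (p : Fin d → ℤ → ℤ) (N L : ℕ) (V : Set X) : Set X :=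
  {x | ∃ a : ℤ, ∀ i : ℤ, a ≤ i → i + N ≤ a + L → ∃ j : ℤ, i ≤ j ∧ j ≤ i + N ∧
    ∀ t, hpow T (p t j) x ∈ V}

lemma Blk_mono (T : X ≃ₜ X) {d : ℕ} (p : Fin d → ℤ → ℤ) (N L : ℕ) {V V' : Set X} (h : V ⊆ V') :
    Blk T p N L V ⊆ Blk T p N L V' := by
  rintro x ⟨a, ha⟩
  refine ⟨a, fun i h1 h2 => ?_⟩
  obtain ⟨j, h3, h4, h5⟩ := ha i h1 h2
  exact ⟨j, h3, h4, fun t => h (h5 t)⟩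

lemma Blk_open (T : X ≃ₜ X) {d : ℕ} (p : Fin d → ℤ → ℤ) (N L : ℕ) {V : Set X} (hV : IsOpen V) :
    IsOpen (Blk T p N L V) := by
  have : Blk T p N L V = ⋃ a : ℤ, ⋂ i ∈ Finset.Icc a (a + L - N), ⋃ j ∈ Finset.Icc i (i + N),
      ⋂ t, hpow T (p t j) ⁻¹' V := by
    ext x
    simp only [Blk, Set.mem_ofPred_eq, Set.mem_iUnion, Set.mem_iInter, Finset.mem_Icc,
      Set.mem_preimage, exists_prop, and_imp, and_assoc]
    constructor
    · rintro ⟨a, h⟩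
      exact ⟨a, fun i h1 h2 => h i h1 (by omega)⟩
    · rintro ⟨a, h⟩
      exact ⟨a, fun i h1 h2 => h i h1 (by omega)⟩
  rw [this]
  refine isOpen_iUnion fun a => isOpen_biInter_finset fun i _ => isOpen_biUnion fun j _ =>
    isOpen_iInter_of_finite fun t => hV.preimage (hpow_cont T _)

lemma P0_const {g : ℤ → ℤ} (hg : P 0 g) : g = fun _ => g 0 := funext hg

lemma sh_Sg_const (k m : ℤ) (f : (ℤ → ℤ) → X) :
    sh k (Sg (fun _ => m) f) = Sg (fun _ => m) (sh k f) := sh_Sg _ _ _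

lemma sh_at_zero (k : ℤ) (f : (ℤ → ℤ) → X) : sh k f 0 = f 0 := rfl

lemma Sg_const_zero [T2Space X] (T : X ≃ₜ X) {f : (ℤ → ℤ) → X} (hf : f ∈ Om T) (m : ℤ) :
    Sg (fun _ => m) f 0 = hpow T m (f 0) := Om_const T hf 0 m

lemma fiber [CompactSpace X] [T2Space X] (T : X ≃ₜ X) (hT : IsMinimalTDS T)
    {M O : Set ((ℤ → ℤ) → X)} (hMO : M ⊆ Om T) (hM : MinSet (Fam X 0) M) (hO : IsOpen O)
    (hne : (M ∩ O).Nonempty) (x : X) :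
    ∃ m : ℤ, ∃ N : ℕ, ∃ f ∈ M, f 0 = hpow T m x ∧
      ∀ n : ℤ, ∃ k ∈ Finset.range (N + 1), sh (n + (k : ℤ)) f ∈ O := by
  have hMi := Inv_Fam.1 hM.inv
  have hMc : ∀ m : ℤ, ∀ f ∈ M, Sg (fun _ => m) f ∈ M := fun m f hf => hMi.1 _ (P_const 0 m) f hf
  -- surjectivity
  have hsurj : (fun f : (ℤ → ℤ) → X => f 0) '' M = Set.univ := by
    have hc : IsClosed ((fun f : (ℤ → ℤ) → X => f 0) '' M) :=
      (hM.closed.isCompact.image (continuous_apply 0)).isClosed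
    obtain ⟨f, hf⟩ := hM.ne
    have hd : Dense ((fun f : (ℤ → ℤ) → X => f 0) '' M) := by
      refine (hT (f 0)).mono ?_
      rintro _ ⟨n, rfl⟩
      exact ⟨_, hMc n f hf, Sg_const_zero T (hMO hf) n⟩
    rw [← hc.closure_eq]; exact hd.closure_eq
  let K : Set ((ℤ → ℤ) → X) := M ∩ {f | f 0 = x}
  have hKc : IsClosed K := hM.closed.inter (isClosed_eq (continuous_apply 0) continuous_const)
  have hKne : K.Nonempty := by
    have : x ∈ (fun f : (ℤ → ℤ) → X => f 0) '' M := by rw [hsurj]; trivial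
    obtain ⟨f, hf, hfx⟩ := this
    exact ⟨f, hf, hfx⟩
  let F : Set (((ℤ → ℤ) → X) → ((ℤ → ℤ) → X)) := {φ | ∃ k, φ = sh k}
  have hFc : ∀ φ ∈ F, Continuous φ := by
    rintro _ ⟨k, rfl⟩; exact sh_cont k
  have hKi : Inv F K := by
    rintro _ ⟨k, rfl⟩ f ⟨hf, hfx⟩
    exact ⟨hMi.2 k f hf, hfx⟩
  obtain ⟨M3, hM3K, hM3⟩ := exists_min F hKc hKne hKi
  have hM3i : ∀ k, ∀ f ∈ M3, sh k f ∈ M3 := fun k f hf => hM3.inv _ ⟨k, rfl⟩ f hf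
  obtain ⟨f, hf⟩ := hM3.ne
  have hfM := (hM3K hf).1
  -- the full orbit meets O
  obtain ⟨m, n0, hmn⟩ : ∃ m n : ℤ, Sg (fun _ => m) (sh n f) ∈ O := by
    let Z : Set ((ℤ → ℤ) → X) := {g | ∃ m n : ℤ, g = Sg (fun _ => m) (sh n f)}
    have hZM : Z ⊆ M := by
      rintro _ ⟨m, n, rfl⟩
      exact hMc m _ (hMi.2 n f hfM)
    have hZi : Inv (Fam X 0) Z := by
      rw [Inv_Fam]
      constructor
      · rintro g hg _ ⟨m, n, rfl⟩
        rw [P0_const hg]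
        exact ⟨g 0 + m, n, Sg_Sg _ _ _⟩
      · rintro k _ ⟨m, n, rfl⟩
        exact ⟨m, n + k, by rw [sh_Sg_const, sh_sh]⟩
    have hcl : closure Z = M := hM.eq _ (closure_minimal hZM hM.closed) isClosed_closure
      (Set.Nonempty.closure ⟨_, 0, 0, rfl⟩) (inv_closure (Fam_cont _) hZi)
    obtain ⟨h, hhM, hhO⟩ := hne
    rw [← hcl] at hhM
    obtain ⟨_, hO', m, n, rfl⟩ := mem_closure_iff.1 hhM O hO hhO
    exact ⟨m, n, hO'⟩
  let O' : Set ((ℤ → ℤ) → X) := Sg (fun _ => m) ⁻¹' O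
  have hO' : IsOpen O' := hO.preimage (Sg_cont _)
  have hhit : ∀ f' ∈ M3, ∃ n : ℤ, sh n f' ∈ O' := by
    intro f' hf'
    let Z : Set ((ℤ → ℤ) → X) := {g | ∃ n : ℤ, g = sh n f'}
    have hZM : Z ⊆ M3 := by
      rintro _ ⟨n, rfl⟩
      exact hM3i n f' hf'
    have hZi : Inv F Z := by
      rintro _ ⟨k, rfl⟩ _ ⟨n, rfl⟩
      exact ⟨n + k, sh_sh _ _ _⟩
    have hcl : closure Z = M3 := hM3.eq _ (closure_minimal hZM hM3.closed) isClosed_closure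
      (Set.Nonempty.closure ⟨_, 0, rfl⟩) (inv_closure hFc hZi)
    have h1 : sh n0 f ∈ closure Z := by rw [hcl]; exact hM3i n0 f hf
    obtain ⟨_, hO'', n, rfl⟩ := mem_closure_iff.1 h1 O' hO' hmn
    exact ⟨n, hO''⟩
  obtain ⟨J, hJ⟩ := hM3.closed.isCompact.elim_finite_subcover (fun n : ℤ => sh n ⁻¹' O')
    (fun n => hO'.preimage (sh_cont n)) (fun f' hf' => Set.mem_iUnion.2 (hhit f' hf'))
  obtain ⟨R, hR⟩ : ∃ R : ℕ, ∀ j ∈ J, j.natAbs ≤ R := ⟨J.sup Int.natAbs, fun j hj => Finset.le_sup hj⟩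
  refine ⟨m, 2 * R, Sg (fun _ => m) f, hMc m f hfM, ?_, ?_⟩
  · rw [Sg_const_zero T (hMO hfM), (hM3K hf).2]
  · intro n
    have := hJ (hM3i (n + R) f hf)
    simp only [Set.mem_iUnion, Set.mem_preimage] at this
    obtain ⟨j, hj, hj2⟩ := this
    have hjR := hR j hj
    refine ⟨(R + j).toNat, ?_, ?_⟩
    · rw [Finset.mem_range]; omega
    · rw [sh_sh] at hj2
      rw [sh_Sg_const, show n + ((R + j).toNat : ℤ) = n + R + j by omega]
      exact hj2

lemma loc [CompactSpace X] [T2Space X] (T : X ≃ₜ X) (hT : IsMinimalTDS T) (D d : ℕ)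
    (p : Fin d → ℤ → ℤ) (hp0 : ∀ i, p i 0 = 0) (hp : ∀ i, P D (p i)) {V : Set X}
    (hV : IsOpen V) (hVne : V.Nonempty) :
    ∃ N : ℕ, ∃ W ⊆ V, IsOpen W ∧ W.Nonempty ∧ ∀ L : ℕ, W ⊆ closure (Blk T p N L V) := by
  obtain ⟨v, hv⟩ := hVne
  have : Nonempty X := ⟨v⟩
  obtain ⟨C, hCv, hCc, hCV⟩ := exists_mem_nhds_isClosed_subset (hV.mem_nhds hv)
  obtain ⟨e, he, M, hMO, hM, f0, hf0, hf0U, hf0p⟩ := base T hT (isOpen_interior (s := C))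
    ⟨v, mem_interior_iff_mem_nhds.2 hCv⟩ D d p hp0 hp
  let O : Set ((ℤ → ℤ) → X) := {f | f 0 ∈ interior C} ∩ ⋂ i, {f | f (fun n => p i (e * n)) ∈ interior C}
  have hO : IsOpen O := (isOpen_interior.preimage (continuous_apply _)).inter
    (isOpen_iInter_of_finite fun i => isOpen_interior.preimage (continuous_apply _))
  let Oc : Set ((ℤ → ℤ) → X) := {f | f 0 ∈ C} ∩ ⋂ i, {f | f (fun n => p i (e * n)) ∈ C}
  have hOc : IsClosed Oc := (hCc.preimage (continuous_apply _)).inter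
    (isClosed_iInter fun i => hCc.preimage (continuous_apply _))
  have hOOc : O ⊆ Oc := by
    rintro f ⟨h1, h2⟩
    refine ⟨interior_subset (s := C) h1, ?_⟩
    rw [Set.mem_iInter] at h2 ⊢
    exact fun i => interior_subset (s := C) (h2 i)
  have hfib := fiber T hT hMO hM hO ⟨f0, hf0, hf0U, Set.mem_iInter.2 hf0p⟩
  let K : ℕ → Set ((ℤ → ℤ) → X) := fun N => M ∩ ⋂ n : ℤ, ⋃ k ∈ Finset.range (N + 1), sh (n + (k : ℤ)) ⁻¹' Oc
  have hK : ∀ N, IsClosed (K N) := fun N => hM.closed.inter (isClosed_iInter fun n =>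
    Set.Finite.isClosed_biUnion (Finset.finite_toSet _) fun k _ => hOc.preimage (sh_cont _))
  let E : ℕ → Set X := fun N => (fun f : (ℤ → ℤ) → X => f 0) '' K N
  have hE : ∀ N, IsClosed (E N) := fun N => ((hK N).isCompact.image (continuous_apply 0)).isClosed
  have hcov : ⋃ q : ℤ × ℕ, hpow T q.1 ⁻¹' E q.2 = Set.univ := by
    rw [Set.eq_univ_iff_forall]
    intro x
    obtain ⟨m, N, f, hf, hfx, hfn⟩ := hfib x
    refine Set.mem_iUnion.2 ⟨(m, N), f, ⟨hf, ?_⟩, hfx⟩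
    rw [Set.mem_iInter]
    intro n
    obtain ⟨k, hk, hkO⟩ := hfn n
    exact Set.mem_biUnion hk (hOOc hkO)
  obtain ⟨⟨m, N⟩, hmN⟩ := nonempty_interior_of_iUnion_of_closed
    (fun q : ℤ × ℕ => (hE q.2).preimage (hpow_cont T q.1)) hcov
  let W : Set X := hpow T (-m) ⁻¹' interior (hpow T m ⁻¹' E N)
  have hWE : W ⊆ E N := by
    intro y hy
    have := interior_subset hy
    rw [Set.mem_preimage, hpow_neg'] at this
    exact this
  refine ⟨(e * (N + 1)).toNat, W, ?_, isOpen_interior.preimage (hpow_cont T _), ?_, ?_⟩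
  · intro y hy
    obtain ⟨f, ⟨-, hf⟩, rfl⟩ := hWE hy
    have := Set.mem_iInter.1 hf 0
    simp only [Set.mem_iUnion] at this
    obtain ⟨k, -, hk⟩ := this
    exact hCV hk.1
  · obtain ⟨y, hy⟩ := hmN
    refine ⟨hpow T m y, ?_⟩
    simp only [W, Set.mem_preimage]
    rw [hpow_neg]; exact hy
  · intro L x hx
    rw [mem_closure_iff]
    intro o ho hxo
    obtain ⟨f, ⟨hfM, hf⟩, rfl⟩ := hWE hx
    have hf' : ∀ n : ℤ, ∃ k ∈ Finset.range (N + 1), sh (n + (k : ℤ)) f ∈ Oc := by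
      intro n
      have := Set.mem_iInter.1 hf n
      simp only [Set.mem_iUnion] at this
      obtain ⟨k, hk, hk2⟩ := this
      exact ⟨k, hk, hk2⟩
    choose k hkN hkO using hf'
    let Q : Set ((ℤ → ℤ) → X) := {f | f 0 ∈ o} ∩ ⋂ n ∈ Finset.Icc (0 : ℤ) L, ⋂ t,
      {f | f (fun m => p t (e * (m + (n + k n)))) ∈ V}
    have hQ : IsOpen Q := (ho.preimage (continuous_apply _)).inter
      (isOpen_biInter_finset fun n _ => isOpen_iInter_of_finite fun t =>
        hV.preimage (continuous_apply _))
    have hfQ : f ∈ Q := by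
      refine ⟨hxo, ?_⟩
      simp only [Set.mem_iInter]
      intro n _ t
      exact hCV (Set.mem_iInter.1 (hkO n).2 t)
    obtain ⟨_, ⟨hyo, hyQ⟩, y, b, rfl⟩ := mem_closure_iff.1 (hMO hfM) Q hQ hfQ
    refine ⟨y, hyo, e * b, ?_⟩
    intro i hi1 hi2
    have hN' : (((e * (N + 1)).toNat : ℕ) : ℤ) = e * N + e := by
      rw [Int.toNat_of_nonneg (by positivity)]; ring
    rw [hN'] at hi2 ⊢
    set n : ℤ := (i - e * b) / e + 1 with hn
    have h1 := Int.mul_ediv_add_emod (i - e * b) e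
    have h2 := Int.emod_nonneg (i - e * b) he.ne'
    have h3 := Int.emod_lt_of_pos (i - e * b) he
    have hq0 : 0 ≤ (i - e * b) / e := Int.ediv_nonneg (by omega) he.le
    have hqe : (i - e * b) / e ≤ i - e * b := Int.ediv_le_self _ (by omega)
    have heN : 0 ≤ e * N := by positivity
    have hnL : n ∈ Finset.Icc (0 : ℤ) L := by
      rw [Finset.mem_Icc]; omega
    have hk := Finset.mem_range.1 (hkN n)
    refine ⟨e * (b + (n + k n)), ?_, ?_, ?_⟩
    · have : e * (b + (n + k n)) = e * b + e * ((i - e * b) / e) + e + e * k n := by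
        rw [hn]; ring
      have : 0 ≤ e * (k n : ℤ) := by positivity
      omega
    · have : e * (b + (n + k n)) = e * b + e * ((i - e * b) / e) + e + e * k n := by
        rw [hn]; ring
      have : e * (k n : ℤ) ≤ e * N := by
        apply mul_le_mul_of_nonneg_left _ he.le
        omega
      omega
    · intro t
      simp only [Set.mem_iInter] at hyQ
      exact hyQ n hnL t

lemma residual_block [CompactSpace X] [T2Space X] (T : X ≃ₜ X) (hT : IsMinimalTDS T) (D d : ℕ)
    (p : Fin d → ℤ → ℤ) (hp0 : ∀ i, p i 0 = 0) (hp : ∀ i, P D (p i)) {V : Set X}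
    (hV : IsOpen V) :
    {x | x ∈ V → ∃ N : ℕ, ∀ L : ℕ, x ∈ Blk T p N L V} ∈ residual X := by
  have hdo : ∀ A : Set X, IsOpen A → A ∪ (closure A)ᶜ ∈ residual X := by
    intro A hA
    apply residual_of_dense_open (hA.union isClosed_closure.isOpen_compl)
    intro x
    by_cases hx : x ∈ closure A
    · exact closure_mono Set.subset_union_left hx
    · exact subset_closure (Or.inr hx)
  let O : Set X := ⋃ N : ℕ, interior (⋂ L : ℕ, closure (Blk T p N L V))
  have hO : IsOpen O := isOpen_iUnion fun _ => isOpen_interior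
  have hVO : V ⊆ closure O := by
    intro x hx
    rw [mem_closure_iff]
    intro o ho hxo
    obtain ⟨N, W, hWV, hWo, hWne, hWL⟩ := loc T hT D d p hp0 hp (hV.inter ho) ⟨x, hx, hxo⟩
    obtain ⟨w, hw⟩ := hWne
    refine ⟨w, (hWV hw).2, Set.mem_iUnion.2 ⟨N, ?_⟩⟩
    refine mem_interior.2 ⟨W, ?_, hWo, hw⟩
    exact Set.subset_iInter fun L => (hWL L).trans
      (closure_mono (Blk_mono T p N L Set.inter_subset_left))
  have h1 : (⋂ q : ℕ × ℕ, (Blk T p q.1 q.2 V ∪ (closure (Blk T p q.1 q.2 V))ᶜ)) ∈ residual X :=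
    countable_iInter_mem.2 fun q => hdo _ (Blk_open T p _ _ hV)
  filter_upwards [h1, hdo O hO] with x hx1 hx2 hxV
  rcases hx2 with hx2 | hx2
  · obtain ⟨N, hN⟩ := Set.mem_iUnion.1 hx2
    refine ⟨N, fun L => ?_⟩
    have h3 := Set.mem_iInter.1 (interior_subset hN) L
    rcases Set.mem_iInter.1 hx1 (N, L) with h4 | h4
    · exact h4
    · exact absurd h3 h4
  · exact absurd (hVO hxV) hx2

end loc

lemma ps_of_blocks (A : Set ℤ) (N : ℕ) (h : ∀ L : ℕ, ∃ a : ℤ, ∀ i : ℤ, a ≤ i → i + N ≤ a + L →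
    ∃ j : ℤ, i ≤ j ∧ j ≤ i + N ∧ j ∈ A) : PiecewiseSyndetic A := by
  choose a ha using h
  let Th : Set ℤ := A ∪ {j | ∃ L : ℕ, a (L + 2 * N) ≤ j ∧ j ≤ a (L + 2 * N) + (L + 2 * N : ℕ)}
  refine ⟨A ∪ Thᶜ, Th, ⟨2 * N, ?_⟩, ?_, ?_⟩
  · intro i
    by_cases hm : i + N ∈ A ∪ Thᶜ
    · exact ⟨i + N, by omega, by push_cast; omega, hm⟩
    · have h1 : i + N ∈ Th := by
        by_contra hc; exact hm (Or.inr hc)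
      rcases h1 with h1 | ⟨L, h1, h2⟩
      · exact absurd (Or.inl h1) hm
      · by_cases h3 : i + N + N ≤ a (L + 2 * N) + (L + 2 * N : ℕ)
        · obtain ⟨j, h4, h5, h6⟩ := ha (L + 2 * N) (i + N) h1 h3
          exact ⟨j, by omega, by push_cast; omega, Or.inl h6⟩
        · obtain ⟨j, h4, h5, h6⟩ := ha (L + 2 * N) i (by push_cast at *; omega) h2
          exact ⟨j, by omega, by push_cast; omega, Or.inl h6⟩
  · intro L
    refine ⟨a (L + 2 * N), fun j h1 h2 => Or.inr ⟨L, h1, by push_cast; omega⟩⟩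
  · ext j
    constructor
    · intro hj; exact ⟨Or.inl hj, Or.inl hj⟩
    · rintro ⟨h1 | h1, h2⟩
      · exact h1
      · exact absurd h2 h1

end PRT

/-- **Corollary (HSY22-1, Theorem C).** Let `(X,T)` be a minimal t.d.s. and `p 0, …,
p (d-1)` integral polynomials with `p i 0 = 0` and `deg (p i) ≥ 2`. Then there is a dense
`Gδ` subset `X₀` such that for each `x ∈ X₀` and each neighbourhood `U` of `x`, the set
`N(x,U) = {n ∈ ℤ : T^{p i (n)} x ∈ U ∀ i}` is piecewise syndetic. -/
theorem polynomial_return_times_piecewise_syndetic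
    {X : Type*} [MetricSpace X] [CompactSpace X] (T : X ≃ₜ X) (hT : IsMinimalTDS T)
    (d : ℕ) (p : Fin d → ℤ → ℤ) (hp : ∀ i, IsNonlinearIntPoly0 (p i)) :
    ∃ X₀ : Set X, IsGδ X₀ ∧ Dense X₀ ∧ ∀ x ∈ X₀, ∀ U ∈ 𝓝 x,
      PiecewiseSyndetic {n : ℤ | ∀ i : Fin d, hpow T (p i n) x ∈ U} := by

  have : SecondCountableTopology X := inferInstance
  have hP : ∃ D, ∀ i, PRT.P D (p i) := by
    choose q hq _ using fun i => (hp i).2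
    refine ⟨Finset.univ.sup fun i => (q i).natDegree, fun i => ?_⟩
    exact PRT.P_mono (Finset.le_sup (f := fun i => (q i).natDegree) (Finset.mem_univ i))
      (PRT.P_of_poly (p i) (q i) (hq i))
  obtain ⟨D, hD⟩ := hP
  have hres : (⋂ V ∈ TopologicalSpace.countableBasis X,
      {x | x ∈ V → ∃ N : ℕ, ∀ L : ℕ, x ∈ PRT.Blk T p N L V}) ∈ residual X := by
    rw [countable_bInter_mem (TopologicalSpace.countable_countableBasis X)]
    intro V hV
    exact PRT.residual_block T hT D d p (fun i => (hp i).1) hD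
      (TopologicalSpace.isOpen_of_mem_countableBasis hV)
  obtain ⟨X₀, hsub, hG, hd⟩ := mem_residual.1 hres
  refine ⟨X₀, hG, hd, fun x hx U hU => ?_⟩
  obtain ⟨V, hVb, hxV, hVU⟩ :=
    (TopologicalSpace.isBasis_countableBasis X).mem_nhds_iff.1 hU
  have h1 := Set.mem_iInter₂.1 (hsub hx) V hVb
  obtain ⟨N, hN⟩ := h1 hxV
  refine PRT.ps_of_blocks _ N fun L => ?_
  obtain ⟨a, ha⟩ := hN L
  refine ⟨a, fun i h2 h3 => ?_⟩
  obtain ⟨j, h4, h5, h6⟩ := ha i h2 h3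
  exact ⟨j, h4, h5, fun t => hVU (h6 t)⟩
end
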